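/- Let I(1) = ∫₀^∞∫₀^∞∫₀^∞ [ (1+x₁+x₂+x₃)(1+x₁⁻¹+x₂⁻¹+x₃⁻¹) − 1 ]⁻¹ (dx₁/x₁)(dx₂/x₂)(dx₃/x₃). Then I(1) = Γ(1/15)·Γ(2/15)·Γ(4/15)·Γ(8/15) / (30√5). -/

import Mathlib

open MeasureTheory

/-- The three-banana Feynman integral `I(t)`. -/
noncomputable def feynmanI (t : ℝ) : ℝ :=
  ∫ x₁ in Set.Ioi (0 : ℝ), ∫ x₂ in Set.Ioi (0 : ℝ), ∫ x₃ in Set.Ioi (0 : ℝ),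
    ((1 + x₁ + x₂ + x₃) * (1 + x₁⁻¹ + x₂⁻¹ + x₃⁻¹) - t)⁻¹ / (x₁ * x₂ * x₃)

theorem lintegral_cov {s t : Set ℝ} (hs : MeasurableSet s) {φ φ' F G : ℝ → ℝ}
    (hd : ∀ x ∈ s, HasDerivAt φ (φ' x) x) (hinj : Set.InjOn φ s) (himg : φ '' s = t)
    (hFG : ∀ x ∈ s, F x = |φ' x| * G (φ x)) :
    ∫⁻ y in t, ENNReal.ofReal (G y) = ∫⁻ x in s, ENNReal.ofReal (F x) := by
  rw [← himg, lintegral_image_eq_lintegral_abs_deriv_mul hs (fun x hx => (hd x hx).hasDerivWithinAt)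
    hinj]
  refine setLIntegral_congr_fun hs fun x hx => ?_
  simp only [hFG x hx, ENNReal.ofReal_mul (abs_nonneg _)]

theorem lintegral_cov_inv {s t : Set ℝ} (hs : MeasurableSet s) {φ φ' F G : ℝ → ℝ} (ψ : ℝ → ℝ)
    (hd : ∀ x ∈ s, HasDerivAt φ (φ' x) x) (hst : ∀ x ∈ s, φ x ∈ t) (hts : ∀ y ∈ t, ψ y ∈ s)
    (hl : ∀ x ∈ s, ψ (φ x) = x) (hr : ∀ y ∈ t, φ (ψ y) = y)
    (hFG : ∀ x ∈ s, F x = |φ' x| * G (φ x)) :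
    ∫⁻ y in t, ENNReal.ofReal (G y) = ∫⁻ x in s, ENNReal.ofReal (F x) := by
  refine lintegral_cov hs hd ?_ ?_ hFG
  · intro x hx y hy hxy
    rw [← hl x hx, ← hl y hy, hxy]
  · ext y
    exact ⟨fun ⟨x, hx, h⟩ => h ▸ hst x hx, fun hy => ⟨ψ y, hts y hy, hr y hy⟩⟩

theorem lintegral_cov_mono {s t : Set ℝ} (hso : IsOpen s) (hsc : Convex ℝ s) {φ φ' F G : ℝ → ℝ}
    (hd : ∀ x ∈ s, HasDerivAt φ (φ' x) x)
    (hsign : (∀ x ∈ s, 0 < φ' x) ∨ (∀ x ∈ s, φ' x < 0))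
    (hst : ∀ x ∈ s, φ x ∈ t) (hlo : ∀ y ∈ t, ∃ x ∈ s, φ x ≤ y) (hhi : ∀ y ∈ t, ∃ x ∈ s, y ≤ φ x)
    (hFG : ∀ x ∈ s, F x = |φ' x| * G (φ x)) :
    ∫⁻ y in t, ENNReal.ofReal (G y) = ∫⁻ x in s, ENNReal.ofReal (F x) := by
  have hc : ContinuousOn φ s := fun x hx => (hd x hx).continuousAt.continuousWithinAt
  refine lintegral_cov hso.measurableSet hd ?_ ?_ hFG
  · rcases hsign with h | h
    · refine (strictMonoOn_of_deriv_pos hsc hc fun x hx => ?_).injOn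
      rw [hso.interior_eq] at hx
      rw [(hd x hx).deriv]; exact h x hx
    · refine (strictAntiOn_of_deriv_neg hsc hc fun x hx => ?_).injOn
      rw [hso.interior_eq] at hx
      rw [(hd x hx).deriv]; exact h x hx
  · ext y
    refine ⟨fun ⟨x, hx, h⟩ => h ▸ hst x hx, fun hy => ?_⟩
    obtain ⟨a, ha, hay⟩ := hlo y hy
    obtain ⟨b, hb, hyb⟩ := hhi y hy
    exact hsc.isPreconnected.intermediate_value ha hb hc ⟨hay, hyb⟩

theorem exists_le_of_tendsto_nhds {s : Set ℝ} {φ : ℝ → ℝ} {l : Filter ℝ} [l.NeBot] (hs : s ∈ l)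
    {a y : ℝ} (h : Filter.Tendsto φ l (nhds a)) (hy : a < y) : ∃ x ∈ s, φ x ≤ y := by
  obtain ⟨x, hx, hxs⟩ := ((h.eventually_lt_const hy).and hs).exists
  exact ⟨x, hxs, hx.le⟩

theorem exists_ge_of_tendsto_atTop {s : Set ℝ} {φ : ℝ → ℝ} {l : Filter ℝ} [l.NeBot] (hs : s ∈ l)
    {y : ℝ} (h : Filter.Tendsto φ l Filter.atTop) : ∃ x ∈ s, y ≤ φ x := by
  obtain ⟨x, hx, hxs⟩ := ((h.eventually_ge_atTop y).and hs).exists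
  exact ⟨x, hxs, hx⟩

theorem setLIntegral_eq_of_subset_of_eq_zero {α : Type*} [MeasurableSpace α] {μ : Measure α}
    {s t : Set α} {f : α → ENNReal} (hs : MeasurableSet s) (ht : MeasurableSet t) (hst : s ⊆ t)
    (h : ∀ x ∈ t \ s, f x = 0) : ∫⁻ x in s, f x ∂μ = ∫⁻ x in t, f x ∂μ := by
  rw [← lintegral_inter_add_sdiff f t hs, Set.inter_eq_self_of_subset_right hst,
    setLIntegral_congr_fun (ht.diff hs) h, lintegral_zero, add_zero]

/-- The cubic with a rational `3`-torsion point. -/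
noncomputable def torsionCubic (w e z : ℝ) : ℝ := 2 * (w - e) * z ^ 3 + (3 * z - e) ^ 2

/-- The real period `∫ dt / √(t (t² + b t + 3))` over the positive half-line. -/
noncomputable def halfPeriod (b : ℝ) : ENNReal :=
  ∫⁻ t in Set.Ioi (0 : ℝ), ENNReal.ofReal (√(t * (t ^ 2 + b * t + 3)))⁻¹

/-- The three-to-one map between the two cubics. -/
noncomputable def isogenyMap (w e z : ℝ) : ℝ :=
  (z + (w + 2 * e)) * (z - (w - e) / 2) ^ 2 / (3 * z ^ 2)

noncomputable def isogenyDeriv (w e z : ℝ) : ℝ :=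
  (z - (w - e) / 2) * (z ^ 2 + (w - e) / 2 * z + (3 + e * w)) / (3 * z ^ 3)

theorem isogenyDeriv_sq {w e z : ℝ} (hw : w ^ 2 = 5) (he : e ^ 2 = 1) (hz : z ≠ 0) :
    isogenyDeriv w e z ^ 2 * torsionCubic w e z = 6 * (w - e) * (isogenyMap w e z *
      (isogenyMap w e z ^ 2 + -(3 * e * (7 - e * w) / 8) * isogenyMap w e z + 3)) := by
  unfold isogenyDeriv torsionCubic isogenyMap
  field_simp
  grind

theorem hasDerivAt_isogenyMap {w e z : ℝ} (hw : w ^ 2 = 5) (he : e ^ 2 = 1) (hz : z ≠ 0) :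
    HasDerivAt (isogenyMap w e) (isogenyDeriv w e z) z := by
  unfold isogenyMap
  have h1 : HasDerivAt (fun z : ℝ => z) 1 z := hasDerivAt_id z
  have h := ((h1.add_const (w + 2 * e)).mul ((h1.sub_const ((w - e) / 2)).pow 2)).div
    ((h1.pow 2).const_mul 3) (by simpa using hz)
  refine h.congr_deriv ?_
  unfold isogenyDeriv
  simp only [Pi.pow_apply, Pi.mul_apply]
  field_simp
  grind

theorem two_lt_of_sq_eq_five {w : ℝ} (hw0 : 0 < w) (hw : w ^ 2 = 5) : 2.236 < w ∧ w < 2.2361 :=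
  ⟨by nlinarith, by nlinarith⟩

theorem lintegral_torsionCubic_of_branch {w e : ℝ} (hw0 : 0 < w) (hw : w ^ 2 = 5)
    (he : e = 1 ∨ e = -1)
    {s : Set ℝ} (hso : IsOpen s) (hsc : Convex ℝ s) (hs0 : ∀ z ∈ s, z ≠ 0 ∧ -(w + 2 * e) < z ∧
      z ≠ (w - e) / 2)
    (hsign : (∀ x ∈ s, 0 < isogenyDeriv w e x) ∨ (∀ x ∈ s, isogenyDeriv w e x < 0))
    (hlo : ∀ y ∈ Set.Ioi (0 : ℝ), ∃ x ∈ s, isogenyMap w e x ≤ y)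
    (hhi : ∀ y ∈ Set.Ioi (0 : ℝ), ∃ x ∈ s, y ≤ isogenyMap w e x) :
    halfPeriod (-(3 * e * (7 - e * w) / 8)) = ENNReal.ofReal (√(6 * (w - e))) *
      ∫⁻ z in s, ENNReal.ofReal (√(torsionCubic w e z))⁻¹ := by
  have hb := two_lt_of_sq_eq_five hw0 hw
  have he2 : e ^ 2 = 1 := by rcases he with rfl | rfl <;> norm_num
  have hk : 0 < 6 * (w - e) := by rcases he with rfl | rfl <;> linarith
  rw [halfPeriod, ← lintegral_const_mul' _ _ ENNReal.ofReal_ne_top]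
  simp_rw [← ENNReal.ofReal_mul (Real.sqrt_nonneg (6 * (w - e)))]
  have hpos : ∀ x ∈ s, 0 < isogenyMap w e x := by
    intro x hx
    obtain ⟨h0, h1, h2⟩ := hs0 x hx
    unfold isogenyMap
    have : 0 < x + (w + 2 * e) := by linarith
    have : 0 < (x - (w - e) / 2) ^ 2 := by
      have : x - (w - e) / 2 ≠ 0 := sub_ne_zero.2 h2
      positivity
    positivity
  refine lintegral_cov_mono hso hsc (fun x hx => hasDerivAt_isogenyMap hw he2 (hs0 x hx).1) hsign
    hpos hlo hhi fun x hx => ?_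
  have hX := hpos x hx
  have hid := isogenyDeriv_sq hw he2 (hs0 x hx).1
  set X := isogenyMap w e x
  have hq : 0 < X * (X ^ 2 + -(3 * e * (7 - e * w) / 8) * X + 3) := by
    refine mul_pos hX ?_
    have : (3 * e * (7 - e * w) / 8) ^ 2 < 12 := by
      rcases he with rfl | rfl <;> nlinarith
    nlinarith [sq_nonneg (2 * X - (3 * e * (7 - e * w) / 8))]
  have hf : 0 < torsionCubic w e x := by
    have h3 : 0 < isogenyDeriv w e x ^ 2 * torsionCubic w e x := by rw [hid]; positivity
    exact (pos_iff_pos_of_mul_pos h3).1 (lt_of_le_of_ne (sq_nonneg _) fun h => by simp [← h] at h3)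
  have h4 : |isogenyDeriv w e x| * √(torsionCubic w e x) =
      √(6 * (w - e)) * √(X * (X ^ 2 + -(3 * e * (7 - e * w) / 8) * X + 3)) := by
    rw [← Real.sqrt_mul hk.le, ← hid, Real.sqrt_mul (sq_nonneg _), Real.sqrt_sq_eq_abs]
  have h5 := Real.sqrt_pos.2 hf
  have h6 := Real.sqrt_pos.2 hq
  rw [← div_eq_mul_inv, ← div_eq_mul_inv, div_eq_div_iff h5.ne' h6.ne', h4]

theorem tendsto_isogenyMap_zero {w e : ℝ} (hw0 : 0 < w) (hw : w ^ 2 = 5) (he : e = 1 ∨ e = -1) :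
    Filter.Tendsto (isogenyMap w e) (nhdsWithin 0 {0}ᶜ) Filter.atTop := by
  have hb := two_lt_of_sq_eq_five hw0 hw
  have h1 : Filter.Tendsto (fun z : ℝ => (z + (w + 2 * e)) * (z - (w - e) / 2) ^ 2 / 3)
      (nhdsWithin 0 {0}ᶜ) (nhds ((0 + (w + 2 * e)) * (0 - (w - e) / 2) ^ 2 / 3)) :=
    (Continuous.tendsto (by fun_prop) 0).mono_left nhdsWithin_le_nhds
  have h2 : Filter.Tendsto (fun z : ℝ => (z ^ 2)⁻¹) (nhdsWithin 0 {0}ᶜ) Filter.atTop := by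
    refine Filter.Tendsto.inv_tendsto_nhdsGT_zero ?_
    refine tendsto_nhdsWithin_iff.2 ⟨?_, ?_⟩
    · have : Filter.Tendsto (fun z : ℝ => z ^ 2) (nhds 0) (nhds (0 ^ 2)) :=
        Continuous.tendsto (by fun_prop) 0
      rw [zero_pow two_ne_zero] at this
      exact this.mono_left nhdsWithin_le_nhds
    · filter_upwards [self_mem_nhdsWithin] with z hz
      have : z ≠ 0 := hz
      exact Set.mem_Ioi.2 (by positivity)
  have h3 := h1.pos_mul_atTop (by
    have : w - e ≠ 0 := by rcases he with rfl | rfl <;> linarith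
    have : 0 < 0 + (w + 2 * e) := by rcases he with rfl | rfl <;> linarith
    have : (0 - (w - e) / 2) ≠ 0 := by rcases he with rfl | rfl <;> linarith
    positivity) h2
  refine h3.congr fun z => ?_
  unfold isogenyMap
  ring

theorem tendsto_isogenyMap_of_ne {w e a : ℝ} (l : Filter ℝ) (hl : l ≤ nhds a) (ha : a ≠ 0)
    (h : isogenyMap w e a = 0) : Filter.Tendsto (isogenyMap w e) l (nhds 0) := by
  rw [← h]
  refine Filter.Tendsto.mono_left ?_ hl
  have : ContinuousAt (isogenyMap w e) a := by
    unfold isogenyMap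
    fun_prop (disch := positivity)
  exact this

theorem halfPeriod_isogeny {w e : ℝ} (hw0 : 0 < w) (hw : w ^ 2 = 5) (he : e = 1 ∨ e = -1) :
    halfPeriod (-(3 * e * (7 - e * w) / 8)) = ENNReal.ofReal (√(6 * (w - e))) *
      ∫⁻ z in Set.Ioo (-(w + 2 * e)) 0, ENNReal.ofReal (√(torsionCubic w e z))⁻¹ ∧
    halfPeriod (-(3 * e * (7 - e * w) / 8)) = ENNReal.ofReal (√(6 * (w - e))) *
      ∫⁻ z in Set.Ioo 0 ((w - e) / 2), ENNReal.ofReal (√(torsionCubic w e z))⁻¹ ∧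
    halfPeriod (-(3 * e * (7 - e * w) / 8)) = ENNReal.ofReal (√(6 * (w - e))) *
      ∫⁻ z in Set.Ioi ((w - e) / 2), ENNReal.ofReal (√(torsionCubic w e z))⁻¹ := by
  have hb := two_lt_of_sq_eq_five hw0 hw
  have hk : 0 < (w - e) / 2 := by rcases he with rfl | rfl <;> linarith
  have hz0 : -(w + 2 * e) < 0 := by rcases he with rfl | rfl <;> linarith
  have hquad : ∀ x : ℝ, 0 < x ^ 2 + (w - e) / 2 * x + (3 + e * w) := by
    intro x
    have : (w - e) ^ 2 < 16 * (3 + e * w) := by rcases he with rfl | rfl <;> nlinarith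
    nlinarith [sq_nonneg (2 * x + (w - e) / 2)]
  have hT := tendsto_isogenyMap_zero hw0 hw he
  have hTp : isogenyMap w e ((w - e) / 2) = 0 := by simp [isogenyMap]
  have hTz : isogenyMap w e (-(w + 2 * e)) = 0 := by simp [isogenyMap]
  refine ⟨?_, ?_, ?_⟩
  · refine lintegral_torsionCubic_of_branch hw0 hw he isOpen_Ioo (convex_Ioo _ _) ?_ (.inl ?_) ?_ ?_
    · exact fun z hz => ⟨hz.2.ne, hz.1, by linarith [hz.2]⟩
    · intro x hx
      have h1 : x - (w - e) / 2 < 0 := by linarith [hx.2]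
      have h2 : 3 * x ^ 3 < 0 := by
        have := Odd.pow_neg (n := 3) (by decide) hx.2
        linarith
      exact div_pos_of_neg_of_neg (mul_neg_of_neg_of_pos h1 (hquad x)) h2
    · exact fun y hy => exists_le_of_tendsto_nhds (Ioo_mem_nhdsGT hz0)
        (tendsto_isogenyMap_of_ne _ nhdsWithin_le_nhds hz0.ne hTz) hy
    · exact fun y hy => exists_ge_of_tendsto_atTop (Ioo_mem_nhdsLT hz0)
        (hT.mono_left (nhdsWithin_mono _ fun x hx => (ne_of_lt hx)))
  · refine lintegral_torsionCubic_of_branch hw0 hw he isOpen_Ioo (convex_Ioo _ _) ?_ (.inr ?_) ?_ ?_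
    · exact fun z hz => ⟨hz.1.ne', by linarith [hz.1], hz.2.ne⟩
    · intro x hx
      have h1 : x - (w - e) / 2 < 0 := by linarith [hx.2]
      have h2 : 0 < 3 * x ^ 3 := by
        have := pow_pos hx.1 3
        linarith
      exact div_neg_of_neg_of_pos (mul_neg_of_neg_of_pos h1 (hquad x)) h2
    · exact fun y hy => exists_le_of_tendsto_nhds (Ioo_mem_nhdsLT hk)
        (tendsto_isogenyMap_of_ne _ nhdsWithin_le_nhds hk.ne' hTp) hy
    · exact fun y hy => exists_ge_of_tendsto_atTop (Ioo_mem_nhdsGT hk)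
        (hT.mono_left (nhdsWithin_mono _ fun x hx => (ne_of_gt hx)))
  · refine lintegral_torsionCubic_of_branch hw0 hw he isOpen_Ioi (convex_Ioi _) ?_ (.inl ?_) ?_ ?_
    · exact fun z hz => ⟨(hk.trans hz).ne', by linarith [hk.trans hz], (Set.mem_Ioi.1 hz).ne'⟩
    · intro x hx
      have h1 : 0 < x - (w - e) / 2 := sub_pos.2 hx
      have h2 : 0 < 3 * x ^ 3 := by
        have := pow_pos (hk.trans hx) 3
        linarith
      exact div_pos (mul_pos h1 (hquad x)) h2
    · exact fun y hy => exists_le_of_tendsto_nhds self_mem_nhdsWithin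
        (tendsto_isogenyMap_of_ne (nhdsWithin _ (Set.Ioi _)) nhdsWithin_le_nhds hk.ne' hTp) hy
    · intro y hy
      have hy0 : 0 < y := hy
      refine ⟨(w - e) + 12 * y, Set.mem_Ioi.2 (by linarith), ?_⟩
      unfold isogenyMap
      rw [le_div_iff₀ (by have : 0 < w - e := by linarith
                          positivity)]
      have h1 : 12 * y ≤ w - e + 12 * y + (w + 2 * e) := by linarith
      have h2 : ((w - e + 12 * y) / 2) ^ 2 ≤ (w - e + 12 * y - (w - e) / 2) ^ 2 := by
        gcongr <;> linarith
      have h3 := mul_le_mul h1 h2 (by positivity) (by linarith)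
      refine le_trans (le_of_eq ?_) h3
      ring

theorem halfPeriod_eq_lintegral_Ioi {w e : ℝ} (hw0 : 0 < w) (hw : w ^ 2 = 5)
    (he : e = 1 ∨ e = -1) :
    halfPeriod (-(3 * e * (7 + e * w) / 8)) = ENNReal.ofReal (√(2 * (w + e))) *
      ∫⁻ z in Set.Ioi (-(w + 2 * e)), ENNReal.ofReal (√(torsionCubic w e z))⁻¹ := by
  have hb := two_lt_of_sq_eq_five hw0 hw
  have he2 : e ^ 2 = 1 := by rcases he with rfl | rfl <;> norm_num
  have hr : 0 < (3 + e * w) / 2 := by rcases he with rfl | rfl <;> linarith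
  have hk : 0 < 2 * (w + e) := by rcases he with rfl | rfl <;> linarith
  have h := lintegral_cov_inv (s := Set.Ioi 0) (t := Set.Ioi (-(w + 2 * e))) measurableSet_Ioi
    (φ := fun t => -(w + 2 * e) + (3 + e * w) / 2 * t) (φ' := fun _ => (3 + e * w) / 2)
    (F := fun t => (√(2 * (w + e)))⁻¹ * (√(t * (t ^ 2 + -(3 * e * (7 + e * w) / 8) * t + 3)))⁻¹)
    (G := fun z => (√(torsionCubic w e z))⁻¹)
    (fun z => (z + (w + 2 * e)) / ((3 + e * w) / 2)) ?_ ?_ ?_ ?_ ?_ ?_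
  · rw [h, halfPeriod, ← lintegral_const_mul' _ _ ENNReal.ofReal_ne_top]
    refine lintegral_congr fun t => ?_
    have := Real.sqrt_pos.2 hk
    rw [← ENNReal.ofReal_mul this.le]
    congr 1
    field_simp
  · intro x _
    simpa using ((hasDerivAt_id x).const_mul ((3 + e * w) / 2)).const_add (-(w + 2 * e))
  · intro x hx
    have : 0 < (3 + e * w) / 2 * x := mul_pos hr hx
    exact Set.mem_Ioi.2 (by linarith)
  · intro y hy
    have : -(w + 2 * e) < y := hy
    exact div_pos (by linarith) hr
  · intro x _
    rw [div_eq_iff hr.ne']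
    ring
  · intro x _
    rw [mul_div_cancel₀ _ hr.ne']
    ring
  · intro t _
    have hid : torsionCubic w e (-(w + 2 * e) + (3 + e * w) / 2 * t) =
        ((3 + e * w) / 2) ^ 2 * (2 * (w + e) *
          (t * (t ^ 2 + -(3 * e * (7 + e * w) / 8) * t + 3))) := by
      unfold torsionCubic
      grind
    rw [hid, Real.sqrt_mul (sq_nonneg _), Real.sqrt_sq_eq_abs, Real.sqrt_mul hk.le, mul_inv,
      mul_inv, abs_of_pos hr, mul_inv_cancel_left₀ hr.ne']

/-- The periods of `3`-isogenous cubics, both in terms of one integral. -/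
theorem halfPeriod_three_isogeny {w e : ℝ} (hw0 : 0 < w) (hw : w ^ 2 = 5)
    (he : e = 1 ∨ e = -1) :
    halfPeriod (-(3 * e * (7 + e * w) / 8)) = ENNReal.ofReal (√(2 * (w + e))) * (3 *
      ∫⁻ z in Set.Ioo (-(w + 2 * e)) 0, ENNReal.ofReal (√(torsionCubic w e z))⁻¹) := by
  have hb := two_lt_of_sq_eq_five hw0 hw
  have hk : 0 < (w - e) / 2 := by rcases he with rfl | rfl <;> linarith
  have hz0 : -(w + 2 * e) < 0 := by rcases he with rfl | rfl <;> linarith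
  have hs : ENNReal.ofReal (√(6 * (w - e))) ≠ 0 := by
    have := Real.sqrt_pos.2 (show 0 < 6 * (w - e) by linarith)
    simpa using this
  obtain ⟨h1, h2, h3⟩ := halfPeriod_isogeny hw0 hw he
  have h12 := (ENNReal.mul_right_inj hs ENNReal.ofReal_ne_top).1 (h1.symm.trans h2)
  have h13 := (ENNReal.mul_right_inj hs ENNReal.ofReal_ne_top).1 (h1.symm.trans h3)
  rw [halfPeriod_eq_lintegral_Ioi hw0 hw he]
  congr 1
  rw [← Set.Ioc_union_Ioi_eq_Ioi hz0.le, lintegral_union measurableSet_Ioi (by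
      rw [Set.disjoint_left]; exact fun x hx hx' => not_lt.2 hx.2 hx'),
    ← Set.Ioc_union_Ioi_eq_Ioi hk.le, lintegral_union measurableSet_Ioi (by
      rw [Set.disjoint_left]; exact fun x hx hx' => not_lt.2 hx.2 hx'),
    setLIntegral_congr (Ioo_ae_eq_Ioc (a := -(w + 2 * e))).symm,
    setLIntegral_congr (Ioo_ae_eq_Ioc (a := (0 : ℝ))).symm, ← h12, ← h13]
  ring

section

namespace Real

theorem convexOn_log_Gamma_comp_affine {a b : ℝ} (ha : 0 < a) (hb : 0 ≤ b) :
    ConvexOn ℝ (Set.Ioi 0) fun s => log (Gamma (a * s + b)) := by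
  refine ⟨convex_Ioi 0, fun x hx y hy p q hp hq hpq => ?_⟩
  have hx' : a * x + b ∈ Set.Ioi (0 : ℝ) := add_pos_of_pos_of_nonneg (mul_pos ha hx) hb
  have hy' : a * y + b ∈ Set.Ioi (0 : ℝ) := add_pos_of_pos_of_nonneg (mul_pos ha hy) hb
  have h := convexOn_log_Gamma.2 hx' hy' hp hq hpq
  simp only [Function.comp_apply, smul_eq_mul] at h ⊢
  convert h using 3
  have : q = 1 - p := by linarith
  subst this
  ring

/-- Gauss's multiplication formula for five factors, with the constant as a Gamma product. -/
theorem Gamma_mul_five {s : ℝ} (hs : 0 < s) :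
    Gamma (s / 5) * Gamma (s / 5 + 1 / 5) * Gamma (s / 5 + 2 / 5) * Gamma (s / 5 + 3 / 5) *
      Gamma (s / 5 + 4 / 5) * 5 ^ (s - 1) =
    Gamma (1 / 5) * Gamma (2 / 5) * Gamma (3 / 5) * Gamma (4 / 5) * Gamma s := by
  have hC : 0 < Gamma (1 / 5) * Gamma (2 / 5) * Gamma (3 / 5) * Gamma (4 / 5) := by
    have := Gamma_pos_of_pos (show (0 : ℝ) < 1 / 5 by norm_num)
    have := Gamma_pos_of_pos (show (0 : ℝ) < 2 / 5 by norm_num)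
    have := Gamma_pos_of_pos (show (0 : ℝ) < 3 / 5 by norm_num)
    have := Gamma_pos_of_pos (show (0 : ℝ) < 4 / 5 by norm_num)
    positivity
  set C := Gamma (1 / 5) * Gamma (2 / 5) * Gamma (3 / 5) * Gamma (4 / 5) with hCdef
  have hpos : ∀ {s : ℝ}, 0 < s → ∀ {b : ℝ}, 0 ≤ b → 0 < Gamma (s / 5 + b) := fun h b hb =>
    Gamma_pos_of_pos (add_pos_of_pos_of_nonneg (div_pos h (by norm_num)) hb)
  have key := eq_Gamma_of_log_convex (f := fun s => Gamma (s / 5) * Gamma (s / 5 + 1 / 5) *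
    Gamma (s / 5 + 2 / 5) * Gamma (s / 5 + 3 / 5) * Gamma (s / 5 + 4 / 5) * 5 ^ (s - 1) / C)
    ?_ ?_ ?_ ?_ hs
  · rw [div_eq_iff hC.ne'] at key
    rw [key, mul_comm]
  · have h5 : (0 : ℝ) < 1 / 5 := by norm_num
    have hlin : ConvexOn ℝ (Set.Ioi (0 : ℝ)) fun s : ℝ => s * log 5 := by
      refine ⟨convex_Ioi 0, fun x _ y _ p q _ _ _ => le_of_eq ?_⟩
      simp only [smul_eq_mul]
      ring
    have h := (((((convexOn_log_Gamma_comp_affine h5 le_rfl).add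
      (convexOn_log_Gamma_comp_affine (b := 1 / 5) h5 (by norm_num))).add
      (convexOn_log_Gamma_comp_affine (b := 2 / 5) h5 (by norm_num))).add
      (convexOn_log_Gamma_comp_affine (b := 3 / 5) h5 (by norm_num))).add
      (convexOn_log_Gamma_comp_affine (b := 4 / 5) h5 (by norm_num))).add hlin
    refine (h.add_const (-log 5 - log C)).congr fun s hs => ?_
    have h0 : 0 < Gamma (s / 5) := by simpa using hpos hs le_rfl
    have h1 := hpos hs (b := 1 / 5) (by norm_num)
    have h2 := hpos hs (b := 2 / 5) (by norm_num)
    have h3 := hpos hs (b := 3 / 5) (by norm_num)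
    have h4 := hpos hs (b := 4 / 5) (by norm_num)
    have hp : (0 : ℝ) < 5 ^ (s - 1) := by positivity
    simp only [Function.comp_apply, Pi.add_apply]
    rw [log_div (by positivity) hC.ne', log_mul (by positivity) hp.ne',
      log_mul (by positivity) h4.ne', log_mul (by positivity) h3.ne',
      log_mul (by positivity) h2.ne', log_mul h0.ne' h1.ne', log_rpow (by norm_num)]
    simp only [one_div, inv_mul_eq_div, add_zero]
    ring
  · intro y hy
    rw [show (y + 1) / 5 = y / 5 + 1 / 5 by ring,
      show y / 5 + 1 / 5 + 1 / 5 = y / 5 + 2 / 5 by ring,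
      show y / 5 + 1 / 5 + 2 / 5 = y / 5 + 3 / 5 by ring,
      show y / 5 + 1 / 5 + 3 / 5 = y / 5 + 4 / 5 by ring,
      show y / 5 + 1 / 5 + 4 / 5 = y / 5 + 1 by ring,
      show y + 1 - 1 = (y - 1) + 1 by ring, rpow_add (by norm_num), rpow_one,
      Gamma_add_one (by positivity)]
    ring
  · intro y hy
    have h0 : 0 < Gamma (y / 5) := by simpa using hpos hy le_rfl
    have h1 := hpos hy (b := 1 / 5) (by norm_num)
    have h2 := hpos hy (b := 2 / 5) (by norm_num)
    have h3 := hpos hy (b := 3 / 5) (by norm_num)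
    have h4 := hpos hy (b := 4 / 5) (by norm_num)
    positivity
  · rw [div_eq_one_iff_eq hC.ne', hCdef]
    norm_num

theorem Gamma_mul_Gamma_fifteenth (a b : ℝ) (h : a + b = 1) :
    Gamma a * Gamma b = π / sin (π * a) := by
  rw [← Gamma_mul_Gamma_one_sub, ← h, add_sub_cancel_left]

theorem sin_pi_mul_pos {a : ℝ} (h0 : 0 < a) (h1 : a < 1) : 0 < sin (π * a) :=
  sin_pos_of_pos_of_lt_pi (by positivity) (by nlinarith [pi_pos])

theorem Gamma_fifths : Gamma (1 / 5) * Gamma (2 / 5) * Gamma (3 / 5) * Gamma (4 / 5) =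
    4 * π ^ 2 / √5 := by
  have h1 := Gamma_mul_Gamma_fifteenth (1 / 5) (4 / 5) (by norm_num)
  have h2 := Gamma_mul_Gamma_fifteenth (2 / 5) (3 / 5) (by norm_num)
  have hs1 := sin_pi_mul_pos (a := 1 / 5) (by norm_num) (by norm_num)
  have hs2 := sin_pi_mul_pos (a := 2 / 5) (by norm_num) (by norm_num)
  have h5 : √5 ^ 2 = 5 := sq_sqrt (by norm_num)
  have h50 : 0 < √5 := sqrt_pos.2 (by norm_num)
  have hss : sin (π * (1 / 5)) * sin (π * (2 / 5)) = √5 / 4 := by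
    have e1 : sin (π * (2 / 5)) = 2 * sin (π * (1 / 5)) * cos (π / 5) := by
      rw [show π * (2 / 5) = 2 * (π * (1 / 5)) by ring, sin_two_mul]
      congr 2
      ring
    have e2 := sin_sq_add_cos_sq (π * (1 / 5))
    rw [show cos (π * (1 / 5)) = cos (π / 5) by congr 1; ring, cos_pi_div_five] at e2
    rw [e1, cos_pi_div_five]
    grind
  calc _ = (Gamma (1 / 5) * Gamma (4 / 5)) * (Gamma (2 / 5) * Gamma (3 / 5)) := by ring
    _ = π ^ 2 / (sin (π * (1 / 5)) * sin (π * (2 / 5))) := by rw [h1, h2]; field_simp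
    _ = _ := by rw [hss]; field_simp

end Real

open Real ProbabilityTheory

theorem beta_thirds {a b c : ℝ} (habc : a + b + c = 1) (h0 : 0 < c) (h1 : c < 1) :
    beta a b = Gamma a * Gamma b * Gamma c * sin (π * c) / π := by
  have h := Gamma_mul_Gamma_one_sub c
  rw [show 1 - c = a + b by linarith] at h
  have hs := sin_pi_mul_pos h0 h1
  have h1 := Gamma_pos_of_pos h0
  have h2 : Gamma (a + b) = π / sin (π * c) / Gamma c := by
    rw [← h]; field_simp
  rw [beta, h2]
  field_simp

noncomputable def betaSum : ℝ := 5 ^ (1 / 6 : ℝ) / 30 * (beta (1 / 15) (2 / 3) + beta (4 / 15) (2 / 3))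
noncomputable def betaDiff : ℝ := 5 ^ (1 / 3 : ℝ) / 30 * (beta (2 / 15) (1 / 3) - beta (8 / 15) (1 / 3))

theorem betaSum_eq : betaSum = 5 ^ (1 / 6 : ℝ) / 30 *
    (Gamma (2 / 3) * Gamma (1 / 15) * Gamma (4 / 15) * sin (2 * (π / 5)) / π) := by
  rw [betaSum, beta_thirds (a := 1 / 15) (b := 2 / 3) (c := 4 / 15) (by norm_num) (by norm_num) (by norm_num),
    beta_thirds (a := 4 / 15) (b := 2 / 3) (c := 1 / 15) (by norm_num) (by norm_num) (by norm_num)]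
  have h : sin (π * (4 / 15)) + sin (π * (1 / 15)) = sin (2 * (π / 5)) := by
    have e1 : sin (π * (4 / 15)) = sin (π / 6 + π / 10) := by congr 1; ring
    have e2 : sin (π * (1 / 15)) = sin (π / 6 - π / 10) := by congr 1; ring
    have e3 : sin (2 * (π / 5)) = cos (π / 10) := by
      rw [← cos_pi_div_two_sub]; congr 1; ring
    rw [e1, e2, e3, sin_add, sin_sub, sin_pi_div_six]
    ring
  rw [← h]
  ring

theorem betaDiff_eq : betaDiff = 5 ^ (1 / 3 : ℝ) / 30 *
    (Gamma (1 / 3) * Gamma (2 / 15) * Gamma (8 / 15) * sin (π / 5) / π) := by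
  rw [betaDiff, beta_thirds (a := 2 / 15) (b := 1 / 3) (c := 8 / 15) (by norm_num) (by norm_num) (by norm_num),
    beta_thirds (a := 8 / 15) (b := 1 / 3) (c := 2 / 15) (by norm_num) (by norm_num) (by norm_num)]
  have h : sin (π * (8 / 15)) - sin (π * (2 / 15)) = sin (π / 5) := by
    have e1 : sin (π * (8 / 15)) = sin (π / 3 + π / 5) := by congr 1; ring
    have e2 : sin (π * (2 / 15)) = sin (π / 3 - π / 5) := by congr 1; ring
    rw [e1, e2, sin_add, sin_sub, cos_pi_div_three]
    ring
  rw [← h]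
  ring

theorem sin_two_pi_div_five : sin (2 * (π / 5)) = sin (π / 5) * ((1 + √5) / 2) := by
  rw [sin_two_mul, cos_pi_div_five]; ring

theorem sin_pi_div_five_sq : sin (π / 5) ^ 2 = (5 - √5) / 8 := by
  have h := sin_sq_add_cos_sq (π / 5)
  have : √5 ^ 2 = 5 := sq_sqrt (by norm_num)
  rw [cos_pi_div_five] at h
  grind

theorem betaSum_mul_betaDiff : betaSum * betaDiff =
    Gamma (1 / 15) * Gamma (2 / 15) * Gamma (4 / 15) * Gamma (8 / 15) / (360 * √3 * π) := by
  have h1 : (5 : ℝ) ^ (1 / 6 : ℝ) * 5 ^ (1 / 3 : ℝ) = √5 := by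
    rw [← rpow_add (by norm_num), sqrt_eq_rpow]; norm_num
  have h2 : Gamma (1 / 3) * Gamma (2 / 3) = 2 * π / √3 := by
    rw [Gamma_mul_Gamma_fifteenth _ _ (by norm_num), show π * (1 / 3) = π / 3 by ring,
      sin_pi_div_three]
    field_simp
  have h5 : √5 ^ 2 = 5 := sq_sqrt (by norm_num)
  have h3 := sin_pi_div_five_sq
  have h4 : sin (2 * (π / 5)) * sin (π / 5) = √5 / 4 := by
    rw [sin_two_pi_div_five]; grind
  rw [betaSum_eq, betaDiff_eq]
  calc _ = (5 : ℝ) ^ (1 / 6 : ℝ) * 5 ^ (1 / 3 : ℝ) * (Gamma (1 / 3) * Gamma (2 / 3)) *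
        (sin (2 * (π / 5)) * sin (π / 5)) *
        (Gamma (1 / 15) * Gamma (2 / 15) * Gamma (4 / 15) * Gamma (8 / 15)) / (900 * π ^ 2) := by
        field_simp
        ring
    _ = _ := by
        rw [h1, h2, h4]
        field_simp
        rw [h5]
        norm_num

theorem betaSum_eq_mul_betaDiff : betaSum = (3 + √5) / 2 * betaDiff := by
  have hm := Gamma_mul_five (s := 1 / 3) (by norm_num)
  rw [Gamma_fifths] at hm
  norm_num at hm
  have h5 : √5 ^ 2 = 5 := sq_sqrt (by norm_num)
  have h50 : 0 < √5 := sqrt_pos.2 (by norm_num)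
  have r1 := Gamma_mul_Gamma_fifteenth (2 / 15) (13 / 15) (by norm_num)
  have r2 := Gamma_mul_Gamma_fifteenth (8 / 15) (7 / 15) (by norm_num)
  have s1 := sin_pi_mul_pos (a := 2 / 15) (by norm_num) (by norm_num)
  have s2 := sin_pi_mul_pos (a := 8 / 15) (by norm_num) (by norm_num)
  have hss : sin (π * (2 / 15)) * sin (π * (8 / 15)) = (√5 + 1) / 8 := by
    have e1 : sin (π * (8 / 15)) = sin (π / 3 + π / 5) := by congr 1; ring
    have e2 : sin (π * (2 / 15)) = sin (π / 3 - π / 5) := by congr 1; ring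
    have e3 : sin (π / 3) ^ 2 = 3 / 4 := by
      rw [sin_pi_div_three, div_pow, sq_sqrt (by norm_num)]; norm_num
    have e4 := sin_pi_div_five_sq
    rw [e1, e2, sin_add, sin_sub, cos_pi_div_three, cos_pi_div_five]
    grind
  have hp : (5 : ℝ) ^ (1 / 6 : ℝ) = √5 * 5 ^ (1 / 3 : ℝ) * 5 ^ (-(2 / 3) : ℝ) := by
    rw [sqrt_eq_rpow, ← rpow_add (by norm_num), ← rpow_add (by norm_num)]; norm_num
  have g1 := Gamma_pos_of_pos (show (0 : ℝ) < 13 / 15 by norm_num)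
  have g2 := Gamma_pos_of_pos (show (0 : ℝ) < 7 / 15 by norm_num)
  have hR : Gamma (2 / 15) * Gamma (8 / 15) =
      8 * π ^ 2 / (√5 + 1) / (Gamma (13 / 15) * Gamma (7 / 15)) := by
    rw [eq_div_iff (by positivity)]
    calc _ = (Gamma (2 / 15) * Gamma (13 / 15)) * (Gamma (8 / 15) * Gamma (7 / 15)) := by ring
      _ = π ^ 2 / (sin (π * (2 / 15)) * sin (π * (8 / 15))) := by rw [r1, r2]; field_simp
      _ = _ := by rw [hss]; field_simp
  rw [betaSum_eq, betaDiff_eq, hp, sin_two_pi_div_five]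
  have hL : Gamma (2 / 3) * Gamma (1 / 15) * Gamma (4 / 15) * 5 ^ (-(2 / 3) : ℝ) =
      4 * π ^ 2 / √5 * Gamma (1 / 3) / (Gamma (13 / 15) * Gamma (7 / 15)) := by
    rw [eq_div_iff (by positivity), ← hm]
    ring
  calc _ = √5 * 5 ^ (1 / 3 : ℝ) / 30 * (Gamma (2 / 3) * Gamma (1 / 15) * Gamma (4 / 15) *
        5 ^ (-(2 / 3) : ℝ)) * (sin (π / 5) * ((1 + √5) / 2)) / π := by ring
    _ = (3 + √5) / 2 * (5 ^ (1 / 3 : ℝ) / 30 * (Gamma (1 / 3) * (Gamma (2 / 15) * Gamma (8 / 15)) *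
        sin (π / 5) / π)) := by
      rw [hL, hR]
      field_simp
      grind
    _ = _ := by ring

theorem betaDiff_pos : 0 < betaDiff := by
  rw [betaDiff_eq]
  have := Gamma_pos_of_pos (show (0 : ℝ) < 1 / 3 by norm_num)
  have := Gamma_pos_of_pos (show (0 : ℝ) < 2 / 15 by norm_num)
  have := Gamma_pos_of_pos (show (0 : ℝ) < 8 / 15 by norm_num)
  have : 0 < sin (π / 5) := sin_pos_of_pos_of_lt_pi (by positivity) (by linarith [pi_pos])
  have := pi_pos
  positivity

theorem betaSum_add_mul_sub : (betaSum + betaDiff) * (betaSum - betaDiff) =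
    √5 * (Gamma (1 / 15) * Gamma (2 / 15) * Gamma (4 / 15) * Gamma (8 / 15)) /
      (360 * √3 * π) := by
  rw [mul_div_assoc, ← betaSum_mul_betaDiff]
  have h := betaSum_eq_mul_betaDiff
  have h5 : √5 ^ 2 = 5 := sq_sqrt (by norm_num)
  grind

end

section

open Real ProbabilityTheory

theorem lintegral_rpow_mul_one_sub_pow_five {a b : ℝ} (ha : 0 < a) (hb : 0 < b) :
    ∫⁻ x in Set.Ioo (0 : ℝ) 1, ENNReal.ofReal (x ^ (5 * a - 1) * (1 - x ^ 5) ^ (b - 1)) =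
      ENNReal.ofReal (beta a b / 5) := by
  have hB := beta_pos ha hb
  have h1 := lintegral_betaPDF_eq_one ha hb
  rw [lintegral_betaPDF] at h1
  have h2 := lintegral_cov_inv (s := Set.Ioo (0 : ℝ) 1) (t := Set.Ioo (0 : ℝ) 1) measurableSet_Ioo
    (φ := fun x => x ^ 5) (φ' := fun x => 5 * x ^ 4)
    (F := fun x => 5 / beta a b * (x ^ (5 * a - 1) * (1 - x ^ 5) ^ (b - 1)))
    (G := fun x => 1 / beta a b * x ^ (a - 1) * (1 - x) ^ (b - 1)) (fun y => y ^ (1 / 5 : ℝ))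
    ?_ ?_ ?_ ?_ ?_ ?_
  · rw [h1] at h2
    have h5 : 0 < 5 / beta a b := by positivity
    simp_rw [ENNReal.ofReal_mul h5.le] at h2
    rw [lintegral_const_mul' _ _ ENNReal.ofReal_ne_top] at h2
    have h6 : (1 : ENNReal) = ENNReal.ofReal (5 / beta a b) * ENNReal.ofReal (beta a b / 5) := by
      rw [← ENNReal.ofReal_mul h5.le, ← ENNReal.ofReal_one]
      congr 1
      field_simp
    rw [h6] at h2
    exact ((ENNReal.mul_right_inj (by simpa using h5) ENNReal.ofReal_ne_top).1 h2).symm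
  · intro x _
    simpa using hasDerivAt_pow 5 x
  · exact fun x hx => ⟨pow_pos hx.1 5, pow_lt_one₀ hx.1.le hx.2 (by norm_num)⟩
  · exact fun y hy => ⟨rpow_pos_of_pos hy.1 _, rpow_lt_one hy.1.le hy.2 (by norm_num)⟩
  · intro x hx
    rw [← rpow_natCast, ← rpow_mul hx.1.le]
    norm_num
  · intro y hy
    rw [← rpow_natCast, ← rpow_mul hy.1.le]
    norm_num
  · intro x hx
    have hx0 := hx.1
    rw [abs_of_pos (by positivity), ← rpow_natCast x 5, ← rpow_natCast x 4, ← rpow_mul hx0.le]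
    rw [show (5 * a - 1) = ((4 : ℕ) : ℝ) + ((5 : ℕ) : ℝ) * (a - 1) by push_cast; ring,
      rpow_add hx0]
    ring

theorem lintegral_rpow_sum_inv {w s : ℝ} (hw0 : 0 < w) (hw : w ^ 2 = 5) :
    ∫⁻ q in Set.Ioi (0 : ℝ), ENNReal.ofReal ((w + q + q⁻¹) ^ (-s) * q⁻¹) =
    ∫⁻ x in Set.Ioo (0 : ℝ) 1,
      ENNReal.ofReal (w ^ s * (x ^ (s - 1) * (1 - x) ^ (3 * s - 1) * (1 + x) *
        (1 - x ^ 5) ^ (-s))) := by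
  refine lintegral_cov_mono isOpen_Ioo (convex_Ioo _ _)
    (φ := fun x => (1 - x) ^ 2 / (w * x)) (φ' := fun x => -(1 - x ^ 2) / (w * x ^ 2))
    ?_ (.inr ?_) ?_ ?_ ?_ ?_
  · intro x hx
    have h1 : HasDerivAt (fun z : ℝ => z) 1 x := hasDerivAt_id x
    have hx0 := hx.1
    have h := ((h1.const_sub 1).pow 2).div (h1.const_mul w) (by positivity)
    refine h.congr_deriv ?_
    simp only [Pi.pow_apply]
    field_simp
    ring
  · intro x hx
    have hx0 := hx.1
    have hx1 := hx.2
    refine div_neg_of_neg_of_pos ?_ (by positivity)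
    nlinarith
  · intro x hx
    have hx0 := hx.1
    have hx1 : 0 < 1 - x := sub_pos.2 hx.2
    exact Set.mem_Ioi.2 (by positivity)
  · intro y hy
    refine exists_le_of_tendsto_nhds (l := nhdsWithin 1 (Set.Iio 1))
      (Ioo_mem_nhdsLT (show (0 : ℝ) < 1 by norm_num)) (a := 0) ?_ hy
    have : ContinuousAt (fun x : ℝ => (1 - x) ^ 2 / (w * x)) 1 := by
      fun_prop (disch := simpa using hw0.ne')
    have h := this.tendsto
    norm_num at h
    exact h.mono_left nhdsWithin_le_nhds
  · intro y hy
    have hy0 : 0 < y := hy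
    have hd : 0 < 2 + 4 * w * y := by positivity
    refine ⟨(2 + 4 * w * y)⁻¹, ⟨by positivity, inv_lt_one_of_one_lt₀ (by nlinarith)⟩, ?_⟩
    have h2 : (2 + 4 * w * y)⁻¹ ≤ 1 / 2 := by
      rw [one_div]; gcongr; nlinarith [mul_pos hw0 hy0]
    have h3 : (1 / 2 : ℝ) ^ 2 ≤ (1 - (2 + 4 * w * y)⁻¹) ^ 2 := by gcongr; linarith
    rw [le_div_iff₀ (by positivity)]
    refine le_trans ?_ h3
    rw [← mul_assoc, ← div_eq_mul_inv, div_le_iff₀ hd]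
    nlinarith
  · intro x hx
    have hx0 := hx.1
    have hx1 : 0 < 1 - x := sub_pos.2 hx.2
    have hx5 : 0 < 1 - x ^ 5 := sub_pos.2 (pow_lt_one₀ hx.1.le hx.2 (by norm_num))
    have hx2 : 0 < 1 - x ^ 2 := sub_pos.2 (pow_lt_one₀ hx.1.le hx.2 (by norm_num))
    have e1 : w + (1 - x) ^ 2 / (w * x) + ((1 - x) ^ 2 / (w * x))⁻¹ =
        (1 - x ^ 5) / (w * (x * (1 - x) ^ 3)) := by
      field_simp
      grind
    rw [e1, neg_div, abs_neg, abs_of_pos (by positivity), div_rpow hx5.le (by positivity),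
      mul_rpow hw0.le (by positivity), mul_rpow hx0.le (by positivity), ← rpow_natCast (1 - x) 3,
      ← rpow_mul hx1.le, rpow_sub_one hx0.ne', rpow_sub_one hx1.ne',
      rpow_neg hw0.le, rpow_neg hx0.le,
      show ((3 : ℕ) : ℝ) * -s = -(3 * s) by push_cast; ring, rpow_neg hx1.le]
    have := rpow_pos_of_pos hw0 s
    have := rpow_pos_of_pos hx0 s
    have := rpow_pos_of_pos hx1 (3 * s)
    field_simp
    ring

theorem lintegral_rpow_sum_inv_Ioi_one {w s : ℝ} :
    ∫⁻ q in Set.Ioi (0 : ℝ), ENNReal.ofReal ((w + q + q⁻¹) ^ (-s) * q⁻¹) =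
    2 * ∫⁻ q in Set.Ioi (1 : ℝ), ENNReal.ofReal ((w + q + q⁻¹) ^ (-s) * q⁻¹) := by
  have h := lintegral_cov_inv (s := Set.Ioi (1 : ℝ)) (t := Set.Ioo (0 : ℝ) 1) measurableSet_Ioi
    (φ := fun x => x⁻¹) (φ' := fun x => -(x ^ 2)⁻¹)
    (F := fun q => ((w + q + q⁻¹) ^ (-s) * q⁻¹))
    (G := fun q => ((w + q + q⁻¹) ^ (-s) * q⁻¹)) (fun y => y⁻¹)
    ?_ ?_ ?_ ?_ ?_ ?_
  · rw [← Set.Ioc_union_Ioi_eq_Ioi (zero_le_one (α := ℝ)), lintegral_union measurableSet_Ioi (by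
      rw [Set.disjoint_left]; exact fun x hx hx' => not_lt.2 hx.2 hx'),
      setLIntegral_congr (Ioo_ae_eq_Ioc (a := (0 : ℝ))).symm, h]
    ring
  · intro x hx
    exact hasDerivAt_inv (by linarith [Set.mem_Ioi.1 hx])
  · exact fun x hx => ⟨inv_pos.2 (by linarith [Set.mem_Ioi.1 hx]), inv_lt_one_of_one_lt₀ hx⟩
  · exact fun y hy => (one_lt_inv₀ hy.1).2 hy.2
  · exact fun x _ => inv_inv x
  · exact fun x _ => inv_inv x
  · intro x hx
    have : 0 < x := by linarith [Set.mem_Ioi.1 hx]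
    rw [abs_neg, abs_of_pos (by positivity), inv_inv, show w + x⁻¹ + x = w + x + x⁻¹ by ring]
    field_simp

theorem lintegral_rpow_div_sqrt {w s : ℝ} (hw0 : 0 < w) (hw : w ^ 2 = 5) :
    ∫⁻ y in Set.Ioi ((1 + w) / 2),
      ENNReal.ofReal (y ^ (2 - 3 * s) * (√(y ^ 6 - 2 * w * y ^ 3 + 1))⁻¹) =
    ∫⁻ q in Set.Ioi (1 : ℝ), ENNReal.ofReal (1 / 3 * ((w + q + q⁻¹) ^ (-s) * q⁻¹)) := by
  have hφ : (w + 2) ^ (1 / 3 : ℝ) = (1 + w) / 2 := by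
    rw [show w + 2 = ((1 + w) / 2) ^ (3 : ℕ) by grind, ← rpow_natCast, ← rpow_mul (by positivity)]
    norm_num
  have hge : ∀ q : ℝ, 1 < q → w + 2 < w + q + q⁻¹ := by
    intro q hq
    have : 0 < (q - 1) ^ 2 * q⁻¹ := by
      have : 0 < q - 1 := by linarith
      positivity
    have e : (q - 1) ^ 2 * q⁻¹ = q + q⁻¹ - 2 := by field_simp; ring
    linarith
  refine lintegral_cov_mono isOpen_Ioi (convex_Ioi _)
    (φ := fun q => (w + q + q⁻¹) ^ (1 / 3 : ℝ))
    (φ' := fun q => (1 - (q ^ 2)⁻¹) * (1 / 3) * (w + q + q⁻¹) ^ ((1 / 3 : ℝ) - 1))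
    ?_ (.inl ?_) ?_ ?_ ?_ ?_
  · intro q hq
    have hq1 : 1 < q := hq
    have hq0 : q ≠ 0 := by linarith
    have h1 : HasDerivAt (fun z : ℝ => z) 1 q := hasDerivAt_id q
    have h := ((h1.const_add w).add (hasDerivAt_inv hq0)).rpow_const (p := 1 / 3)
      (.inl (by simp only [Pi.add_apply]; linarith [hge q hq1]))
    refine h.congr_deriv ?_
    simp only [Pi.add_apply]
    ring
  · intro q hq
    have hq1 : 1 < q := hq
    have := rpow_pos_of_pos (by linarith [hge q hq1] : 0 < w + q + q⁻¹) ((1 / 3 : ℝ) - 1)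
    have : 0 < 1 - (q ^ 2)⁻¹ := sub_pos.2 (inv_lt_one_of_one_lt₀ (by nlinarith))
    positivity
  · intro q hq
    rw [Set.mem_Ioi, ← hφ]
    exact rpow_lt_rpow (by positivity) (hge q hq) (by norm_num)
  · intro y hy
    refine exists_le_of_tendsto_nhds (l := nhdsWithin 1 (Set.Ioi 1)) self_mem_nhdsWithin
      (a := (1 + w) / 2) ?_ hy
    have : ContinuousAt (fun q : ℝ => (w + q + q⁻¹) ^ (1 / 3 : ℝ)) 1 := by
      refine ContinuousAt.rpow_const ?_ (.inr (by norm_num))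
      fun_prop (disch := norm_num)
    have h := this.tendsto
    rw [inv_one, show w + 1 + 1 = w + 2 by ring, hφ] at h
    exact h.mono_left nhdsWithin_le_nhds
  · intro y hy
    have hy0 : 0 < y := lt_trans (by positivity) hy
    refine ⟨1 + y ^ 3, Set.mem_Ioi.2 (by linarith [pow_pos hy0 3]), ?_⟩
    have : y = (y ^ 3) ^ (1 / 3 : ℝ) := by
      rw [← rpow_natCast, ← rpow_mul hy0.le]; norm_num
    nth_rw 1 [this]
    refine rpow_le_rpow (by positivity) ?_ (by norm_num)
    have : 0 < (1 + y ^ 3)⁻¹ := by positivity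
    linarith
  · intro q hq
    have hq1 : 1 < q := hq
    have hA := hge q hq1
    set A := w + q + q⁻¹ with hAdef
    have hA0 : 0 < A := by linarith
    have h3 : (A ^ (1 / 3 : ℝ)) ^ 3 = A := by
      rw [← rpow_natCast, ← rpow_mul hA0.le]; norm_num
    have h6 : (A ^ (1 / 3 : ℝ)) ^ 6 = A ^ 2 := by
      rw [show 6 = 3 * 2 by norm_num, pow_mul, h3]
    have hqq : 0 < q - q⁻¹ := sub_pos.2 ((inv_lt_one_of_one_lt₀ hq1).trans hq1)
    have hs : √(A ^ 2 - 2 * w * A + 1) = q - q⁻¹ := by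
      rw [show A ^ 2 - 2 * w * A + 1 = (q - q⁻¹) ^ 2 by
        rw [hAdef]; field_simp; grind, sqrt_sq hqq.le]
    have hm : 0 < 1 - (q ^ 2)⁻¹ := sub_pos.2 (inv_lt_one_of_one_lt₀ (by nlinarith))
    have hp := rpow_pos_of_pos hA0 ((1 / 3 : ℝ) - 1)
    rw [h3, h6, hs, abs_of_pos (by positivity), ← rpow_mul hA0.le]
    have e : A ^ (-s) = A ^ ((1 / 3 : ℝ) - 1) * A ^ (1 / 3 * (2 - 3 * s)) := by
      rw [← rpow_add hA0]; congr 1; ring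
    have hq2 : q ^ 2 - 1 ≠ 0 := by nlinarith
    rw [e]
    field_simp

theorem lintegral_torsionCubic_eq {w e : ℝ} (hw0 : 0 < w) (hw : w ^ 2 = 5) (he : e = 1 ∨ e = -1) :
    ∫⁻ z in Set.Ioo (-(w + 2 * e)) 0, ENNReal.ofReal (√(torsionCubic w e z))⁻¹ =
    ∫⁻ y in Set.Ioi ((1 + w) / 2),
      ENNReal.ofReal ((y + e) * (√(y ^ 6 - 2 * w * y ^ 3 + 1))⁻¹) := by
  have hb := two_lt_of_sq_eq_five hw0 hw
  have hye : ∀ y : ℝ, (1 + w) / 2 < y → 0 < y - e := by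
    intro y hy
    rcases he with rfl | rfl <;> linarith
  have hye' : ∀ y : ℝ, (1 + w) / 2 < y → 0 < y + e := by
    intro y hy
    rcases he with rfl | rfl <;> linarith
  have hφe : (1 + w) / 2 - e ≠ 0 := by rcases he with rfl | rfl <;> linarith
  have he2 : e ^ 2 = 1 := by rcases he with rfl | rfl <;> norm_num
  refine lintegral_cov_mono isOpen_Ioi (convex_Ioi _)
    (φ := fun y => -y / (y - e) ^ 2) (φ' := fun y => (y + e) / (y - e) ^ 3)
    ?_ (.inl ?_) ?_ ?_ ?_ ?_
  · intro y hy
    have h1 : HasDerivAt (fun z : ℝ => z) 1 y := hasDerivAt_id y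
    have h0 := hye y hy
    have h := (h1.neg).div ((h1.sub_const e).pow 2) (by simp only [Pi.pow_apply]; positivity)
    refine h.congr_deriv ?_
    simp only [Pi.pow_apply, Pi.neg_apply]
    field_simp
    ring
  · exact fun y hy => div_pos (hye' y hy) (pow_pos (hye y hy) 3)
  · intro y hy
    have hy' : (1 + w) / 2 < y := hy
    have h0 := hye y hy
    have hyp : 0 < y := by linarith
    constructor
    · rw [lt_div_iff₀ (by positivity)]
      rcases he with rfl | rfl <;> nlinarith
    · exact div_neg_of_neg_of_pos (by linarith) (by positivity)
  · intro z hz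
    refine exists_le_of_tendsto_nhds (l := nhdsWithin ((1 + w) / 2) (Set.Ioi _)) self_mem_nhdsWithin
      (a := -(w + 2 * e)) ?_ hz.1
    have : ContinuousAt (fun y : ℝ => -y / (y - e) ^ 2) ((1 + w) / 2) := by
      fun_prop (disch := exact pow_ne_zero 2 hφe)
    have h := this.tendsto
    have e1 : -((1 + w) / 2) / ((1 + w) / 2 - e) ^ 2 = -(w + 2 * e) := by
      rw [div_eq_iff (by positivity)]
      rcases he with rfl | rfl <;> grind
    rw [e1] at h
    exact h.mono_left nhdsWithin_le_nhds
  · intro z hz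
    have hz0 : 0 < -z := neg_pos.2 hz.2
    refine ⟨4 + 4 * (-z)⁻¹, ?_, ?_⟩
    · have : 0 < (-z)⁻¹ := inv_pos.2 hz0
      exact Set.mem_Ioi.2 (by linarith)
    · have hv : 0 < (-z)⁻¹ := inv_pos.2 hz0
      have hz' : z = -((-z)⁻¹)⁻¹ := by rw [inv_inv, neg_neg]
      set v := (-z)⁻¹
      have hye2 : v * (4 + 4 * v) ≤ (4 + 4 * v - e) ^ 2 := by rcases he with rfl | rfl <;> nlinarith
      have hye3 : 0 < (4 + 4 * v - e) ^ 2 := lt_of_lt_of_le (by positivity) hye2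
      rw [hz', le_div_iff₀ hye3, neg_mul, neg_le_neg_iff, inv_mul_eq_div, le_div_iff₀ hv]
      linarith
  · intro y hy
    have hy' : (1 + w) / 2 < y := hy
    have h0 := hye y hy
    have h1 := hye' y hy
    have e1 : torsionCubic w e (-y / (y - e) ^ 2) =
        (y ^ 6 - 2 * w * y ^ 3 + 1) / ((y - e) ^ 3) ^ 2 := by
      unfold torsionCubic
      field_simp
      grind
    rw [e1, sqrt_div' _ (sq_nonneg _), sqrt_sq (by positivity), abs_of_pos (by positivity)]
    field_simp

theorem lintegral_rpow_div_sqrt_eq {w s : ℝ} (hw0 : 0 < w) (hw : w ^ 2 = 5) :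
    ∫⁻ y in Set.Ioi ((1 + w) / 2),
      ENNReal.ofReal (y ^ (2 - 3 * s) * (√(y ^ 6 - 2 * w * y ^ 3 + 1))⁻¹) =
    ENNReal.ofReal (w ^ s / 6) * ∫⁻ x in Set.Ioo (0 : ℝ) 1,
      ENNReal.ofReal (x ^ (s - 1) * (1 - x) ^ (3 * s - 1) * (1 + x) * (1 - x ^ 5) ^ (-s)) := by
  have h := lintegral_rpow_sum_inv (s := s) hw0 hw
  rw [lintegral_rpow_sum_inv_Ioi_one] at h
  have hws := rpow_pos_of_pos hw0 s
  simp_rw [ENNReal.ofReal_mul hws.le] at h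
  rw [lintegral_const_mul' _ _ ENNReal.ofReal_ne_top] at h
  rw [lintegral_rpow_div_sqrt hw0 hw]
  simp_rw [ENNReal.ofReal_mul (show (0 : ℝ) ≤ 1 / 3 by norm_num)]
  rw [lintegral_const_mul' _ _ ENNReal.ofReal_ne_top,
    show ENNReal.ofReal (w ^ s / 6) = ENNReal.ofReal (1 / 6) * ENNReal.ofReal (w ^ s) by
      rw [← ENNReal.ofReal_mul (by norm_num)]; congr 1; ring, mul_assoc, ← h, ← mul_assoc]
  congr 1
  rw [show (2 : ENNReal) = ENNReal.ofReal 2 by simp, ← ENNReal.ofReal_mul (by norm_num)]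
  norm_num

theorem lintegral_id_div_sqrt :
    ∫⁻ y in Set.Ioi ((1 + √5) / 2),
      ENNReal.ofReal (y * (√(y ^ 6 - 2 * √5 * y ^ 3 + 1))⁻¹) = ENNReal.ofReal betaSum := by
  have h := lintegral_rpow_div_sqrt_eq (s := 1 / 3) (w := √5) (by positivity)
    (sq_sqrt (by norm_num))
  norm_num at h
  rw [h, betaSum]
  have e : ∀ x ∈ Set.Ioo (0 : ℝ) 1, ENNReal.ofReal (x ^ (-(2 / 3) : ℝ) * (1 + x) *
      (1 - x ^ 5) ^ (-(1 / 3) : ℝ)) =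
      ENNReal.ofReal (x ^ (5 * (1 / 15) - 1 : ℝ) * (1 - x ^ 5) ^ (2 / 3 - 1 : ℝ)) +
      ENNReal.ofReal (x ^ (5 * (4 / 15) - 1 : ℝ) * (1 - x ^ 5) ^ (2 / 3 - 1 : ℝ)) := by
    intro x hx
    have hx0 := hx.1
    have hx5 : 0 < 1 - x ^ 5 := sub_pos.2 (pow_lt_one₀ hx.1.le hx.2 (by norm_num))
    rw [← ENNReal.ofReal_add (by positivity) (by positivity)]
    congr 1
    rw [show (5 * (4 / 15) - 1 : ℝ) = -(2 / 3) + 1 by norm_num, rpow_add_one hx0.ne']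
    norm_num
    ring
  rw [setLIntegral_congr_fun measurableSet_Ioo e, lintegral_add_left (by fun_prop),
    lintegral_rpow_mul_one_sub_pow_five (by norm_num) (by norm_num),
    lintegral_rpow_mul_one_sub_pow_five (by norm_num) (by norm_num)]
  have b1 := beta_pos (show (0 : ℝ) < 1 / 15 by norm_num) (show (0 : ℝ) < 2 / 3 by norm_num)
  have b2 := beta_pos (show (0 : ℝ) < 4 / 15 by norm_num) (show (0 : ℝ) < 2 / 3 by norm_num)
  rw [← ENNReal.ofReal_add (by positivity) (by positivity), ← ENNReal.ofReal_mul (by positivity),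
    sqrt_eq_rpow, ← rpow_mul (by norm_num)]
  congr 1
  norm_num
  ring

theorem lintegral_one_div_sqrt :
    ∫⁻ y in Set.Ioi ((1 + √5) / 2),
      ENNReal.ofReal ((√(y ^ 6 - 2 * √5 * y ^ 3 + 1))⁻¹) = ENNReal.ofReal betaDiff := by
  have h := lintegral_rpow_div_sqrt_eq (s := 2 / 3) (w := √5) (by positivity)
    (sq_sqrt (by norm_num))
  norm_num at h
  rw [h]
  have e : ∀ x ∈ Set.Ioo (0 : ℝ) 1, ENNReal.ofReal (x ^ (-(1 / 3) : ℝ) * (1 - x) * (1 + x) *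
      (1 - x ^ 5) ^ (-(2 / 3) : ℝ)) +
      ENNReal.ofReal (x ^ (5 * (8 / 15) - 1 : ℝ) * (1 - x ^ 5) ^ (1 / 3 - 1 : ℝ)) =
      ENNReal.ofReal (x ^ (5 * (2 / 15) - 1 : ℝ) * (1 - x ^ 5) ^ (1 / 3 - 1 : ℝ)) := by
    intro x hx
    have hx0 := hx.1
    have hx1 : 0 < 1 - x := sub_pos.2 hx.2
    have hx5 : 0 < 1 - x ^ 5 := sub_pos.2 (pow_lt_one₀ hx.1.le hx.2 (by norm_num))
    rw [← ENNReal.ofReal_add (by positivity) (by positivity)]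
    congr 1
    rw [show (5 * (8 / 15) - 1 : ℝ) = -(1 / 3) + (2 : ℕ) by norm_num, rpow_add hx0, rpow_natCast]
    norm_num
    ring
  have hs := setLIntegral_congr_fun (μ := volume) measurableSet_Ioo e
  rw [lintegral_add_left (by fun_prop),
    lintegral_rpow_mul_one_sub_pow_five (by norm_num) (by norm_num),
    lintegral_rpow_mul_one_sub_pow_five (by norm_num) (by norm_num)] at hs
  have b2 := beta_pos (show (0 : ℝ) < 8 / 15 by norm_num) (show (0 : ℝ) < 1 / 3 by norm_num)
  have hs' := ENNReal.eq_sub_of_add_eq ENNReal.ofReal_ne_top hs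
  rw [← ENNReal.ofReal_sub _ (by positivity)] at hs'
  rw [hs', ← ENNReal.ofReal_mul (by positivity), sqrt_eq_rpow, ← rpow_mul (by norm_num), betaDiff]
  congr 1
  norm_num
  ring

theorem lintegral_torsionCubic_one :
    ∫⁻ z in Set.Ioo (-(√5 + 2 * 1)) 0, ENNReal.ofReal (√(torsionCubic (√5) 1 z))⁻¹ =
      ENNReal.ofReal (betaSum + betaDiff) := by
  rw [lintegral_torsionCubic_eq (by positivity) (sq_sqrt (by norm_num)) (.inl rfl)]
  have hs : 0 ≤ betaSum := by
    rw [betaSum_eq_mul_betaDiff]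
    have := betaDiff_pos
    positivity
  rw [ENNReal.ofReal_add hs betaDiff_pos.le, ← lintegral_id_div_sqrt, ← lintegral_one_div_sqrt,
    ← lintegral_add_left (by fun_prop)]
  refine setLIntegral_congr_fun measurableSet_Ioi fun y hy => ?_
  have hy0 : 0 < y := lt_trans (by positivity) (Set.mem_Ioi.1 hy)
  rw [← ENNReal.ofReal_add (by positivity) (by positivity), add_mul, one_mul]

theorem lintegral_torsionCubic_neg_one :
    ∫⁻ z in Set.Ioo (-(√5 + 2 * -1)) 0, ENNReal.ofReal (√(torsionCubic (√5) (-1) z))⁻¹ =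
      ENNReal.ofReal (betaSum - betaDiff) := by
  rw [lintegral_torsionCubic_eq (by positivity) (sq_sqrt (by norm_num)) (.inr rfl)]
  rw [ENNReal.ofReal_sub _ betaDiff_pos.le]
  refine ENNReal.eq_sub_of_add_eq ENNReal.ofReal_ne_top ?_
  rw [← lintegral_id_div_sqrt, ← lintegral_one_div_sqrt,
    ← lintegral_add_left (by fun_prop)]
  refine setLIntegral_congr_fun measurableSet_Ioi fun y hy => ?_
  have h5 := two_lt_of_sq_eq_five (w := √5) (by positivity) (sq_sqrt (by norm_num))
  have hy0 : 0 < y + -1 := by linarith [Set.mem_Ioi.1 hy]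
  rw [← ENNReal.ofReal_add (by positivity) (by positivity)]
  congr 1
  ring

theorem halfPeriod_products :
    halfPeriod (3 * (7 + √5) / 8) * halfPeriod (-(3 * (7 - √5) / 8)) +
      halfPeriod (-(3 * (7 + √5) / 8)) * halfPeriod (3 * (7 - √5) / 8) =
    ENNReal.ofReal (48 * (√5 * (Gamma (1 / 15) * Gamma (2 / 15) * Gamma (4 / 15) *
      Gamma (8 / 15)) / (360 * √3 * π))) := by
  have h5 : √5 ^ 2 = 5 := sq_sqrt (by norm_num)
  have h50 : 0 < √5 := by positivity
  have hb := two_lt_of_sq_eq_five h50 h5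
  have a1 := (halfPeriod_isogeny h50 h5 (.inl rfl)).1
  have a2 := (halfPeriod_isogeny h50 h5 (.inr rfl)).1
  have a3 := halfPeriod_three_isogeny h50 h5 (.inl rfl)
  have a4 := halfPeriod_three_isogeny h50 h5 (.inr rfl)
  rw [lintegral_torsionCubic_one] at a1 a3
  rw [lintegral_torsionCubic_neg_one] at a2 a4
  rw [show -(3 * 1 * (7 - 1 * √5) / 8) = -(3 * (7 - √5) / 8) by ring] at a1
  rw [show -(3 * 1 * (7 + 1 * √5) / 8) = -(3 * (7 + √5) / 8) by ring] at a3
  rw [show -(3 * -1 * (7 - -1 * √5) / 8) = 3 * (7 + √5) / 8 by ring] at a2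
  rw [show -(3 * -1 * (7 + -1 * √5) / 8) = 3 * (7 - √5) / 8 by ring] at a4
  have hs := betaSum_eq_mul_betaDiff
  have hd := betaDiff_pos
  have hp : 0 < betaSum + betaDiff := by rw [hs]; positivity
  have hm : 0 < betaSum - betaDiff := by rw [hs]; nlinarith
  have h3 : (3 : ENNReal) = ENNReal.ofReal 3 := by simp
  rw [a1, a2, a3, a4, ← betaSum_add_mul_sub, h3]
  simp only [← ENNReal.ofReal_mul (Real.sqrt_nonneg _), ← ENNReal.ofReal_mul (show (0 : ℝ) ≤ 3 by norm_num)]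
  rw [← ENNReal.ofReal_mul (by positivity), ← ENNReal.ofReal_mul (by positivity),
    ← ENNReal.ofReal_add (by positivity) (by positivity)]
  congr 1
  have r1 : √(6 * (√5 - -1)) * √(6 * (√5 - 1)) = 12 := by
    rw [← sqrt_mul (by linarith), sqrt_eq_iff_mul_self_eq (by nlinarith) (by norm_num)]
    nlinarith
  have r2 : √(2 * (√5 + 1)) * √(2 * (√5 + -1)) = 4 := by
    rw [← sqrt_mul (by linarith), sqrt_eq_iff_mul_self_eq (by nlinarith) (by norm_num)]
    nlinarith
  linear_combination (betaSum + betaDiff) * (betaSum - betaDiff) * r1 +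
    9 * (betaSum + betaDiff) * (betaSum - betaDiff) * r2

end

section

open Real

theorem lintegral_Ioi_inv_one_add_sq :
    ∫⁻ x in Set.Ioi (0 : ℝ), ENNReal.ofReal (1 + x ^ 2)⁻¹ = ENNReal.ofReal (π / 2) := by
  rw [← ofReal_integral_eq_lintegral_ofReal integrable_inv_one_add_sq.integrableOn
    (.of_forall fun x => by positivity), integral_Ioi_inv_one_add_sq]
  simp

theorem lintegral_inv_one_add_sq :
    ∫⁻ x : ℝ, ENNReal.ofReal (1 + x ^ 2)⁻¹ = ENNReal.ofReal π := by
  rw [← ofReal_integral_eq_lintegral_ofReal integrable_inv_one_add_sq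
    (.of_forall fun x => by positivity), integral_univ_inv_one_add_sq]

theorem lintegral_inv_sqrt_mul_linear {a b : ℝ} (ha : 0 < a) (hb : 0 < b) :
    ∫⁻ x in Set.Ioi (0 : ℝ), ENNReal.ofReal (√x * (x * a + b))⁻¹ =
      ENNReal.ofReal (π * (√(a * b))⁻¹) := by
  have h := lintegral_cov_inv (s := Set.Ioi (0 : ℝ)) (t := Set.Ioi (0 : ℝ)) measurableSet_Ioi
    (φ := fun x => b / a * x ^ 2) (φ' := fun x => b / a * (2 * x))
    (F := fun x => 2 * (√(a * b))⁻¹ * (1 + x ^ 2)⁻¹)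
    (G := fun x => (√x * (x * a + b))⁻¹) (fun y => √(a / b * y))
    ?_ ?_ ?_ ?_ ?_ ?_
  · rw [h]
    simp_rw [ENNReal.ofReal_mul (show 0 ≤ 2 * (√(a * b))⁻¹ by positivity)]
    rw [lintegral_const_mul' _ _ ENNReal.ofReal_ne_top, lintegral_Ioi_inv_one_add_sq,
      ← ENNReal.ofReal_mul (by positivity)]
    congr 1
    ring
  · intro x _
    simpa using (hasDerivAt_pow 2 x).const_mul (b / a)
  · intro x hx
    have : 0 < x := hx
    exact Set.mem_Ioi.2 (by positivity)
  · intro x hx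
    have : 0 < x := hx
    exact Set.mem_Ioi.2 (by positivity)
  · intro x hx
    have : 0 < x := hx
    rw [show a / b * (b / a * x ^ 2) = x ^ 2 by field_simp, sqrt_sq this.le]
  · intro x hx
    have : 0 < x := hx
    rw [sq_sqrt (by positivity)]
    field_simp
  · intro x hx
    have hx0 : 0 < x := hx
    have hba : 0 < b / a := by positivity
    rw [abs_of_pos (by positivity), sqrt_mul hba.le, sqrt_sq hx0.le, sqrt_div' b ha.le,
      sqrt_mul ha.le]
    have h1 := sq_sqrt ha.le
    have h2 := sq_sqrt hb.le
    have := sqrt_pos.2 ha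
    have := sqrt_pos.2 hb
    field_simp
    rw [h1]
    ring

theorem lintegral_inv_quadratic {a b c : ℝ} (ha : 0 < a) (hd : 0 < 4 * a * c - b ^ 2) :
    ∫⁻ t : ℝ, ENNReal.ofReal (a * t ^ 2 + b * t + c)⁻¹ =
      ENNReal.ofReal (2 * π * (√(4 * a * c - b ^ 2))⁻¹) := by
  set d := √(4 * a * c - b ^ 2) with hdd
  have hd0 : 0 < d := sqrt_pos.2 hd
  have hd2 : d ^ 2 = 4 * a * c - b ^ 2 := sq_sqrt hd.le
  have h := lintegral_cov_inv (s := Set.univ) (t := Set.univ) MeasurableSet.univ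
    (φ := fun x => d / (2 * a) * x - b / (2 * a)) (φ' := fun _ => d / (2 * a))
    (F := fun x => 2 * d⁻¹ * (1 + x ^ 2)⁻¹)
    (G := fun t => (a * t ^ 2 + b * t + c)⁻¹) (fun y => (y + b / (2 * a)) / (d / (2 * a)))
    ?_ ?_ ?_ ?_ ?_ ?_
  · simp only [Measure.restrict_univ] at h
    rw [h]
    simp_rw [ENNReal.ofReal_mul (show 0 ≤ 2 * d⁻¹ by positivity)]
    rw [lintegral_const_mul' _ _ ENNReal.ofReal_ne_top, lintegral_inv_one_add_sq,
      ← ENNReal.ofReal_mul (by positivity)]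
    congr 1
    ring
  · intro x _
    simpa using ((hasDerivAt_id x).const_mul (d / (2 * a))).sub_const (b / (2 * a))
  · simp
  · simp
  · intro x _
    field_simp
    ring
  · intro x _
    field_simp
    ring
  · intro x _
    have e : a * (d / (2 * a) * x - b / (2 * a)) ^ 2 + b * (d / (2 * a) * x - b / (2 * a)) + c =
        d ^ 2 / (4 * a) * (1 + x ^ 2) := by
      rw [mul_add, hd2, ← hd2]
      field_simp
      rw [hd2]
      ring_nf
      rw [hd2]
      ring
    rw [e, abs_of_pos (by positivity)]
    field_simp
    norm_num

end

section

open Real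

/-- The double-logarithmic integral. -/
noncomputable def doubleLog : ENNReal :=
  ∫⁻ m in Set.Ioi (0 : ℝ), ∫⁻ t in Set.Ioi (0 : ℝ),
    ENNReal.ofReal (m * t * √(66 + 64 * (m + m⁻¹) + t + t⁻¹))⁻¹

theorem halfPeriod_mul_halfPeriod (a b : ℝ) :
    halfPeriod a * halfPeriod b = ∫⁻ m in Set.Ioi (0 : ℝ), ∫⁻ t in Set.Ioi (0 : ℝ),
      ENNReal.ofReal ((√m)⁻¹ * (√(t ^ 2 + a * t + 3) * √((t * m) ^ 2 + b * (t * m) + 3))⁻¹) := by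
  rw [lintegral_lintegral_swap (by fun_prop), halfPeriod, halfPeriod,
    ← lintegral_mul_const _ (by fun_prop)]
  refine setLIntegral_congr_fun measurableSet_Ioi fun t ht => ?_
  have ht0 : 0 < t := ht
  rw [← lintegral_const_mul _ (by fun_prop)]
  simp_rw [← ENNReal.ofReal_mul (show 0 ≤ (√(t * (t ^ 2 + a * t + 3)))⁻¹ by positivity)]
  refine lintegral_cov_inv (φ := fun m => t * m) (φ' := fun _ => t) measurableSet_Ioi
    (fun y => y / t) ?_ ?_ ?_ ?_ ?_ ?_
  · intro x _
    simpa using (hasDerivAt_id x).const_mul t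
  · exact fun x hx => mul_pos ht0 hx
  · exact fun x hx => div_pos hx ht0
  · intro x _
    field_simp
  · intro x _
    field_simp
  · intro m hm
    have hm0 : 0 < m := hm
    rw [abs_of_pos ht0, sqrt_mul ht0.le, mul_assoc t m, sqrt_mul ht0.le, sqrt_mul hm0.le]
    have h1 := sqrt_pos.2 ht0
    have h2 := sq_sqrt ht0.le
    simp only [mul_inv]
    calc _ = ((√t)⁻¹ ^ 2 * √t ^ 2) * ((√m)⁻¹ * ((√(t ^ 2 + a * t + 3))⁻¹ *
          (√((t * m) ^ 2 + b * (t * m) + 3))⁻¹)) := by rw [← mul_pow, inv_mul_cancel₀ h1.ne']; ring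
      _ = _ := by rw [h2]; ring

theorem halfPeriod_mul_add {a b : ℝ} :
    halfPeriod a * halfPeriod (-b) + halfPeriod (-a) * halfPeriod b =
    ∫⁻ m in Set.Ioi (0 : ℝ), ∫⁻ t : ℝ, ENNReal.ofReal
      ((√m)⁻¹ * (√(t ^ 2 + a * t + 3) * √((t * m) ^ 2 + -b * (t * m) + 3))⁻¹) := by
  rw [halfPeriod_mul_halfPeriod, halfPeriod_mul_halfPeriod, ← lintegral_add_left (by fun_prop)]
  refine lintegral_congr fun m => ?_
  have h : ∫⁻ t in Set.Ioi (0 : ℝ), ENNReal.ofReal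
      ((√m)⁻¹ * (√(t ^ 2 + -a * t + 3) * √((t * m) ^ 2 + b * (t * m) + 3))⁻¹) =
      ∫⁻ t in Set.Iic (0 : ℝ), ENNReal.ofReal
      ((√m)⁻¹ * (√(t ^ 2 + a * t + 3) * √((t * m) ^ 2 + -b * (t * m) + 3))⁻¹) := by
    rw [setLIntegral_congr (Iio_ae_eq_Iic (a := (0 : ℝ))).symm]
    refine (lintegral_cov_inv (φ := fun t => -t) (φ' := fun _ => -1) measurableSet_Iio
      (fun y => -y) ?_ ?_ ?_ ?_ ?_ ?_)
    · exact fun x _ => hasDerivAt_neg x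
    · exact fun x (hx : x < 0) => Set.mem_Ioi.2 (neg_pos.2 hx)
    · exact fun x (hx : 0 < x) => Set.mem_Iio.2 (neg_neg_iff_pos.2 hx)
    · exact fun x _ => neg_neg x
    · exact fun x _ => neg_neg x
    · intro t _
      rw [abs_neg, abs_one, one_mul]
      ring_nf
  rw [h, add_comm, ← Set.compl_Iic, lintegral_add_compl _ measurableSet_Iic]

theorem lintegral_inv_sqrt_mul_quadratics {a b m : ℝ} (ha : a ^ 2 < 12) (hb : b ^ 2 < 12)
    (hm : 0 < m) :
    ∫⁻ t : ℝ, ENNReal.ofReal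
      ((√m)⁻¹ * (√(t ^ 2 + a * t + 3) * √((t * m) ^ 2 + -b * (t * m) + 3))⁻¹) =
    ∫⁻ l in Set.Ioi (0 : ℝ), ENNReal.ofReal (2 * (√m * √l * √((12 - a ^ 2) * l ^ 2 +
      (12 * (1 + m ^ 2) + 2 * a * b * m) * l + (12 - b ^ 2) * m ^ 2))⁻¹) := by
  have hq1 : ∀ t : ℝ, 0 < t ^ 2 + a * t + 3 := fun t => by nlinarith [sq_nonneg (2 * t + a)]
  have hq2 : ∀ t : ℝ, 0 < (t * m) ^ 2 + -b * (t * m) + 3 := fun t => by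
    nlinarith [sq_nonneg (2 * (t * m) - b)]
  have h1 : ∀ t : ℝ, ENNReal.ofReal
      ((√m)⁻¹ * (√(t ^ 2 + a * t + 3) * √((t * m) ^ 2 + -b * (t * m) + 3))⁻¹) =
      ∫⁻ l in Set.Ioi (0 : ℝ), ENNReal.ofReal (π⁻¹ * (√m)⁻¹ *
        (√l * (l * (t ^ 2 + a * t + 3) + ((t * m) ^ 2 + -b * (t * m) + 3)))⁻¹) := by
    intro t
    simp_rw [ENNReal.ofReal_mul (show 0 ≤ π⁻¹ * (√m)⁻¹ by positivity)]
    rw [lintegral_const_mul' _ _ ENNReal.ofReal_ne_top,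
      lintegral_inv_sqrt_mul_linear (hq1 t) (hq2 t), ← ENNReal.ofReal_mul (by positivity),
      sqrt_mul (hq1 t).le]
    congr 1
    field_simp
  simp_rw [h1]
  rw [lintegral_lintegral_swap (by fun_prop)]
  refine setLIntegral_congr_fun measurableSet_Ioi fun l hl => ?_
  have hl0 : 0 < l := hl
  have hab : (a * b) ^ 2 < 144 := by nlinarith [sq_nonneg a, sq_nonneg b]
  have hab' : -12 < a * b := by nlinarith
  have h2 := lintegral_inv_quadratic (a := l + m ^ 2) (b := l * a - m * b) (c := 3 * (l + 1))
    (by positivity) (by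
      have : 0 < 12 - a ^ 2 := by linarith
      have : 0 < 12 - b ^ 2 := by linarith
      have : 0 < a * b + 12 := by linarith
      have e : 4 * (l + m ^ 2) * (3 * (l + 1)) - (l * a - m * b) ^ 2 = (12 - a ^ 2) * l ^ 2 +
        (12 * (m - 1) ^ 2 + 2 * (a * b + 12) * m) * l + (12 - b ^ 2) * m ^ 2 := by ring
      rw [e]
      positivity)
  have h3 : ∀ t : ℝ, ENNReal.ofReal (π⁻¹ * (√m)⁻¹ *
        (√l * (l * (t ^ 2 + a * t + 3) + ((t * m) ^ 2 + -b * (t * m) + 3)))⁻¹) =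
      ENNReal.ofReal (π⁻¹ * (√m)⁻¹ * (√l)⁻¹) *
        ENNReal.ofReal ((l + m ^ 2) * t ^ 2 + (l * a - m * b) * t + 3 * (l + 1))⁻¹ := by
    intro t
    rw [← ENNReal.ofReal_mul (by positivity), mul_inv, ← mul_assoc]
    congr 3
    ring
  simp_rw [h3]
  rw [lintegral_const_mul' _ _ ENNReal.ofReal_ne_top, h2, ← ENNReal.ofReal_mul (by positivity)]
  congr 1
  rw [show 4 * (l + m ^ 2) * (3 * (l + 1)) - (l * a - m * b) ^ 2 = (12 - a ^ 2) * l ^ 2 +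
      (12 * (1 + m ^ 2) + 2 * a * b * m) * l + (12 - b ^ 2) * m ^ 2 by ring]
  field_simp

theorem lintegral_log_inner {a b c m : ℝ} (hc : 0 < c) (hac : (12 - a ^ 2) * c = 3 / 16)
    (hbc : 12 - b ^ 2 = 3 / 16 * c) (hab : a * b = 99 / 16) (hm : 0 < m) :
    ∫⁻ l in Set.Ioi (0 : ℝ), ENNReal.ofReal (2 * (√m * √l * √((12 - a ^ 2) * l ^ 2 +
      (12 * (1 + m ^ 2) + 2 * a * b * m) * l + (12 - b ^ 2) * m ^ 2))⁻¹) =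
    ENNReal.ofReal (8 / √3) * ∫⁻ t in Set.Ioi (0 : ℝ),
      ENNReal.ofReal (m * t * √(66 + 64 * (m + m⁻¹) + t + t⁻¹))⁻¹ := by
  rw [← lintegral_const_mul' _ _ ENNReal.ofReal_ne_top]
  simp_rw [← ENNReal.ofReal_mul (show 0 ≤ 8 / √3 by positivity)]
  refine lintegral_cov_inv (φ := fun t => m * c * t) (φ' := fun _ => m * c) measurableSet_Ioi
    (fun y => y / (m * c)) ?_ ?_ ?_ ?_ ?_ ?_
  · intro x _
    simpa using (hasDerivAt_id x).const_mul (m * c)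
  · exact fun x hx => mul_pos (mul_pos hm hc) hx
  · exact fun x hx => div_pos hx (mul_pos hm hc)
  · intro x _
    field_simp
  · intro x _
    field_simp
  · intro t ht
    have ht0 : 0 < t := ht
    set E := 66 + 64 * (m + m⁻¹) + t + t⁻¹ with hE
    have hE0 : 0 < E := by positivity
    have e : (12 - a ^ 2) * (m * c * t) ^ 2 +
        (12 * (1 + m ^ 2) + 2 * a * b * m) * (m * c * t) + (12 - b ^ 2) * m ^ 2 =
        3 / 4 ^ 2 * (m ^ 2 * (c * t) * E) := by
      rw [hbc, show (12 - a ^ 2) * (m * c * t) ^ 2 = ((12 - a ^ 2) * c) * (m ^ 2 * c * t ^ 2) by ring,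
        hac, mul_assoc 2 a b, hab, hE]
      field_simp
      ring
    have hs : √(m * c * t) = √m * √(c * t) := by rw [mul_assoc, sqrt_mul hm.le]
    have h1 := sq_sqrt hm.le
    have h2 := sq_sqrt (show 0 ≤ c * t by positivity)
    have := sqrt_pos.2 hm
    have := sqrt_pos.2 (show 0 < c * t by positivity)
    have := sqrt_pos.2 hE0
    have hsq : √(3 / 4 ^ 2 * (m ^ 2 * (c * t) * E)) = √3 / 4 * (m * √(c * t) * √E) := by
      rw [sqrt_mul (by positivity), sqrt_div' _ (by positivity), sqrt_sq (by norm_num),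
        sqrt_mul (by positivity), sqrt_mul (sq_nonneg m), sqrt_sq hm.le]
    rw [e, hs, hsq, abs_of_pos (by positivity)]
    field_simp
    rw [h1, mul_comm t c, h2]
    ring

theorem halfPeriod_products_eq_doubleLog :
    halfPeriod (3 * (7 + √5) / 8) * halfPeriod (-(3 * (7 - √5) / 8)) +
      halfPeriod (-(3 * (7 + √5) / 8)) * halfPeriod (3 * (7 - √5) / 8) =
    ENNReal.ofReal (8 / √3) * doubleLog := by
  have h5 : √5 ^ 2 = 5 := sq_sqrt (by norm_num)
  have h50 : 0 < √5 := by positivity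
  have hb := two_lt_of_sq_eq_five h50 h5
  rw [halfPeriod_mul_add, doubleLog, ← lintegral_const_mul' _ _ ENNReal.ofReal_ne_top]
  refine setLIntegral_congr_fun measurableSet_Ioi fun m hm => ?_
  rw [lintegral_inv_sqrt_mul_quadratics (by nlinarith) (by nlinarith) hm,
    lintegral_log_inner (c := (47 + 21 * √5) / 2) (by positivity) (by grind) (by grind) (by grind) hm]

end

section

open Real

theorem lintegral_window {h : ℝ} (h0 : 0 < h) (h1 : h < 1) :
    ∫⁻ b in Set.Ioo (0 : ℝ) 1, ENNReal.ofReal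
      (√((1 - h) * (h - b * (1 - b)) * (b * (1 - b) * (1 + 3 * h) - h * (1 - h))))⁻¹ =
    ∫⁻ X in Set.Ioo (-1 : ℝ) 1, ENNReal.ofReal
      (2 * (√((1 - X ^ 2) * (1 - h) * (16 * h ^ 2 - (1 - X ^ 2) * (1 - h + 4 * h ^ 2))))⁻¹) := by
  have hc : 0 < 1 - h + 4 * h ^ 2 := by nlinarith
  set r := √((1 - h + 4 * h ^ 2) / (1 + 3 * h)) with hr
  have hr2 : r ^ 2 = (1 - h + 4 * h ^ 2) / (1 + 3 * h) := sq_sqrt (by positivity)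
  have hr0 : 0 < r := by positivity
  have hr2' : r ^ 2 * (1 + 3 * h) = 1 - h + 4 * h ^ 2 := by rw [hr2]; field_simp
  have hr1 : r < 1 := by
    by_contra! hcon
    nlinarith [mul_le_mul hcon hcon (by norm_num) hr0.le]
  have hsub : Set.Ioo (1 / 2 - r / 2) (1 / 2 + r / 2) ⊆ Set.Ioo (0 : ℝ) 1 :=
    Set.Ioo_subset_Ioo (by linarith) (by linarith)
  rw [← setLIntegral_eq_of_subset_of_eq_zero measurableSet_Ioo measurableSet_Ioo hsub]
  · refine lintegral_cov_inv (φ := fun X => 1 / 2 + r / 2 * X) (φ' := fun _ => r / 2)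
      measurableSet_Ioo (fun b => (b - 1 / 2) / (r / 2)) ?_ ?_ ?_ ?_ ?_ ?_
    · intro x _
      simpa using ((hasDerivAt_id x).const_mul (r / 2)).const_add (1 / 2)
    · rintro x ⟨hx, hx'⟩
      constructor <;> nlinarith
    · rintro b ⟨hb, hb'⟩
      constructor
      · rw [lt_div_iff₀ (by positivity)]; linarith
      · rw [div_lt_iff₀ (by positivity)]; linarith
    · intro x _; field_simp; ring
    · intro x _; field_simp; ring
    · rintro X _
      have e : (1 - h) * (h - (1 / 2 + r / 2 * X) * (1 - (1 / 2 + r / 2 * X))) *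
          ((1 / 2 + r / 2 * X) * (1 - (1 / 2 + r / 2 * X)) * (1 + 3 * h) - h * (1 - h)) =
          (r / 4) ^ 2 *
          ((1 - X ^ 2) * (1 - h) * (16 * h ^ 2 - (1 - X ^ 2) * (1 - h + 4 * h ^ 2))) := by
        grind
      rw [e, sqrt_mul (sq_nonneg _), sqrt_sq (by positivity), abs_of_pos (by positivity), mul_inv]
      field_simp
      norm_num
  · rintro b ⟨⟨hb, hb'⟩, hn⟩
    have hout : r ^ 2 ≤ (2 * b - 1) ^ 2 := by
      rw [sq_le_sq, abs_of_pos hr0, le_abs]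
      by_contra! hcon
      exact hn ⟨by linarith, by linarith⟩
    have hu : b * (1 - b) * (1 + 3 * h) - h * (1 - h) ≤ 0 := by
      nlinarith [mul_le_mul_of_nonneg_right hout (show 0 ≤ 1 + 3 * h by positivity)]
    have hu2 : 0 ≤ h - b * (1 - b) := by
      by_contra! hcon
      nlinarith [mul_lt_mul_of_pos_right hcon (show 0 < 1 + 3 * h by positivity), sq_nonneg h]
    rw [sqrt_eq_zero_of_nonpos, inv_zero, ENNReal.ofReal_zero]
    exact mul_nonpos_of_nonneg_of_nonpos (mul_nonneg (by linarith) hu2) hu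

theorem lintegral_window_cubic {Y : ℝ} (h0 : 0 < Y) (h1 : Y ≤ 1) :
    ∫⁻ h in Set.Ioo (0 : ℝ) 1, ENNReal.ofReal
      (2 * (√(Y * (1 - h) * (16 * h ^ 2 - Y * (1 - h + 4 * h ^ 2))))⁻¹) =
    ∫⁻ N in Set.Ioi (-1 : ℝ), ENNReal.ofReal
      (2 * (√Y * √(N * ((1 + N) * (64 - 15 * Y + Y * N))))⁻¹) := by
  refine (lintegral_cov_mono (φ := fun h => (16 - 4 * Y) * h ^ 2 / (Y * (1 - h)) - 1)
    (φ' := fun h => (16 - 4 * Y) * h * (2 - h) / (Y * (1 - h) ^ 2)) isOpen_Ioo (convex_Ioo 0 1)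
    ?_ ?_ ?_ ?_ ?_ ?_).symm
  · rintro h ⟨hh, hh'⟩
    have hne : (1 - h) ≠ 0 := by linarith
    have := ((((hasDerivAt_id h).pow 2).const_mul (16 - 4 * Y)).div
      (((hasDerivAt_id h).const_sub 1).const_mul Y) (mul_ne_zero h0.ne' hne)).sub_const 1
    refine this.congr_deriv ?_
    simp
    field_simp
    ring
  · left
    rintro h ⟨hh, hh'⟩
    have : 0 < 1 - h := by linarith
    have : 0 < 2 - h := by linarith
    have : 0 < 16 - 4 * Y := by linarith
    positivity
  · rintro h ⟨hh, hh'⟩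
    have : 0 < 1 - h := by linarith
    have : 0 < 16 - 4 * Y := by linarith
    have : 0 < (16 - 4 * Y) * h ^ 2 / (Y * (1 - h)) := by positivity
    exact Set.mem_Ioi.2 (by linarith)
  · intro y hy
    refine exists_le_of_tendsto_nhds (l := nhdsWithin 0 (Set.Ioi 0)) (Ioo_mem_nhdsGT one_pos)
      (a := -1) ?_ hy
    have hct : ContinuousAt (fun h : ℝ => (16 - 4 * Y) * h ^ 2 / (Y * (1 - h)) - 1) 0 := by
      refine ContinuousAt.sub (ContinuousAt.div (by fun_prop) (by fun_prop) ?_) (by fun_prop)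
      simpa using h0.ne'
    have := hct.tendsto
    simp only [ne_eq, OfNat.ofNat_ne_zero, not_false_eq_true, zero_pow, mul_zero, zero_div,
      zero_sub] at this
    exact this.mono_left nhdsWithin_le_nhds
  · intro y hy
    refine exists_ge_of_tendsto_atTop (l := nhdsWithin 1 (Set.Iio 1)) (Ioo_mem_nhdsLT one_pos) ?_
    refine Filter.tendsto_atTop_add_const_right _ _ ?_
    have hnum : Filter.Tendsto (fun h : ℝ => (16 - 4 * Y) * h ^ 2) (nhdsWithin 1 (Set.Iio 1))
        (nhds ((16 - 4 * Y) * 1 ^ 2)) := by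
      have : ContinuousAt (fun h : ℝ => (16 - 4 * Y) * h ^ 2) 1 := by fun_prop
      exact this.tendsto.mono_left nhdsWithin_le_nhds
    have hden : Filter.Tendsto (fun h : ℝ => Y * (1 - h)) (nhdsWithin 1 (Set.Iio 1))
        (nhdsWithin 0 (Set.Ioi 0)) := by
      refine tendsto_nhdsWithin_of_tendsto_nhds_of_eventually_within _ ?_ ?_
      · have : ContinuousAt (fun h : ℝ => Y * (1 - h)) 1 := by fun_prop
        have := this.tendsto.mono_left (nhdsWithin_le_nhds (s := Set.Iio 1))
        simpa using this
      · filter_upwards [self_mem_nhdsWithin] with h (hh : h < 1)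
        exact mul_pos h0 (by linarith)
    simp_rw [div_eq_mul_inv]
    exact hnum.pos_mul_atTop (by linarith) hden.inv_tendsto_nhdsGT_zero
  · rintro h ⟨hh, hh'⟩
    have hne : 0 < 1 - h := by linarith
    have h2 : 0 < 2 - h := by linarith
    have hY : 0 < 16 - 4 * Y := by linarith
    set D := (16 - 4 * Y) * h * (2 - h) / (Y * (1 - h) ^ 2) with hD
    have hD0 : 0 < D := by positivity
    have e : ((16 - 4 * Y) * h ^ 2 / (Y * (1 - h)) - 1) *
        ((1 + ((16 - 4 * Y) * h ^ 2 / (Y * (1 - h)) - 1)) *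
        (64 - 15 * Y + Y * ((16 - 4 * Y) * h ^ 2 / (Y * (1 - h)) - 1))) =
        D ^ 2 * ((1 - h) * (16 * h ^ 2 - Y * (1 - h + 4 * h ^ 2))) := by
      rw [hD]
      field_simp
      ring
    rw [e, sqrt_mul (sq_nonneg _), sqrt_sq hD0.le, abs_of_pos hD0, mul_assoc Y, sqrt_mul h0.le]
    field_simp

theorem lintegral_cubic_eq {Y : ℝ} (h0 : 0 < Y) (h1 : Y ≤ 1) :
    ∫⁻ N in Set.Ioi (-1 : ℝ), ENNReal.ofReal
      (2 * (√Y * √(N * ((1 + N) * (64 - 15 * Y + Y * N))))⁻¹) =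
    ∫⁻ t in Set.Ioi (1 : ℝ), ENNReal.ofReal (4 / Y * (t * √(256 / Y - 62 + t + t⁻¹))⁻¹) := by
  rw [← setLIntegral_eq_of_subset_of_eq_zero (s := Set.Ioi (0 : ℝ)) measurableSet_Ioi measurableSet_Ioi
    (Set.Ioi_subset_Ioi (by norm_num))]
  · refine lintegral_cov_mono (φ := fun t => (t + t⁻¹ - 2) / 4) (φ' := fun t => (1 - (t ^ 2)⁻¹) / 4)
      isOpen_Ioi (convex_Ioi 1) ?_ ?_ ?_ ?_ ?_ ?_
    · intro t (ht : 1 < t)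
      have := (((hasDerivAt_id t).add (hasDerivAt_inv (by positivity : t ≠ 0))).sub_const 2).div_const 4
      refine this.congr_deriv ?_
      simp [sub_eq_add_neg]
    · left
      intro t (ht : 1 < t)
      have : (t ^ 2)⁻¹ < 1 := inv_lt_one_of_one_lt₀ (by nlinarith)
      linarith
    · intro t (ht : 1 < t)
      have : (t + t⁻¹ - 2) / 4 = (t - 1) ^ 2 / (4 * t) := by field_simp; ring
      have h3 : 0 < t - 1 := by linarith
      rw [Set.mem_Ioi, this]
      positivity
    · intro y hy
      refine exists_le_of_tendsto_nhds (l := nhdsWithin 1 (Set.Ioi 1)) self_mem_nhdsWithin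
        (a := 0) ?_ hy
      have hct : ContinuousAt (fun t : ℝ => (t + t⁻¹ - 2) / 4) 1 := by
        fun_prop (disch := norm_num)
      have := hct.tendsto.mono_left (nhdsWithin_le_nhds (s := Set.Ioi 1))
      norm_num at this
      exact this
    · intro y (hy : 0 < y)
      refine ⟨4 * y + 2, Set.mem_Ioi.2 (by linarith), ?_⟩
      have : 0 < (4 * y + 2)⁻¹ := by positivity
      linarith
    · intro t (ht : 1 < t)
      have ht0 : 0 < t := by linarith
      have hY : 256 ≤ 256 / Y := by rw [le_div_iff₀ h0]; linarith
      have hti : 0 < t⁻¹ := by positivity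
      set E := 256 / Y - 62 + t + t⁻¹ with hE
      have hE0 : 0 < E := by linarith
      have hD0 : 0 < (1 - (t ^ 2)⁻¹) / 4 := by
        have : (t ^ 2)⁻¹ < 1 := inv_lt_one_of_one_lt₀ (by nlinarith)
        linarith
      set D := (1 - (t ^ 2)⁻¹) / 4 with hD
      have e : (t + t⁻¹ - 2) / 4 * ((1 + (t + t⁻¹ - 2) / 4) *
          (64 - 15 * Y + Y * ((t + t⁻¹ - 2) / 4))) = (D * t / 2) ^ 2 * (Y * E) := by
        rw [hD, hE]
        field_simp
        ring
      rw [e, sqrt_mul (sq_nonneg _), sqrt_sq (by positivity), abs_of_pos hD0, sqrt_mul h0.le]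
      have h4 := sq_sqrt h0.le
      have := sqrt_pos.2 h0
      have := sqrt_pos.2 hE0
      field_simp
      rw [h4]
      ring
  · rintro N ⟨hN : -1 < N, hn⟩
    have hn' : N ≤ 0 := not_lt.1 hn
    rw [sqrt_eq_zero_of_nonpos (x := N * _)]
    · simp
    · refine mul_nonpos_of_nonpos_of_nonneg hn' (mul_nonneg (by linarith) ?_)
      nlinarith

theorem lintegral_logistic {c : ℝ} :
    ∫⁻ X in Set.Ioo (-1 : ℝ) 1, ENNReal.ofReal
      (4 / (1 - X ^ 2) * (c * √(256 / (1 - X ^ 2) - 62 + c + c⁻¹))⁻¹) =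
    ∫⁻ m in Set.Ioi (0 : ℝ), ENNReal.ofReal (2 * (m * c * √(66 + 64 * (m + m⁻¹) + c + c⁻¹))⁻¹) := by
  refine lintegral_cov_inv (φ := fun m => (m - 1) / (m + 1)) (φ' := fun m => 2 / (m + 1) ^ 2)
    measurableSet_Ioi (fun X => (1 + X) / (1 - X)) ?_ ?_ ?_ ?_ ?_ ?_
  · intro m (hm : 0 < m)
    have := ((hasDerivAt_id m).sub_const 1).div ((hasDerivAt_id m).add_const 1)
      (show m + 1 ≠ 0 by positivity)
    refine this.congr_deriv ?_
    simp
    ring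
  · intro m (hm : 0 < m)
    constructor
    · rw [lt_div_iff₀ (by positivity)]; linarith
    · rw [div_lt_one (by positivity)]; linarith
  · rintro X ⟨hX, hX'⟩
    exact Set.mem_Ioi.2 (div_pos (by linarith) (by linarith))
  · intro m (hm : 0 < m)
    have : 1 - (m - 1) / (m + 1) = 2 / (m + 1) := by field_simp; ring
    rw [this]
    field_simp
    ring
  · rintro X ⟨hX, hX'⟩
    have h1 : 1 - X ≠ 0 := by linarith
    have : (1 + X) / (1 - X) + 1 = 2 / (1 - X) := by field_simp; ring
    rw [this]
    field_simp
    ring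
  · intro m (hm : 0 < m)
    have e : 1 - ((m - 1) / (m + 1)) ^ 2 = 4 * m / (m + 1) ^ 2 := by field_simp; ring
    have e2 : 256 / (4 * m / (m + 1) ^ 2) - 62 + c + c⁻¹ = 66 + 64 * (m + m⁻¹) + c + c⁻¹ := by
      field_simp
      ring
    rw [e, e2, abs_of_pos (by positivity), mul_assoc m, mul_inv]
    field_simp

theorem lintegral_Ioi_one_symm {m : ℝ} :
    ∫⁻ t in Set.Ioi (0 : ℝ), ENNReal.ofReal (m * t * √(66 + 64 * (m + m⁻¹) + t + t⁻¹))⁻¹ =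
    2 * ∫⁻ t in Set.Ioi (1 : ℝ), ENNReal.ofReal (m * t * √(66 + 64 * (m + m⁻¹) + t + t⁻¹))⁻¹ := by
  rw [← Set.Ioc_union_Ioi_eq_Ioi (zero_le_one' ℝ),
    lintegral_union measurableSet_Ioi (Set.Ioc_disjoint_Ioi le_rfl), two_mul]
  congr 1
  rw [setLIntegral_congr Ioo_ae_eq_Ioc.symm]
  refine lintegral_cov_inv (φ := fun t => t⁻¹) (φ' := fun t => -(t ^ 2)⁻¹)
    measurableSet_Ioi (fun t => t⁻¹) ?_ ?_ ?_ ?_ ?_ ?_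
  · exact fun t (ht : 1 < t) => hasDerivAt_inv (by positivity)
  · exact fun t (ht : 1 < t) => ⟨by positivity, inv_lt_one_of_one_lt₀ ht⟩
  · exact fun t ht => (one_lt_inv₀ ht.1).2 ht.2
  · exact fun t _ => inv_inv t
  · exact fun t _ => inv_inv t
  · intro t (ht : 1 < t)
    have ht0 : 0 < t := by linarith
    rw [abs_neg, abs_of_pos (by positivity), inv_inv,
      show 66 + 64 * (m + m⁻¹) + t⁻¹ + t = 66 + 64 * (m + m⁻¹) + t + t⁻¹ by ring]
    simp only [mul_inv, inv_inv]
    field_simp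

theorem lintegral_window_eq_doubleLog :
    ∫⁻ b in Set.Ioo (0 : ℝ) 1, ∫⁻ h in Set.Ioo (0 : ℝ) 1, ENNReal.ofReal
      (√((1 - h) * (h - b * (1 - b)) * (b * (1 - b) * (1 + 3 * h) - h * (1 - h))))⁻¹ =
    doubleLog := by
  rw [lintegral_lintegral_swap (by fun_prop)]
  rw [setLIntegral_congr_fun measurableSet_Ioo fun h hh => lintegral_window hh.1 hh.2]
  rw [lintegral_lintegral_swap (by fun_prop)]
  have hY : ∀ X ∈ Set.Ioo (-1 : ℝ) 1, 0 < 1 - X ^ 2 ∧ 1 - X ^ 2 ≤ 1 := fun X hX =>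
    ⟨by nlinarith [hX.1, hX.2], by nlinarith [sq_nonneg X]⟩
  rw [setLIntegral_congr_fun measurableSet_Ioo fun X hX =>
    (lintegral_window_cubic (hY X hX).1 (hY X hX).2).trans
      (lintegral_cubic_eq (hY X hX).1 (hY X hX).2)]
  rw [lintegral_lintegral_swap (by fun_prop)]
  simp_rw [lintegral_logistic]
  rw [lintegral_lintegral_swap (by fun_prop), doubleLog]
  simp_rw [lintegral_Ioi_one_symm]
  refine lintegral_congr fun m => ?_
  rw [← lintegral_const_mul' _ _ (by norm_num)]
  refine lintegral_congr fun t => ?_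
  rw [ENNReal.ofReal_mul (by norm_num)]
  norm_num

end

section

open Real

/-- `|x| ^ (-1/4)`, with value `0` at `0`. -/
noncomputable def quarterInv (x : ℝ) : ℝ := |x| ^ (-(1 / 4) : ℝ)

theorem quarterInv_nonneg (x : ℝ) : 0 ≤ quarterInv x := rpow_nonneg (abs_nonneg x) _

theorem quarterInv_mul (x y : ℝ) : quarterInv (x * y) = quarterInv x * quarterInv y := by
  rw [quarterInv, abs_mul, mul_rpow (abs_nonneg _) (abs_nonneg _)]; rfl

theorem quarterInv_neg (x : ℝ) : quarterInv (-x) = quarterInv x := by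
  rw [quarterInv, abs_neg]; rfl

theorem quarterInv_zero : quarterInv 0 = 0 := by
  rw [quarterInv, abs_zero, zero_rpow (by norm_num)]

theorem quarterInv_one : quarterInv 1 = 1 := by
  rw [quarterInv, abs_one, one_rpow]

theorem quarterInv_le {x y : ℝ} (hx : x ≠ 0) (hxy : |x| ≤ |y|) : quarterInv y ≤ quarterInv x :=
  rpow_le_rpow_of_nonpos (abs_pos.2 hx) hxy (by norm_num)

theorem quarterInv_le_one {x : ℝ} (hx : 1 ≤ |x|) : quarterInv x ≤ 1 :=
  quarterInv_one ▸ quarterInv_le one_ne_zero (by simpa using hx)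

theorem quarterInv_sq (x : ℝ) : quarterInv x ^ 2 = (√|x|)⁻¹ := by
  rw [quarterInv, ← rpow_mul_natCast (abs_nonneg x), sqrt_eq_rpow, ← rpow_neg (abs_nonneg x)]
  norm_num

theorem quarterInv_cube (x : ℝ) : quarterInv x ^ 3 = |x| ^ (-(3 / 4) : ℝ) := by
  rw [quarterInv, ← rpow_mul_natCast (abs_nonneg x)]
  norm_num

theorem quarterInv_inv (x : ℝ) : quarterInv x⁻¹ = (quarterInv x)⁻¹ := by
  rw [quarterInv, abs_inv, inv_rpow (abs_nonneg x)]; rfl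

theorem quarterInv_pow_four (x : ℝ) : quarterInv x ^ 4 = |x|⁻¹ := by
  rw [quarterInv, ← rpow_mul_natCast (abs_nonneg x), ← rpow_neg_one]
  norm_num

@[fun_prop]
theorem measurable_quarterInv : Measurable quarterInv := by
  unfold quarterInv; fun_prop

theorem quarterInv_half_le : quarterInv (1 / 2) ≤ 2 := by
  have h := quarterInv_pow_four (1 / 2)
  rw [abs_of_pos (by norm_num)] at h
  by_contra! hc
  have : (2 : ℝ) ^ 4 < quarterInv (1 / 2) ^ 4 := by gcongr
  norm_num [h] at this

theorem quarterInv_sq_mul_sq_le {x y : ℝ} (h : x ≠ y) : quarterInv x ^ 2 * quarterInv y ^ 2 ≤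
    2 * (quarterInv (x - y) * (quarterInv x ^ 3 + quarterInv y ^ 3)) := by
  have key : ∀ x y : ℝ, x ≠ y → |y| ≤ |x| → quarterInv x ^ 2 * quarterInv y ^ 2 ≤
      2 * (quarterInv (x - y) * (quarterInv x ^ 3 + quarterInv y ^ 3)) := by
    intro x y h hyx
    have hX := quarterInv_nonneg x
    have hY := quarterInv_nonneg y
    have hD := quarterInv_nonneg (x - y)
    rcases eq_or_ne y 0 with rfl | hy
    · rw [quarterInv_zero]
      simp only [ne_eq, OfNat.ofNat_ne_zero, not_false_eq_true, zero_pow, mul_zero]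
      positivity
    have h1 : quarterInv x ≤ quarterInv y := quarterInv_le hy hyx
    have h2 : quarterInv x ≤ 2 * quarterInv (x - y) := by
      calc quarterInv x ≤ quarterInv (1 / 2 * (x - y)) := by
            refine quarterInv_le (mul_ne_zero (by norm_num) (sub_ne_zero.2 h)) ?_
            rw [abs_mul, abs_of_pos (by norm_num : (0 : ℝ) < 1 / 2)]
            linarith [abs_sub x y]
        _ ≤ _ := by
            rw [quarterInv_mul]
            exact mul_le_mul_of_nonneg_right quarterInv_half_le hD
    calc quarterInv x ^ 2 * quarterInv y ^ 2 = quarterInv x * (quarterInv x * quarterInv y ^ 2) := by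
          ring
      _ ≤ (2 * quarterInv (x - y)) * (quarterInv y * quarterInv y ^ 2) := by gcongr
      _ ≤ _ := by
        have : 0 ≤ quarterInv (x - y) * quarterInv x ^ 3 := by positivity
        linarith
  rcases le_total |y| |x| with hyx | hxy
  · exact key x y h hyx
  · have := key y x h.symm hxy
    rw [← quarterInv_neg (y - x), neg_sub] at this
    linarith

theorem integrable_quarterInv_sq_add_one :
    Integrable fun x : ℝ => quarterInv (x ^ 2 + 1) ^ 3 := by
  have := integrable_rpow_neg_one_add_norm_sq (E := ℝ) (μ := volume) (r := 3 / 2) (by norm_num)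
  refine this.congr (Filter.Eventually.of_forall fun x => ?_)
  simp only [quarterInv_cube, norm_eq_abs, sq_abs]
  rw [abs_of_pos (by positivity), add_comm]
  norm_num

theorem intervalIntegrable_quarterInv (c d : ℝ) :
    IntervalIntegrable (fun x : ℝ => quarterInv x ^ 3) volume c d := by
  have h : ∀ c : ℝ, 0 ≤ c → IntervalIntegrable (fun x : ℝ => quarterInv x ^ 3) volume 0 c := by
    intro c hc
    refine (intervalIntegral.intervalIntegrable_rpow' (r := -(3 / 4)) (by norm_num)).congr ?_
    intro x hx
    rw [Set.uIoc_of_le hc] at hx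
    simp only [quarterInv_cube, abs_of_pos hx.1]
  have h' : ∀ c : ℝ, IntervalIntegrable (fun x : ℝ => quarterInv x ^ 3) volume 0 c := by
    intro c
    rcases le_total 0 c with hc | hc
    · exact h c hc
    · rw [IntervalIntegrable.iff_comp_neg]
      simpa [quarterInv_neg] using h (-c) (by linarith)
  exact (h' c).symm.trans (h' d)

theorem integrableOn_quarterInv (a : ℝ) {c d : ℝ} (hcd : c ≤ d) :
    IntegrableOn (fun x : ℝ => quarterInv (x - a) ^ 3) (Set.Icc c d) := by
  rw [← intervalIntegrable_iff_integrableOn_Icc_of_le hcd]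
  simpa using (intervalIntegrable_quarterInv (c - a) (d - a)).comp_sub_right a

theorem integrable_quarterInv_sq_sub_one :
    Integrable fun x : ℝ => quarterInv (x ^ 2 - 1) ^ 3 := by
  rw [← integrableOn_univ, ← Set.union_compl_self (Set.Icc (-2 : ℝ) 2)]
  refine IntegrableOn.union ?_ ?_
  · refine ((integrableOn_quarterInv 1 (by norm_num)).add (integrableOn_quarterInv (-1) (by norm_num))).mono'
      (Measurable.aestronglyMeasurable (by fun_prop)) (Filter.Eventually.of_forall fun x => ?_)
    rw [norm_of_nonneg (pow_nonneg (quarterInv_nonneg _) 3),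
      show x ^ 2 - 1 = (x - 1) * (x - (-1)) by ring, quarterInv_mul, mul_pow]
    have h1 := quarterInv_nonneg (x - 1)
    have h2 := quarterInv_nonneg (x - (-1))
    simp only [Pi.add_apply]
    rcases le_total 0 x with hx | hx
    · have : quarterInv (x - (-1)) ≤ 1 := quarterInv_le_one (le_abs.2 (Or.inl (by linarith)))
      have := pow_le_one₀ (n := 3) h2 this
      nlinarith [pow_nonneg h1 3, pow_nonneg h2 3]
    · have : quarterInv (x - 1) ≤ 1 := quarterInv_le_one (le_abs.2 (Or.inr (by linarith)))
      have := pow_le_one₀ (n := 3) h1 this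
      nlinarith [pow_nonneg h1 3, pow_nonneg h2 3]
  · refine ((integrable_quarterInv_sq_add_one.const_mul 8).integrableOn).mono'
      (Measurable.aestronglyMeasurable (by fun_prop)) ((ae_restrict_iff' measurableSet_Icc.compl).2
        (Filter.Eventually.of_forall fun x hx => ?_))
    have hx2 : 4 ≤ x ^ 2 := by
      by_contra! hc
      exact hx ⟨by nlinarith, by nlinarith⟩
    have hq := quarterInv_nonneg (x ^ 2 + 1)
    have h1 : quarterInv (x ^ 2 - 1) ≤ 2 * quarterInv (x ^ 2 + 1) := by
      calc _ ≤ quarterInv (1 / 2 * (x ^ 2 + 1)) := by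
            refine quarterInv_le (by positivity) ?_
            rw [abs_of_pos (by positivity), abs_of_pos (by linarith)]
            linarith
        _ ≤ _ := by
            rw [quarterInv_mul]
            exact mul_le_mul_of_nonneg_right quarterInv_half_le hq
    rw [norm_of_nonneg (pow_nonneg (quarterInv_nonneg _) 3)]
    calc _ ≤ (2 * quarterInv (x ^ 2 + 1)) ^ 3 := by
          gcongr
          exact quarterInv_nonneg _
      _ = _ := by ring

theorem exists_lintegral_quarterInv_cube_le : ∃ C : ENNReal, C ≠ ⊤ ∧ ∀ α : ℝ, α ≠ 0 →
    ∫⁻ x : ℝ, ENNReal.ofReal (quarterInv (x ^ 2 - α) ^ 3) ≤ C * ENNReal.ofReal (quarterInv α) := by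
  refine ⟨(∫⁻ x : ℝ, ENNReal.ofReal (quarterInv (x ^ 2 - 1) ^ 3)) +
    ∫⁻ x : ℝ, ENNReal.ofReal (quarterInv (x ^ 2 + 1) ^ 3),
    ENNReal.add_ne_top.2 ⟨integrable_quarterInv_sq_sub_one.lintegral_lt_top.ne,
      integrable_quarterInv_sq_add_one.lintegral_lt_top.ne⟩, fun α hα => ?_⟩
  obtain ⟨δ, hδ, hδ'⟩ : ∃ δ : ℝ, (δ = 1 ∨ δ = -1) ∧ α = |α| * δ := by
    rcases le_total 0 α with h | h
    · exact ⟨1, Or.inl rfl, by rw [abs_of_nonneg h, mul_one]⟩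
    · exact ⟨-1, Or.inr rfl, by rw [abs_of_nonpos h]; ring⟩
  have hα0 : 0 < √|α| := sqrt_pos.2 (abs_pos.2 hα)
  have hsq : √|α| ^ 2 = |α| := sq_sqrt (abs_nonneg α)
  have hs : √|α| * quarterInv α ^ 2 = 1 := by
    rw [quarterInv_sq, mul_inv_cancel₀ hα0.ne']
  have : ∫⁻ x : ℝ, ENNReal.ofReal (quarterInv (x ^ 2 - α) ^ 3) =
      ∫⁻ z : ℝ, ENNReal.ofReal (quarterInv α * quarterInv (z ^ 2 - δ) ^ 3) := by
    rw [← setLIntegral_univ, ← setLIntegral_univ (fun z => ENNReal.ofReal (_ * _))]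
    refine lintegral_cov_inv (φ := fun z => √|α| * z) (φ' := fun _ => √|α|) MeasurableSet.univ
      (fun y => y / √|α|) ?_ (by simp) (by simp) ?_ ?_ ?_
    · intro x _
      simpa using (hasDerivAt_id x).const_mul √|α|
    · intro x _; field_simp
    · intro x _; field_simp
    · intro z _
      have e : (√|α| * z) ^ 2 - α = α * (δ * (z ^ 2 - δ)) := by
        have hd : δ ^ 2 = 1 := by rcases hδ with h | h <;> simp [h]
        rw [mul_pow, hsq]
        calc |α| * z ^ 2 - α = |α| * δ ^ 2 * z ^ 2 - |α| * δ * δ ^ 2 := by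
              rw [hd, mul_one, mul_one, ← hδ']
          _ = (|α| * δ) * (δ * (z ^ 2 - δ)) := by ring
          _ = _ := by rw [← hδ']
      have hqd : quarterInv δ = 1 := by
        rcases hδ with h | h <;> simp [h, quarterInv_neg, quarterInv_one]
      rw [e, quarterInv_mul, quarterInv_mul, hqd, one_mul, abs_of_pos hα0, mul_pow]
      linear_combination (-(quarterInv α * quarterInv (z ^ 2 - δ) ^ 3)) * hs
  rw [this]
  simp_rw [ENNReal.ofReal_mul (quarterInv_nonneg α)]
  rw [lintegral_const_mul' _ _ ENNReal.ofReal_ne_top, mul_comm]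
  gcongr
  rcases hδ with h | h
  · rw [h]; exact le_self_add
  · simp only [h, sub_neg_eq_add]; exact le_add_self

theorem exists_lintegral_quarterInv_sq_mul_sq_le : ∃ C : ENNReal, C ≠ ⊤ ∧ ∀ α β : ℝ,
    α ≠ 0 → β ≠ 0 → α ≠ β →
    ∫⁻ x : ℝ, ENNReal.ofReal (quarterInv (x ^ 2 - α) ^ 2 * quarterInv (x ^ 2 - β) ^ 2) ≤
      C * ENNReal.ofReal (quarterInv (α - β) * (quarterInv α + quarterInv β)) := by
  obtain ⟨C, hC, h⟩ := exists_lintegral_quarterInv_cube_le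
  refine ⟨2 * C, ENNReal.mul_ne_top (by norm_num) hC, fun α β hα hβ hαβ => ?_⟩
  have hq := fun x => quarterInv_nonneg x
  calc _ ≤ ∫⁻ x : ℝ, ENNReal.ofReal (2 * quarterInv (α - β)) *
        (ENNReal.ofReal (quarterInv (x ^ 2 - α) ^ 3) +
          ENNReal.ofReal (quarterInv (x ^ 2 - β) ^ 3)) := by
        refine lintegral_mono fun x => ?_
        rw [← ENNReal.ofReal_add (pow_nonneg (hq _) 3) (pow_nonneg (hq _) 3),
          ← ENNReal.ofReal_mul (mul_nonneg zero_le_two (hq _))]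
        refine ENNReal.ofReal_le_ofReal ?_
        have := quarterInv_sq_mul_sq_le (x := x ^ 2 - α) (y := x ^ 2 - β)
          (fun h => hαβ (by linarith))
        rw [show x ^ 2 - α - (x ^ 2 - β) = -(α - β) by ring, quarterInv_neg] at this
        linarith
    _ ≤ ENNReal.ofReal (2 * quarterInv (α - β)) *
        (C * ENNReal.ofReal (quarterInv α) + C * ENNReal.ofReal (quarterInv β)) := by
        rw [lintegral_const_mul' _ _ ENNReal.ofReal_ne_top, lintegral_add_left (by fun_prop)]
        gcongr
        · exact h α hα
        · exact h β hβ
    _ = _ := by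
        rw [ENNReal.ofReal_mul zero_le_two, ENNReal.ofReal_mul (hq _),
          ENNReal.ofReal_add (hq _) (hq _)]
        norm_num
        ring

theorem lintegral_quarterInv_cube_mul_cube_ne_top {a b : ℝ} (hab : a ≠ b) :
    ∫⁻ x : ℝ, ENNReal.ofReal (quarterInv (x - a) ^ 3 * quarterInv (x - b) ^ 3) ≠ ⊤ := by
  obtain ⟨C, hC, h⟩ := exists_lintegral_quarterInv_cube_le
  have := h (((a - b) / 2) ^ 2) (pow_ne_zero 2 (div_ne_zero (sub_ne_zero.2 hab) two_ne_zero))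
  rw [← lintegral_sub_right_eq_self _ ((a + b) / 2)] at this
  refine ne_top_of_le_ne_top (ENNReal.mul_ne_top hC ENNReal.ofReal_ne_top) (le_of_eq_of_le ?_ this)
  refine lintegral_congr fun x => ?_
  rw [← mul_pow, ← quarterInv_mul]
  congr 3
  ring

end

section

open Real

/-- The second elementary symmetric function of `h`, `x`, `1 - h - x`. -/
noncomputable def symTwo (h x : ℝ) : ℝ := x * (1 - h - x) + h * (1 - h)

/-- The third elementary symmetric function of `h`, `x`, `1 - h - x`. -/
noncomputable def symThree (h x : ℝ) : ℝ := h * x * (1 - h - x)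

@[fun_prop]
theorem measurable_symTwo : Measurable fun p : ℝ × ℝ => symTwo p.1 p.2 := by
  unfold symTwo; fun_prop

@[fun_prop]
theorem measurable_symThree : Measurable fun p : ℝ × ℝ => symThree p.1 p.2 := by
  unfold symThree; fun_prop

theorem pow_mul_le_sum_cubes {P Q R : ℝ} (hP : 0 ≤ P) (hQ : 0 ≤ Q) (hR : 0 ≤ R) :
    P ^ 2 * Q ^ 2 * R ^ 2 ≤ P ^ 3 * Q ^ 3 + Q ^ 3 * R ^ 3 + P ^ 3 * R ^ 3 := by
  have h : ∀ a b c : ℝ, 0 ≤ a → 0 ≤ b → 0 ≤ c → a * b * c ≤ a ^ 3 + b ^ 3 + c ^ 3 := by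
    intro a b c ha hb hc
    have h1 : 0 ≤ (a + b + c) * ((a - b) ^ 2 + (b - c) ^ 2 + (a - c) ^ 2) := by positivity
    have h2 : 0 ≤ a * b * c := by positivity
    nlinarith
  have := h (P * Q) (Q * R) (P * R) (by positivity) (by positivity) (by positivity)
  nlinarith

theorem quarterInv_four_le : quarterInv 4 ≤ 1 := quarterInv_le_one (by norm_num)

theorem quarterInv_div_four_le (x : ℝ) : quarterInv (x / 4) ≤ 4 * quarterInv x := by
  have h := mul_le_mul quarterInv_half_le quarterInv_half_le (quarterInv_nonneg _) zero_le_two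
  rw [← quarterInv_mul] at h
  rw [show x / 4 = (1 / 2 * (1 / 2)) * x by ring, quarterInv_mul]
  exact mul_le_mul_of_nonneg_right (h.trans (by norm_num)) (quarterInv_nonneg _)

theorem lintegral_sym_ne_top :
    ∫⁻ h : ℝ, ∫⁻ x : ℝ, ENNReal.ofReal (quarterInv (symTwo h x * symThree h x) ^ 2) ≠ ⊤ := by
  obtain ⟨C, hC, hCb⟩ := exists_lintegral_quarterInv_sq_mul_sq_le
  have hq := quarterInv_nonneg
  have key : ∀ h : ℝ, h ∉ ({0, 1, -1 / 3} : Set ℝ) →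
      ∫⁻ x : ℝ, ENNReal.ofReal (quarterInv (symTwo h x * symThree h x) ^ 2) ≤
      C * (16 * (ENNReal.ofReal (quarterInv (h - 0) ^ 3 * quarterInv (h - 1) ^ 3) +
        ENNReal.ofReal (quarterInv (h - 0) ^ 3 * quarterInv (h - -1 / 3) ^ 3))) := by
    intro h hh
    simp only [Set.mem_insert_iff, Set.mem_singleton_iff, not_or] at hh
    obtain ⟨h0, h1, h3⟩ := hh
    have h1' : 1 - h ≠ 0 := sub_ne_zero.2 (Ne.symm h1)
    have h3' : h - -1 / 3 ≠ 0 := sub_ne_zero.2 h3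
    set α := (1 - h) ^ 2 / 4 with hα
    set β := (1 - h) * (3 * (h - -1 / 3)) / 4 with hβ
    have hα0 : α ≠ 0 := by positivity
    have hβ0 : β ≠ 0 := by positivity
    have hαβ : α - β = -(h * (1 - h)) := by rw [hα, hβ]; ring
    have hαβ0 : α ≠ β := by
      rw [← sub_ne_zero, hαβ]; exact neg_ne_zero.2 (mul_ne_zero h0 h1')
    have hle := hCb α β hα0 hβ0 hαβ0
    rw [← lintegral_sub_right_eq_self _ ((1 - h) / 2)] at hle
    have e : ∀ x : ℝ, ENNReal.ofReal (quarterInv (symTwo h x * symThree h x) ^ 2) =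
        ENNReal.ofReal (quarterInv h ^ 2) * ENNReal.ofReal
          (quarterInv ((x - (1 - h) / 2) ^ 2 - α) ^ 2 *
            quarterInv ((x - (1 - h) / 2) ^ 2 - β) ^ 2) := by
      intro x
      rw [← ENNReal.ofReal_mul (by positivity), ← mul_pow, ← mul_pow, ← quarterInv_mul,
        ← quarterInv_mul]
      congr 3
      rw [hα, hβ, symTwo, symThree]
      ring
    simp_rw [e]
    rw [lintegral_const_mul' _ _ ENNReal.ofReal_ne_top]
    refine (mul_le_mul_right hle _).trans ?_
    rw [mul_left_comm]
    refine mul_le_mul_right ?_ _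
    have hn := fun x y : ℝ => mul_nonneg (pow_nonneg (hq x) 3) (pow_nonneg (hq y) 3)
    rw [← ENNReal.ofReal_mul (by positivity), ← ENNReal.ofReal_add (hn _ _) (hn _ _),
      show (16 : ENNReal) = ENNReal.ofReal 16 by norm_num, ← ENNReal.ofReal_mul (by norm_num)]
    refine ENNReal.ofReal_le_ofReal ?_
    have hA : quarterInv α ≤ 4 * quarterInv (h - 1) ^ 2 := by
      rw [hα]
      refine (quarterInv_div_four_le _).trans_eq ?_
      rw [sq, quarterInv_mul, ← neg_sub h 1, quarterInv_neg]; ring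
    have hB : quarterInv β ≤ 4 * (quarterInv (h - 1) * quarterInv (h - -1 / 3)) := by
      rw [hβ]
      refine (quarterInv_div_four_le _).trans ?_
      rw [quarterInv_mul, quarterInv_mul 3, ← neg_sub h 1, quarterInv_neg]
      have : quarterInv 3 ≤ 1 := quarterInv_le_one (by norm_num)
      gcongr
      · exact hq _
      · exact mul_le_of_le_one_left (hq _) this
    rw [hαβ, quarterInv_neg, quarterInv_mul, ← neg_sub h 1, quarterInv_neg, sub_zero]
    set A := quarterInv h
    set B := quarterInv (h - 1)
    set D := quarterInv (h - -1 / 3)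
    have hA0 : 0 ≤ A := hq _
    have hB0 : 0 ≤ B := hq _
    have hD0 : 0 ≤ D := hq _
    have hBD : B ^ 2 * D ≤ B ^ 3 + D ^ 3 := by
      rcases le_total B D with h | h
      · have : B ^ 2 * D ≤ D ^ 2 * D := by gcongr
        nlinarith [pow_nonneg hB0 3]
      · have : B ^ 2 * D ≤ B ^ 2 * B := by gcongr
        nlinarith [pow_nonneg hD0 3]
    calc A ^ 2 * (A * B * (quarterInv α + quarterInv β)) ≤
        A ^ 2 * (A * B * (4 * B ^ 2 + 4 * (B * D))) := by gcongr
      _ = A ^ 3 * (4 * B ^ 3 + 4 * (B ^ 2 * D)) := by ring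
      _ ≤ A ^ 3 * (4 * B ^ 3 + 4 * (B ^ 3 + D ^ 3)) := by gcongr
      _ ≤ _ := by
        have : 0 ≤ A ^ 3 * B ^ 3 := by positivity
        have : 0 ≤ A ^ 3 * D ^ 3 := by positivity
        linarith
  refine ne_top_of_le_ne_top ?_ (lintegral_mono_ae ?_ (g := fun h =>
      C * (16 * (ENNReal.ofReal (quarterInv (h - 0) ^ 3 * quarterInv (h - 1) ^ 3) +
        ENNReal.ofReal (quarterInv (h - 0) ^ 3 * quarterInv (h - -1 / 3) ^ 3)))))
  · rw [lintegral_const_mul' _ _ hC, lintegral_const_mul' _ _ (by norm_num),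
      lintegral_add_left (by fun_prop)]
    exact ENNReal.mul_ne_top hC (ENNReal.mul_ne_top (by norm_num) (ENNReal.add_ne_top.2
      ⟨lintegral_quarterInv_cube_mul_cube_ne_top (by norm_num),
        lintegral_quarterInv_cube_mul_cube_ne_top (by norm_num)⟩))
  · have : ({0, 1, -1 / 3} : Set ℝ).Finite := by simp
    filter_upwards [this.countable.ae_notMem volume] with h hh using key h hh

/-- Up to the factor `-(1 / 4)`, the discriminant of the quadratic
`x ↦ b (1 - b) symTwo h x - symThree h x`, times its leading coefficient. -/
noncomputable def discW (b h : ℝ) : ℝ :=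
  (b * (1 - b) - h) * (1 - h) * ((b * (1 - b) - h) * (1 - h) + 4 * (b * (1 - b)) * h)

@[fun_prop]
theorem measurable_discW : Measurable fun p : ℝ × ℝ => discW p.1 p.2 := by
  unfold discW; fun_prop

theorem lintegral_discW_pos_ne_top :
    ∫⁻ h in Set.Ioi (0 : ℝ), ∫⁻ b : ℝ, ENNReal.ofReal (quarterInv (discW b h) ^ 2) ≠ ⊤ := by
  obtain ⟨C, hC, hCb⟩ := exists_lintegral_quarterInv_sq_mul_sq_le
  have hq := quarterInv_nonneg
  have key : ∀ h : ℝ, 0 < h → h ∉ ({1, 1 / 4} : Set ℝ) →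
      ∫⁻ b : ℝ, ENNReal.ofReal (quarterInv (discW b h) ^ 2) ≤
      C * (65 * (ENNReal.ofReal (quarterInv (h - 1) ^ 3 * quarterInv (h - 0) ^ 3) +
        ENNReal.ofReal (quarterInv (h - 0) ^ 3 * quarterInv (h - 1 / 4) ^ 3) +
        ENNReal.ofReal (quarterInv (h - 1) ^ 3 * quarterInv (h - 1 / 4) ^ 3))) := by
    intro h h0 hh
    simp only [Set.mem_insert_iff, Set.mem_singleton_iff, not_or] at hh
    obtain ⟨h1, h4⟩ := hh
    have h13 : 0 < 1 + 3 * h := by positivity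
    have hc : 0 < 4 * h ^ 2 - h + 1 := by nlinarith
    set α := 1 / 4 - h with hα
    set β := (4 * h ^ 2 - h + 1) / (4 * (1 + 3 * h)) with hβ
    have hα0 : α ≠ 0 := sub_ne_zero.2 (Ne.symm h4)
    have hβ0 : 0 < β := by positivity
    have hαβ : α - β = -(4 * h ^ 2 / (1 + 3 * h)) := by rw [hα, hβ]; field_simp; ring
    have hαβ0 : α ≠ β := by
      rw [← sub_ne_zero, hαβ]; exact neg_ne_zero.2 (by positivity)
    have hle := hCb α β hα0 hβ0.ne' hαβ0
    rw [← lintegral_sub_right_eq_self _ (1 / 2)] at hle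
    have e : ∀ b : ℝ, ENNReal.ofReal (quarterInv (discW b h) ^ 2) =
        ENNReal.ofReal (quarterInv ((1 - h) * (1 + 3 * h)) ^ 2) * ENNReal.ofReal
          (quarterInv ((b - 1 / 2) ^ 2 - α) ^ 2 * quarterInv ((b - 1 / 2) ^ 2 - β) ^ 2) := by
      intro b
      rw [← ENNReal.ofReal_mul (by positivity), ← mul_pow, ← mul_pow, ← quarterInv_mul,
        ← quarterInv_mul]
      congr 3
      rw [hα, hβ, discW]
      field_simp
      ring
    simp_rw [e]
    rw [lintegral_const_mul' _ _ ENNReal.ofReal_ne_top]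
    refine (mul_le_mul_right hle _).trans ?_
    rw [mul_left_comm]
    refine mul_le_mul_right ?_ _
    have hn := fun x y : ℝ => mul_nonneg (pow_nonneg (hq x) 3) (pow_nonneg (hq y) 3)
    rw [← ENNReal.ofReal_mul (by positivity), ← ENNReal.ofReal_add (hn _ _) (hn _ _),
      ← ENNReal.ofReal_add (add_nonneg (hn _ _) (hn _ _)) (hn _ _),
      show (65 : ENNReal) = ENNReal.ofReal 65 by norm_num, ← ENNReal.ofReal_mul (by norm_num)]
    refine ENNReal.ofReal_le_ofReal ?_
    set P := quarterInv (h - 1)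
    set Q := quarterInv h with hQ
    set R := quarterInv (h - 1 / 4) with hR
    set S := quarterInv (1 + 3 * h) with hS
    have hP0 : 0 ≤ P := hq _
    have hQ0 : 0 ≤ Q := hq _
    have hR0 : 0 ≤ R := hq _
    have hS0 : 0 < S := rpow_pos_of_pos (abs_pos.2 h13.ne') _
    have hSR : S ≤ R := by
      refine quarterInv_le (sub_ne_zero.2 h4) ?_
      rw [abs_of_pos h13, abs_le]
      constructor <;> linarith
    have hA : quarterInv α = R := by rw [hα, ← neg_sub, quarterInv_neg]
    have hB : quarterInv β ≤ 64 * S := by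
      calc quarterInv β ≤ quarterInv ((1 + 3 * h) / 4 / 4 / 4) := by
            refine quarterInv_le (by positivity) ?_
            rw [abs_of_pos (by positivity), abs_of_pos hβ0, hβ, le_div_iff₀ (by positivity)]
            nlinarith [sq_nonneg (2 * h - 1)]
        _ ≤ 4 * (4 * (4 * S)) := by
            refine (quarterInv_div_four_le _).trans ?_
            gcongr
            refine (quarterInv_div_four_le _).trans ?_
            gcongr
            exact quarterInv_div_four_le _
        _ = _ := by ring
    have hd : quarterInv (α - β) ≤ Q ^ 2 / S := by
      rw [hαβ, quarterInv_neg, div_eq_mul_inv, quarterInv_mul, quarterInv_inv, quarterInv_mul,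
        sq h, quarterInv_mul, ← hQ, ← hS, ← sq, div_eq_mul_inv]
      gcongr
      exact mul_le_of_le_one_left (by positivity) quarterInv_four_le
    rw [hA, quarterInv_mul, ← neg_sub h 1, quarterInv_neg, sub_zero, ← hQ]
    calc (P * S) ^ 2 * (quarterInv (α - β) * (R + quarterInv β)) ≤
        (P * S) ^ 2 * (Q ^ 2 / S * (R + 64 * R)) := by
          have := hq β
          gcongr
          linarith
      _ = 65 * (P ^ 2 * Q ^ 2 * (S * R)) := by field_simp; ring
      _ ≤ 65 * (P ^ 2 * Q ^ 2 * (R * R)) := by gcongr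
      _ = 65 * (P ^ 2 * Q ^ 2 * R ^ 2) := by ring
      _ ≤ _ := by
        gcongr
        exact pow_mul_le_sum_cubes hP0 hQ0 hR0
  refine ne_top_of_le_ne_top ?_ (lintegral_mono_ae ?_ (g := fun h =>
      C * (65 * (ENNReal.ofReal (quarterInv (h - 1) ^ 3 * quarterInv (h - 0) ^ 3) +
        ENNReal.ofReal (quarterInv (h - 0) ^ 3 * quarterInv (h - 1 / 4) ^ 3) +
        ENNReal.ofReal (quarterInv (h - 1) ^ 3 * quarterInv (h - 1 / 4) ^ 3)))))
  · rw [lintegral_const_mul' _ _ hC, lintegral_const_mul' _ _ (by norm_num),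
      lintegral_add_left (by fun_prop), lintegral_add_left (by fun_prop)]
    have hf : ∀ a b : ℝ, a ≠ b → ∫⁻ x in Set.Ioi 0,
        ENNReal.ofReal (quarterInv (x - a) ^ 3 * quarterInv (x - b) ^ 3) ≠ ⊤ := fun a b hab =>
      ne_top_of_le_ne_top (lintegral_quarterInv_cube_mul_cube_ne_top hab)
        (setLIntegral_le_lintegral _ _)
    exact ENNReal.mul_ne_top hC (ENNReal.mul_ne_top (by norm_num) (ENNReal.add_ne_top.2
      ⟨ENNReal.add_ne_top.2 ⟨hf _ _ (by norm_num), hf _ _ (by norm_num)⟩, hf _ _ (by norm_num)⟩))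
  · have : ({1, 1 / 4} : Set ℝ).Finite := by simp
    filter_upwards [(ae_restrict_of_ae (this.countable.ae_notMem volume)),
      ae_restrict_mem measurableSet_Ioi] with h hh h0 using key h h0 hh

theorem lintegral_quarterInv_unit_ne_top :
    ∫⁻ b in Set.Ioo (0 : ℝ) 1, ENNReal.ofReal (quarterInv (b * (1 - b)) ^ 3) ≠ ⊤ := by
  refine ne_top_of_le_ne_top (lintegral_quarterInv_cube_mul_cube_ne_top (a := 0) (b := 1)
    (by norm_num)) ((setLIntegral_le_lintegral _ _).trans_eq (lintegral_congr fun b => ?_))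
  rw [quarterInv_mul, mul_pow, sub_zero, ← neg_sub b 1, quarterInv_neg]

theorem one_le_quarterInv_unit {b : ℝ} (hb : b ∈ Set.Ioo (0 : ℝ) 1) :
    1 ≤ quarterInv (b * (1 - b)) := by
  have : 0 < b * (1 - b) := mul_pos hb.1 (by linarith [hb.2])
  refine quarterInv_one.symm.trans_le (quarterInv_le this.ne' ?_)
  rw [abs_of_pos this, abs_one]
  nlinarith [sq_nonneg (b - 1 / 2)]

theorem lintegral_discW_neg_ne_top :
    ∫⁻ h in Set.Iio (0 : ℝ), ∫⁻ b in Set.Ioo (0 : ℝ) 1,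
      ENNReal.ofReal (quarterInv (discW b h) ^ 2) ≠ ⊤ := by
  have hq := quarterInv_nonneg
  have key : ∀ h ∈ Set.Iio (0 : ℝ), ∀ b ∈ Set.Ioo (0 : ℝ) 1,
      ENNReal.ofReal (quarterInv (discW b h) ^ 2) ≤
      ENNReal.ofReal (16 * (quarterInv (h - 0) ^ 3 * quarterInv (h - 1) ^ 3)) *
        ENNReal.ofReal (quarterInv (b * (1 - b)) ^ 3) := by
    intro h (h0 : h < 0) b hb
    have hn := mul_nonneg (pow_nonneg (hq (h - 0)) 3) (pow_nonneg (hq (h - 1)) 3)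
    rw [← ENNReal.ofReal_mul (by positivity)]
    refine ENNReal.ofReal_le_ofReal ?_
    have hU := one_le_quarterInv_unit hb
    have hu : 0 < b * (1 - b) := mul_pos hb.1 (by linarith [hb.2])
    have hu4 : b * (1 - b) ≤ 1 / 4 := by nlinarith [sq_nonneg (b - 1 / 2)]
    set u := b * (1 - b) with hudef
    have ht : 0 < -h := by linarith
    have h1 : 0 < 1 - h := by linarith
    have hA : quarterInv (u - h) ^ 2 ≤ quarterInv u * quarterInv h := by
      rw [sq, ← quarterInv_mul, ← quarterInv_mul, ← quarterInv_neg (u * h)]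
      refine quarterInv_le (by rw [← mul_neg]; positivity) ?_
      rw [← mul_neg, abs_of_pos (by positivity), abs_of_nonneg (mul_self_nonneg _)]
      nlinarith [sq_nonneg (u + h)]
    have hB : quarterInv ((u - h) * (1 - h) + 4 * u * h) ≤
        4 * (quarterInv h * quarterInv (1 - h)) := by
      rw [← quarterInv_mul]
      refine le_trans ?_ (quarterInv_div_four_le _)
      rw [← quarterInv_neg (h * (1 - h) / 4),
        show -(h * (1 - h) / 4) = -h * (1 - h) / 4 by ring]
      have h2 : -h * (1 - h) / 4 ≤ (u - h) * (1 - h) + 4 * u * h := by nlinarith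
      have h3 : 0 < -h * (1 - h) / 4 := by positivity
      refine quarterInv_le h3.ne' ?_
      rwa [abs_of_pos h3, abs_of_pos (h3.trans_le h2)]
    have hC : quarterInv (1 - h) ≤ 1 := quarterInv_le_one (by rw [abs_of_pos h1]; linarith)
    rw [discW, ← hudef, quarterInv_mul, quarterInv_mul, sub_zero, ← neg_sub 1 h, quarterInv_neg]
    set A := quarterInv (u - h)
    set B := quarterInv ((u - h) * (1 - h) + 4 * u * h)
    set H := quarterInv h
    set D := quarterInv (1 - h)
    set U := quarterInv u
    have hA0 : 0 ≤ A := hq _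
    have hB0 : 0 ≤ B := hq _
    have hH0 : 0 ≤ H := hq _
    have hD0 : 0 ≤ D := hq _
    have hU0 : 0 ≤ U := hq _
    have hUU : U ≤ U ^ 3 := le_self_pow₀ hU (by norm_num)
    calc (A * D * B) ^ 2 = A ^ 2 * D ^ 2 * B ^ 2 := by ring
      _ ≤ (U * H) * D ^ 2 * (4 * (H * D)) ^ 2 := by gcongr
      _ = 16 * (H ^ 3 * (D ^ 3 * D)) * U := by ring
      _ ≤ 16 * (H ^ 3 * (D ^ 3 * 1)) * U ^ 3 := by gcongr
      _ = _ := by rw [mul_one]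
  refine ne_top_of_le_ne_top ?_ (setLIntegral_mono_ae' measurableSet_Iio
    (Filter.Eventually.of_forall fun h hh =>
      setLIntegral_mono_ae' measurableSet_Ioo (Filter.Eventually.of_forall (key h hh))))
  simp_rw [lintegral_const_mul' _ _ ENNReal.ofReal_ne_top]
  rw [lintegral_mul_const _ (by fun_prop)]
  refine ENNReal.mul_ne_top (ne_top_of_le_ne_top ?_ (setLIntegral_le_lintegral _ _))
    lintegral_quarterInv_unit_ne_top
  simp_rw [ENNReal.ofReal_mul (show (0 : ℝ) ≤ 16 by norm_num)]
  rw [lintegral_const_mul' _ _ ENNReal.ofReal_ne_top]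
  exact ENNReal.mul_ne_top ENNReal.ofReal_ne_top
    (lintegral_quarterInv_cube_mul_cube_ne_top (by norm_num))

end

section

open Filter Topology

theorem Complex.norm_ofReal_sq_add_sq_ge (x : ℝ) (w : ℂ) : w.re ^ 2 ≤ ‖(x : ℂ) ^ 2 + w ^ 2‖ := by
  have e : (x : ℂ) ^ 2 + w ^ 2 = (w + x * I) * (w - x * I) := by
    linear_combination ((x : ℂ) ^ 2) * Complex.I_sq
  rw [e, norm_mul, ← sq_abs, sq]
  have h1 := Complex.abs_re_le_norm (w + x * I)
  have h2 := Complex.abs_re_le_norm (w - x * I)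
  simp only [Complex.add_re, Complex.sub_re, Complex.mul_re, Complex.ofReal_re, Complex.I_re,
    mul_zero, Complex.ofReal_im, Complex.I_im, mul_one, sub_self, add_zero, sub_zero] at h1 h2
  gcongr

theorem Complex.integrable_inv_ofReal_sq_add_sq {w : ℂ} (hw : 0 < w.re) :
    Integrable fun x : ℝ => ((x : ℂ) ^ 2 + w ^ 2)⁻¹ := by
  have hp : 0 < w.re ^ 2 := by positivity
  refine (integrable_inv_one_add_sq.const_mul (1 + (‖w‖ ^ 2 + 1) / w.re ^ 2)).mono'
    (Measurable.aestronglyMeasurable (by fun_prop)) (Eventually.of_forall fun x => ?_)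
  have h1 := Complex.norm_ofReal_sq_add_sq_ge x w
  have h2 : x ^ 2 ≤ ‖(x : ℂ) ^ 2 + w ^ 2‖ + ‖w‖ ^ 2 := by
    have := norm_sub_le ((x : ℂ) ^ 2 + w ^ 2) (w ^ 2)
    simpa using this
  have h3 : 0 < ‖(x : ℂ) ^ 2 + w ^ 2‖ := hp.trans_le h1
  rw [norm_inv, ← div_eq_mul_inv, le_div_iff₀ (by positivity), inv_mul_le_iff₀ h3]
  have h4 : ‖w‖ ^ 2 + 1 ≤ ‖(x : ℂ) ^ 2 + w ^ 2‖ * ((‖w‖ ^ 2 + 1) / w.re ^ 2) := by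
    rw [mul_div_assoc', le_div_iff₀ hp, mul_comm]
    gcongr
  nlinarith

theorem Complex.tendsto_log_sub_log (w : ℂ) : Tendsto
    (fun x : ℝ => log (w + x * I) - log (w - x * I)) atTop (𝓝 (Real.pi * I)) := by
  have hlim : ∀ z : ℂ, z ∈ slitPlane → Tendsto (fun x : ℝ => log (w * (x : ℂ)⁻¹ + z)) atTop
      (𝓝 (log z)) := by
    intro z hz
    have h0 : Tendsto (fun x : ℝ => w * (x : ℂ)⁻¹ + z) atTop (𝓝 (w * 0 + z)) := by
      refine (Tendsto.const_mul w ?_).add_const z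
      have := (Complex.continuous_ofReal.tendsto 0).comp tendsto_inv_atTop_zero
      simpa [Function.comp_def] using this
    rw [mul_zero, zero_add] at h0
    exact h0.clog hz
  have h1 := (hlim I (by simp [slitPlane])).sub (hlim (-I) (by simp [slitPlane]))
  rw [log_I, log_neg_I, show (Real.pi : ℂ) / 2 * I - -(Real.pi / 2) * I = Real.pi * I by ring] at h1
  refine h1.congr' ?_
  filter_upwards [eventually_gt_atTop 0, eventually_gt_atTop ‖w‖] with x hx hxw
  have hx' : (x : ℂ) ≠ 0 := ofReal_ne_zero.2 hx.ne'
  have hne : ∀ z : ℂ, ‖z‖ = 1 → w * (x : ℂ)⁻¹ + z ≠ 0 := by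
    intro z hz h
    have : w = -(x * z) := by field_simp at h; linear_combination h
    rw [this, norm_neg, norm_mul, hz, norm_real, Real.norm_of_nonneg hx.le, mul_one] at hxw
    exact hxw.false
  have e1 : w + x * I = x * (w * (x : ℂ)⁻¹ + I) := by field_simp
  have e2 : w - x * I = x * (w * (x : ℂ)⁻¹ + -I) := by field_simp; ring
  rw [e1, e2, log_ofReal_mul hx (hne _ (by simp)), log_ofReal_mul hx (hne _ (by simp))]
  ring

theorem Complex.integral_inv_ofReal_sq_add_sq {w : ℂ} (hw : 0 < w.re) :
    ∫ x : ℝ, ((x : ℂ) ^ 2 + w ^ 2)⁻¹ = Real.pi / w := by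
  have hw0 : w ≠ 0 := fun h => by simp [h] at hw
  set F : ℝ → ℂ := fun x => (2 * I * w)⁻¹ * (log (w + x * I) - log (w - x * I)) with hF
  have hre : ∀ x : ℝ, 0 < (w + x * I).re ∧ 0 < (w - x * I).re := by
    intro x
    simp [hw]
  have hd : ∀ x : ℝ, HasDerivAt F (((x : ℂ) ^ 2 + w ^ 2)⁻¹) x := by
    intro x
    have hx : HasDerivAt (fun x : ℝ => (x : ℂ)) 1 x := Complex.ofRealCLM.hasDerivAt
    have h1 := ((hx.mul_const I).const_add w).clog_real (Or.inl (hre x).1)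
    have h2 := ((hx.mul_const I).const_sub w).clog_real (Or.inl (hre x).2)
    refine ((h1.sub h2).const_mul _).congr_deriv ?_
    have e1 : w + x * I ≠ 0 := fun h => by have := (hre x).1; simp [h] at this
    have e2 : w - x * I ≠ 0 := fun h => by have := (hre x).2; simp [h] at this
    have e : (x : ℂ) ^ 2 + w ^ 2 = (w + x * I) * (w - x * I) := by
      linear_combination ((x : ℂ) ^ 2) * Complex.I_sq
    have hA : w = ((w + x * I) + (w - x * I)) / 2 := by ring
    rw [e]
    generalize w + x * I = A at *
    generalize w - x * I = B at *
    field_simp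
    linear_combination -2 * hA
  have ht : Tendsto F atTop (𝓝 ((2 * I * w)⁻¹ * (Real.pi * I))) :=
    (Complex.tendsto_log_sub_log w).const_mul _
  have hb : Tendsto F atBot (𝓝 (-((2 * I * w)⁻¹ * (Real.pi * I)))) := by
    have := (ht.comp tendsto_neg_atBot_atTop).neg
    refine this.congr fun x => ?_
    simp only [hF, Function.comp, ofReal_neg, neg_mul, sub_neg_eq_add, ← sub_eq_add_neg]
    ring
  rw [integral_of_hasDerivAt_of_tendsto hd (Complex.integrable_inv_ofReal_sq_add_sq hw) hb ht]
  field_simp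
  ring

theorem Complex.exists_sq_eq_re_pos {D : ℂ} (hD : D ∈ slitPlane) : ∃ w : ℂ, w ^ 2 = D ∧ 0 < w.re := by
  obtain ⟨w, hw⟩ := IsAlgClosed.exists_pow_nat_eq D two_pos
  rcases lt_trichotomy w.re 0 with h | h | h
  · exact ⟨-w, by rw [neg_sq, hw], by simpa using h⟩
  · exfalso
    rw [← hw, mem_slitPlane_iff, sq, mul_re, mul_im, h] at hD
    rcases hD with hD | hD
    · nlinarith [sq_nonneg w.im]
    · simp at hD
  · exact ⟨w, hw, h⟩

theorem Complex.integral_inv_quadratic {k l : ℂ} {σ : ℝ} (hk : k ≠ 0)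
    (hD : -((σ : ℂ) ^ 2 / 4 + l / k) ∈ slitPlane) :
    ∃ w : ℂ, w ^ 2 = -((σ : ℂ) ^ 2 / 4 + l / k) ∧ 0 < w.re ∧
      (∀ x : ℝ, k * (x * (σ - x)) + l ≠ 0) ∧
      (Integrable fun x : ℝ => (k * (x * (σ - x)) + l)⁻¹) ∧
      ∫ x : ℝ, (k * (x * (σ - x)) + l)⁻¹ = -Real.pi / (k * w) := by
  obtain ⟨w, hw, hwr⟩ := Complex.exists_sq_eq_re_pos hD
  have e : ∀ x : ℝ, k * (x * (σ - x)) + l = -k * (((x - σ / 2 : ℝ) : ℂ) ^ 2 + w ^ 2) := by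
    intro x
    rw [hw]
    push_cast
    field_simp
    ring
  refine ⟨w, hw, hwr, ?_, ?_, ?_⟩
  · intro x
    rw [e]
    refine mul_ne_zero (neg_ne_zero.2 hk) (norm_pos_iff.1 ?_)
    exact lt_of_lt_of_le (by positivity) (Complex.norm_ofReal_sq_add_sq_ge _ w)
  · simp_rw [e, mul_inv]
    exact ((Complex.integrable_inv_ofReal_sq_add_sq hwr).comp_sub_right (σ / 2)).const_mul _
  · simp_rw [e, mul_inv]
    rw [integral_const_mul,
      integral_sub_right_eq_self (fun x : ℝ => ((x : ℂ) ^ 2 + w ^ 2)⁻¹),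
      Complex.integral_inv_ofReal_sq_add_sq hwr]
    field_simp

theorem Complex.tendsto_re_zero_of_sq {ι : Type*} {f : Filter ι} {J : ι → ℂ} {L : ℝ} (hL : L ≤ 0)
    (h : Tendsto (fun i => J i ^ 2) f (𝓝 (L : ℂ))) : Tendsto (fun i => (J i).re) f (𝓝 0) := by
  have h1 : Tendsto (fun i => (‖J i ^ 2‖ + (J i ^ 2).re) / 2) f (𝓝 ((‖(L : ℂ)‖ + (L : ℂ).re) / 2)) :=
    (h.norm.add ((Complex.continuous_re.tendsto _).comp h)).div_const 2
  rw [norm_real, Real.norm_of_nonpos hL, ofReal_re, neg_add_cancel, zero_div] at h1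
  have h2 := (Real.continuous_sqrt.tendsto 0).comp h1
  rw [Real.sqrt_zero] at h2
  refine (tendsto_zero_iff_abs_tendsto_zero _).2 (h2.congr fun i => ?_)
  rw [Function.comp, Function.comp, ← Real.sqrt_sq_eq_abs, norm_pow, Complex.sq_norm, normSq_apply,
    sq (J i), mul_re]
  congr 1
  ring

theorem Complex.tendsto_of_sq_of_re_pos {ι : Type*} {f : Filter ι} {w : ι → ℂ} {D : ℝ} (hD : 0 < D)
    (hw : ∀ᶠ i in f, 0 < (w i).re) (h : Tendsto (fun i => w i ^ 2) f (𝓝 (D : ℂ))) :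
    Tendsto w f (𝓝 (√D : ℂ)) := by
  have hs : 0 < √D := Real.sqrt_pos.2 hD
  have hs2 : ((√D : ℝ) : ℂ) ^ 2 = D := by
    rw [← ofReal_pow, Real.sq_sqrt hD.le]
  rw [tendsto_iff_norm_sub_tendsto_zero] at h ⊢
  have h' := h.div_const √D
  rw [zero_div] at h'
  refine squeeze_zero' (Eventually.of_forall fun i => norm_nonneg _) ?_ h'
  filter_upwards [hw] with i hi
  rw [le_div_iff₀ hs, ← hs2, show w i ^ 2 - ((√D : ℝ) : ℂ) ^ 2 = (w i - √D) * (w i + √D) by ring,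
    norm_mul]
  gcongr
  refine le_trans ?_ ((le_abs_self _).trans (Complex.abs_re_le_norm _))
  simp [hi.le]

end

theorem lintegral_swap_left {f : ℝ → ℝ → ℝ → ℝ}
    (hf : Measurable fun p : ℝ × ℝ × ℝ => f p.1 p.2.1 p.2.2) (s t r : Set ℝ) :
    ∫⁻ a in s, ∫⁻ b in t, ∫⁻ c in r, ENNReal.ofReal (f a b c) =
      ∫⁻ b in t, ∫⁻ a in s, ∫⁻ c in r, ENNReal.ofReal (f a b c) := by
  refine lintegral_lintegral_swap (Measurable.aemeasurable ?_)
  refine Measurable.lintegral_prod_right' (f := fun q : (ℝ × ℝ) × ℝ =>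
    ENNReal.ofReal (f q.1.1 q.1.2 q.2)) ?_
  exact (hf.comp (f := fun q : (ℝ × ℝ) × ℝ => (q.1.1, q.1.2, q.2)) (by fun_prop)).ennreal_ofReal

theorem lintegral_swap_right {f : ℝ → ℝ → ℝ → ℝ}
    (hf : Measurable fun p : ℝ × ℝ × ℝ => f p.1 p.2.1 p.2.2) (s t r : Set ℝ) :
    ∫⁻ a in s, ∫⁻ b in t, ∫⁻ c in r, ENNReal.ofReal (f a b c) =
      ∫⁻ a in s, ∫⁻ c in r, ∫⁻ b in t, ENNReal.ofReal (f a b c) := by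
  refine lintegral_congr fun a => lintegral_lintegral_swap (Measurable.aemeasurable ?_)
  exact (hf.comp (f := fun q : ℝ × ℝ => (a, q.1, q.2)) (by fun_prop)).ennreal_ofReal

theorem lintegral_comp_mul_Ioi {c : ℝ} (hc : 0 < c) (G : ℝ → ℝ) :
    ∫⁻ x in Set.Ioi 0, ENNReal.ofReal (G x) =
      ∫⁻ x in Set.Ioi 0, ENNReal.ofReal (c * G (x * c)) := by
  refine lintegral_cov_inv (φ := fun x => x * c) (φ' := fun _ => c) measurableSet_Ioi
    (fun y => y / c) ?_ ?_ ?_ ?_ ?_ ?_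
  · exact fun x _ => hasDerivAt_mul_const c
  · exact fun x hx => mul_pos hx hc
  · exact fun x hx => div_pos hx hc
  · exact fun x _ => mul_div_cancel_right₀ x hc.ne'
  · exact fun x _ => div_mul_cancel₀ x hc.ne'
  · exact fun x _ => by rw [abs_of_pos hc]

theorem lintegral_feynman_eq_quadratic :
    ∫⁻ x₁ in Set.Ioi (0 : ℝ), ∫⁻ x₂ in Set.Ioi (0 : ℝ), ∫⁻ x₃ in Set.Ioi (0 : ℝ), ENNReal.ofReal
      (((1 + x₁ + x₂ + x₃) * (1 + x₁⁻¹ + x₂⁻¹ + x₃⁻¹) - 1)⁻¹ / (x₁ * x₂ * x₃)) =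
    ∫⁻ b in Set.Ioo (0 : ℝ) 1, ∫⁻ s in Set.Ioi (0 : ℝ), ∫⁻ t in Set.Ioi (0 : ℝ), ENNReal.ofReal
      ((b * (1 - b) * ((s + t) * (1 + s + t) - s * t) + s * t * (1 + s + t))⁻¹) := by
  set f : ℝ → ℝ → ℝ → ℝ := fun x₁ x₂ x₃ =>
    ((1 + x₁ + x₂ + x₃) * (1 + x₁⁻¹ + x₂⁻¹ + x₃⁻¹) - 1)⁻¹ / (x₁ * x₂ * x₃) with hf
  set g : ℝ → ℝ → ℝ → ℝ := fun x₁ s t => (1 + x₁) * ((1 + x₁) * f x₁ (s * (1 + x₁)) (t * (1 + x₁)))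
    with hg
  have hfm : Measurable fun p : ℝ × ℝ × ℝ => f p.1 p.2.1 p.2.2 := by fun_prop
  have h1 : ∫⁻ x₁ in Set.Ioi (0 : ℝ), ∫⁻ x₂ in Set.Ioi (0 : ℝ), ∫⁻ x₃ in Set.Ioi (0 : ℝ),
      ENNReal.ofReal (f x₁ x₂ x₃) =
      ∫⁻ x₁ in Set.Ioi (0 : ℝ), ∫⁻ t in Set.Ioi (0 : ℝ), ∫⁻ s in Set.Ioi (0 : ℝ),
      ENNReal.ofReal (g x₁ s t) := by
    have : ∫⁻ x₁ in Set.Ioi (0 : ℝ), ∫⁻ x₂ in Set.Ioi (0 : ℝ), ∫⁻ x₃ in Set.Ioi (0 : ℝ),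
        ENNReal.ofReal (f x₁ x₂ x₃) = ∫⁻ x₁ in Set.Ioi (0 : ℝ), ∫⁻ x₂ in Set.Ioi (0 : ℝ),
          ∫⁻ t in Set.Ioi (0 : ℝ), ENNReal.ofReal ((1 + x₁) * f x₁ x₂ (t * (1 + x₁))) := by
      refine setLIntegral_congr_fun measurableSet_Ioi fun x₁ (hx₁ : 0 < x₁) => ?_
      refine lintegral_congr fun x₂ => ?_
      exact lintegral_comp_mul_Ioi (by positivity) _
    rw [this, lintegral_swap_right (f := fun x₁ x₂ t => (1 + x₁) * f x₁ x₂ (t * (1 + x₁)))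
      (by fun_prop)]
    refine setLIntegral_congr_fun measurableSet_Ioi fun x₁ (hx₁ : 0 < x₁) => ?_
    refine lintegral_congr fun t => ?_
    exact lintegral_comp_mul_Ioi (c := 1 + x₁) (by positivity) _
  have h2 : ∀ t ∈ Set.Ioi (0 : ℝ), ∀ s ∈ Set.Ioi (0 : ℝ), ∫⁻ x₁ in Set.Ioi (0 : ℝ),
      ENNReal.ofReal (g x₁ s t) = ∫⁻ b in Set.Ioo (0 : ℝ) 1, ENNReal.ofReal
      ((b * (1 - b) * ((s + t) * (1 + s + t) - s * t) + s * t * (1 + s + t))⁻¹) := by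
    intro t ht s hs
    replace ht : 0 < t := ht
    replace hs : 0 < s := hs
    refine lintegral_cov_inv (φ := fun b => b⁻¹ - 1) (φ' := fun b => -(b ^ 2)⁻¹) measurableSet_Ioo
      (fun y => (1 + y)⁻¹) ?_ ?_ ?_ ?_ ?_ ?_
    · exact fun b hb => (hasDerivAt_inv hb.1.ne').sub_const 1
    · exact fun b hb => sub_pos.2 ((one_lt_inv₀ hb.1).2 hb.2)
    · intro y (hy : 0 < y)
      exact ⟨by positivity, inv_lt_one_of_one_lt₀ (by linarith)⟩
    · intro b hb
      simp
    · intro y (hy : 0 < y)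
      simp
    · intro b hb
      have hb0 := hb.1
      have hb1 : 0 < 1 - b := sub_pos.2 hb.2
      have e : b⁻¹ - 1 = (1 - b) / b := by field_simp
      have hD : 0 < b * (1 - b) * ((s + t) * (1 + s + t) - s * t) + s * t * (1 + s + t) := by
        have : 0 < (s + t) * (1 + s + t) - s * t := by nlinarith [mul_pos hs ht]
        positivity
      rw [abs_neg, abs_of_pos (by positivity)]
      simp only [hg, hf]
      rw [e, show 1 + (1 - b) / b = b⁻¹ by field_simp; ring,
        show (b⁻¹ + s * b⁻¹ + t * b⁻¹) * (1 + ((1 - b) / b)⁻¹ + (s * b⁻¹)⁻¹ + (t * b⁻¹)⁻¹) - 1 =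
          (b * (1 - b) * ((s + t) * (1 + s + t) - s * t) + s * t * (1 + s + t)) /
            (b * (1 - b) * s * t) by field_simp; ring]
      field_simp
  rw [h1, lintegral_swap_left (f := fun x₁ t s => g x₁ s t) (by fun_prop),
    lintegral_swap_right (f := fun t x₁ s => g x₁ s t) (by fun_prop),
    setLIntegral_congr_fun measurableSet_Ioi fun t ht => setLIntegral_congr_fun measurableSet_Ioi
      (h2 t ht), lintegral_swap_right (f := fun t s b =>
      (b * (1 - b) * ((s + t) * (1 + s + t) - s * t) + s * t * (1 + s + t))⁻¹) (by fun_prop),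
    lintegral_swap_left (f := fun t b s =>
      (b * (1 - b) * ((s + t) * (1 + s + t) - s * t) + s * t * (1 + s + t))⁻¹) (by fun_prop),
    lintegral_swap_right (f := fun b t s =>
      (b * (1 - b) * ((s + t) * (1 + s + t) - s * t) + s * t * (1 + s + t))⁻¹) (by fun_prop)]

theorem lintegral_comp_neg_Iio (G : ℝ → ℝ) :
    ∫⁻ x in Set.Ioi 0, ENNReal.ofReal (G x) = ∫⁻ x in Set.Iio 0, ENNReal.ofReal (G (-x)) := by
  refine (lintegral_cov_inv (φ := fun t => -t) (φ' := fun _ => -1) measurableSet_Iio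
      (fun y => -y) ?_ ?_ ?_ ?_ ?_ ?_)
  · exact fun x _ => hasDerivAt_neg x
  · exact fun x (hx : x < 0) => Set.mem_Ioi.2 (neg_pos.2 hx)
  · exact fun x (hx : 0 < x) => Set.mem_Iio.2 (neg_neg_iff_pos.2 hx)
  · exact fun x _ => neg_neg x
  · exact fun x _ => neg_neg x
  · intro t _
    rw [abs_neg, abs_one, one_mul]

theorem lintegral_quadratic_eq_neg :
    ∫⁻ b in Set.Ioo (0 : ℝ) 1, ∫⁻ s in Set.Ioi (0 : ℝ), ∫⁻ t in Set.Ioi (0 : ℝ), ENNReal.ofReal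
      ((b * (1 - b) * ((s + t) * (1 + s + t) - s * t) + s * t * (1 + s + t))⁻¹) =
    ∫⁻ b in Set.Ioo (0 : ℝ) 1, ∫⁻ h in Set.Iio (0 : ℝ), ∫⁻ x in Set.Iio (0 : ℝ), ENNReal.ofReal
      ((symThree h x - b * (1 - b) * symTwo h x)⁻¹) := by
  refine lintegral_congr fun b => ?_
  simp_rw [lintegral_comp_neg_Iio (fun t => (_ + _)⁻¹)]
  rw [lintegral_lintegral_swap (Measurable.aemeasurable (by fun_prop))]
  simp_rw [lintegral_comp_neg_Iio (fun t => (_ + _)⁻¹)]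
  rw [lintegral_lintegral_swap (Measurable.aemeasurable (by fun_prop))]
  refine lintegral_congr fun h => lintegral_congr fun x => ?_
  rw [symThree, symTwo]
  ring_nf

theorem lintegral_quadratic_eq_simplex :
    ∫⁻ b in Set.Ioo (0 : ℝ) 1, ∫⁻ s in Set.Ioi (0 : ℝ), ∫⁻ t in Set.Ioi (0 : ℝ), ENNReal.ofReal
      ((b * (1 - b) * ((s + t) * (1 + s + t) - s * t) + s * t * (1 + s + t))⁻¹) =
    ∫⁻ h in Set.Ioo (0 : ℝ) 1, ∫⁻ x in Set.Ioo (0 : ℝ) (1 - h), ∫⁻ y in Set.Ioi (0 : ℝ),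
      ENNReal.ofReal ((y * (1 + y) * symTwo h x + symThree h x)⁻¹) := by
  set f : ℝ → ℝ → ℝ → ℝ := fun b s t =>
    (b * (1 - b) * ((s + t) * (1 + s + t) - s * t) + s * t * (1 + s + t))⁻¹ with hf
  set g : ℝ → ℝ → ℝ → ℝ := fun b h y =>
    ((1 - h) * (b * (1 - b)) * (h + y * (1 + y)) + h * (y * (1 + y)))⁻¹ with hg
  have h1 : ∀ b ∈ Set.Ioo (0 : ℝ) 1, ∀ y ∈ Set.Ioi (0 : ℝ),
      ∫⁻ s in Set.Ioi (0 : ℝ), ENNReal.ofReal ((1 + s) * f b s (y * (1 + s))) =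
      ∫⁻ h in Set.Ioo (0 : ℝ) 1, ENNReal.ofReal (g b h y) := by
    intro b hb y hy
    have hb0 := hb.1
    have hb1 : 0 < 1 - b := sub_pos.2 hb.2
    replace hy : 0 < y := hy
    refine lintegral_cov_inv (φ := fun h => (1 - h)⁻¹ - 1) (φ' := fun h => ((1 - h) ^ 2)⁻¹)
      measurableSet_Ioo (fun s => 1 - (1 + s)⁻¹) ?_ ?_ ?_ ?_ ?_ ?_
    · intro h hh
      have h1 : 1 - h ≠ 0 := (sub_pos.2 hh.2).ne'
      refine ((((hasDerivAt_id h).const_sub 1).inv h1).sub_const 1).congr_deriv ?_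
      simp
    · exact fun h hh => sub_pos.2 ((one_lt_inv₀ (sub_pos.2 hh.2)).2 (by linarith [hh.1]))
    · intro s (hs : 0 < s)
      have : (1 + s)⁻¹ < 1 := inv_lt_one_of_one_lt₀ (by linarith)
      have h' : 0 < (1 + s)⁻¹ := by positivity
      exact ⟨by linarith, by linarith⟩
    · intro h _
      simp
    · intro s _
      simp
    · intro h hh
      have hh0 := hh.1
      have hh1 : 0 < 1 - h := sub_pos.2 hh.2
      rw [abs_of_pos (by positivity)]
      simp only [hg, hf]
      rw [show 1 + ((1 - h)⁻¹ - 1) = (1 - h)⁻¹ by ring, show (1 - h)⁻¹ - 1 = h / (1 - h) by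
        field_simp; ring]
      have e : b * (1 - b) * ((h / (1 - h) + y * (1 - h)⁻¹) *
          ((1 - h)⁻¹ + y * (1 - h)⁻¹) - h / (1 - h) * (y * (1 - h)⁻¹)) +
          h / (1 - h) * (y * (1 - h)⁻¹) * ((1 - h)⁻¹ + y * (1 - h)⁻¹) =
          ((1 - h) * (b * (1 - b)) * (h + y * (1 + y)) + h * (y * (1 + y))) / (1 - h) ^ 3 := by
        field_simp
        ring
      rw [e]
      field_simp
  have h2 : ∀ h ∈ Set.Ioo (0 : ℝ) 1, ∀ y ∈ Set.Ioi (0 : ℝ),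
      ∫⁻ b in Set.Ioo (0 : ℝ) 1, ENNReal.ofReal (g b h y) =
      ∫⁻ x in Set.Ioo (0 : ℝ) (1 - h),
        ENNReal.ofReal ((y * (1 + y) * symTwo h x + symThree h x)⁻¹) := by
    intro h hh y hy
    have hh0 := hh.1
    have hh1 : 0 < 1 - h := sub_pos.2 hh.2
    replace hy : 0 < y := hy
    refine lintegral_cov_inv (φ := fun x => x * (1 - h)⁻¹) (φ' := fun h' => (1 - h)⁻¹)
      measurableSet_Ioo (fun b => b * (1 - h)) ?_ ?_ ?_ ?_ ?_ ?_
    · exact fun x _ => hasDerivAt_mul_const _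
    · intro x hx
      refine ⟨mul_pos hx.1 (inv_pos.2 hh1), ?_⟩
      rw [← div_eq_mul_inv, div_lt_one hh1]
      exact hx.2
    · intro b hb
      exact ⟨mul_pos hb.1 hh1, mul_lt_of_lt_one_left hh1 hb.2⟩
    · intro x _
      field_simp
    · intro x _
      field_simp
    · intro x hx
      rw [abs_of_pos (by positivity)]
      simp only [hg]
      rw [← mul_inv, symTwo, symThree]
      congr 1
      field_simp
      ring
  have h3 : ∫⁻ b in Set.Ioo (0 : ℝ) 1, ∫⁻ s in Set.Ioi (0 : ℝ), ∫⁻ t in Set.Ioi (0 : ℝ),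
      ENNReal.ofReal (f b s t) = ∫⁻ b in Set.Ioo (0 : ℝ) 1, ∫⁻ s in Set.Ioi (0 : ℝ),
      ∫⁻ y in Set.Ioi (0 : ℝ), ENNReal.ofReal ((1 + s) * f b s (y * (1 + s))) := by
    refine lintegral_congr fun b => ?_
    refine setLIntegral_congr_fun measurableSet_Ioi fun s (hs : 0 < s) => ?_
    exact lintegral_comp_mul_Ioi (c := 1 + s) (by positivity) _
  rw [h3, lintegral_swap_right (f := fun b s y => (1 + s) * f b s (y * (1 + s))) (by fun_prop),
    setLIntegral_congr_fun measurableSet_Ioo fun b hb => setLIntegral_congr_fun measurableSet_Ioi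
      (h1 b hb), lintegral_swap_right (f := fun b y h => g b h y) (by fun_prop),
    lintegral_swap_left (f := fun b h y => g b h y) (by fun_prop),
    lintegral_swap_right (f := fun h b y => g b h y) (by fun_prop)]
  refine setLIntegral_congr_fun measurableSet_Ioo fun h hh => ?_
  rw [setLIntegral_congr_fun measurableSet_Ioi (h2 h hh), lintegral_lintegral_swap]
  exact Measurable.aemeasurable (by unfold symTwo symThree; fun_prop)

theorem integral_integral_integral_eq_toReal {s t r : Set ℝ} (hs : MeasurableSet s)
    (ht : MeasurableSet t) (hr : MeasurableSet r) {f : ℝ → ℝ → ℝ → ℝ}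
    (hf : Measurable fun p : ℝ × ℝ × ℝ => f p.1 p.2.1 p.2.2)
    (hf0 : ∀ a ∈ s, ∀ b ∈ t, ∀ c ∈ r, 0 ≤ f a b c)
    (hfin : ∫⁻ a in s, ∫⁻ b in t, ∫⁻ c in r, ENNReal.ofReal (f a b c) ≠ ⊤) :
    ∫ a in s, ∫ b in t, ∫ c in r, f a b c =
      (∫⁻ a in s, ∫⁻ b in t, ∫⁻ c in r, ENNReal.ofReal (f a b c)).toReal := by
  have m1 : Measurable fun q : (ℝ × ℝ) × ℝ => ENNReal.ofReal (f q.1.1 q.1.2 q.2) :=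
    (hf.comp (f := fun q : (ℝ × ℝ) × ℝ => (q.1.1, q.1.2, q.2)) (by fun_prop)).ennreal_ofReal
  have m2 : Measurable fun q : ℝ × ℝ => ∫⁻ c in r, ENNReal.ofReal (f q.1 q.2 c) :=
    m1.lintegral_prod_right'
  have m3 : Measurable fun a : ℝ => ∫⁻ b in t, ∫⁻ c in r, ENNReal.ofReal (f a b c) :=
    m2.lintegral_prod_right'
  rw [← integral_toReal m3.aemeasurable (ae_lt_top m3 hfin)]
  refine integral_congr_ae ?_
  filter_upwards [ae_lt_top m3 hfin, ae_restrict_mem hs] with a ha has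
  have m2a : Measurable fun b : ℝ => ∫⁻ c in r, ENNReal.ofReal (f a b c) := by
    exact m2.comp (f := fun b => (a, b)) (by fun_prop)
  rw [← integral_toReal m2a.aemeasurable (ae_lt_top m2a ha.ne)]
  refine setIntegral_congr_fun ht fun b hb => ?_
  refine integral_eq_lintegral_of_nonneg_ae ?_ ?_
  · exact (ae_restrict_mem hr).mono fun c hc => hf0 a has b hb c hc
  · exact (hf.comp (f := fun c => (a, b, c)) (by fun_prop)).aestronglyMeasurable

theorem symThree_sub_mul_symTwo_inv_le {u h x : ℝ} (hu : 0 < u) (hh : h < 0) (hx : x < 0) :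
    (symThree h x - u * symTwo h x)⁻¹ ≤
      quarterInv u ^ 2 * quarterInv (symTwo h x * symThree h x) ^ 2 := by
  have hA : 0 < symThree h x := by
    rw [symThree]
    exact mul_pos (mul_pos_of_neg_of_neg hh hx) (by linarith)
  have hB : 0 < -symTwo h x := by
    rw [symTwo]
    nlinarith [mul_pos_of_neg_of_neg hh hx, sq_nonneg (h + x), sq_nonneg (h - x)]
  rw [← mul_pow, ← quarterInv_mul, quarterInv_sq]
  refine inv_anti₀ ?_ ?_
  · refine Real.sqrt_pos.2 (abs_pos.2 ?_)
    exact (mul_neg_of_pos_of_neg hu (mul_neg_of_neg_of_pos (neg_pos.1 hB) hA)).ne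
  · rw [abs_of_neg (mul_neg_of_pos_of_neg hu (mul_neg_of_neg_of_pos (neg_pos.1 hB) hA)),
      Real.sqrt_le_left (by nlinarith [mul_pos hu hB])]
    nlinarith [mul_pos hu hB, mul_pos (mul_pos hu hB) hA, sq_nonneg (u * symTwo h x),
      sq_nonneg (symThree h x)]

theorem lintegral_neg_chamber_ne_top :
    ∫⁻ b in Set.Ioo (0 : ℝ) 1, ∫⁻ h in Set.Iio (0 : ℝ), ∫⁻ x in Set.Iio (0 : ℝ), ENNReal.ofReal
      ((symThree h x - b * (1 - b) * symTwo h x)⁻¹) ≠ ⊤ := by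
  refine ne_top_of_le_ne_top (ENNReal.mul_ne_top lintegral_quarterInv_unit_ne_top
    lintegral_sym_ne_top) ?_
  rw [← lintegral_mul_const _ (by fun_prop)]
  refine setLIntegral_mono' measurableSet_Ioo fun b hb => ?_
  have hu : 0 < b * (1 - b) := mul_pos hb.1 (by linarith [hb.2])
  rw [← lintegral_const_mul' _ _ ENNReal.ofReal_ne_top]
  refine (setLIntegral_mono' measurableSet_Iio fun h (hh : h < 0) => ?_).trans
    (setLIntegral_le_lintegral _ _)
  rw [← lintegral_const_mul' _ _ ENNReal.ofReal_ne_top]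
  refine (setLIntegral_mono' measurableSet_Iio fun x (hx : x < 0) => ?_).trans
    (setLIntegral_le_lintegral _ _)
  have h1 := one_le_quarterInv_unit hb
  rw [← ENNReal.ofReal_mul (by positivity)]
  refine ENNReal.ofReal_le_ofReal ((symThree_sub_mul_symTwo_inv_le hu hh hx).trans ?_)
  gcongr
  norm_num

theorem feynmanI_one_eq_toReal : feynmanI 1 =
    (∫⁻ b in Set.Ioo (0 : ℝ) 1, ∫⁻ h in Set.Iio (0 : ℝ), ∫⁻ x in Set.Iio (0 : ℝ), ENNReal.ofReal
      ((symThree h x - b * (1 - b) * symTwo h x)⁻¹)).toReal := by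
  rw [← lintegral_quadratic_eq_neg, ← lintegral_feynman_eq_quadratic, feynmanI]
  refine integral_integral_integral_eq_toReal measurableSet_Ioi measurableSet_Ioi measurableSet_Ioi
    (by fun_prop) ?_ ?_
  · intro a ha b hb c hc
    replace ha : 0 < a := ha
    replace hb : 0 < b := hb
    replace hc : 0 < c := hc
    have h1 : 1 ≤ (1 + a + b + c) * (1 + a⁻¹ + b⁻¹ + c⁻¹) := by
      have : 0 ≤ a⁻¹ + b⁻¹ + c⁻¹ := by positivity
      nlinarith
    have : 0 ≤ (1 + a + b + c) * (1 + a⁻¹ + b⁻¹ + c⁻¹) - 1 := by linarith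
    positivity
  · rw [lintegral_feynman_eq_quadratic, lintegral_quadratic_eq_neg]
    exact lintegral_neg_chamber_ne_top

section

open Filter Topology

theorem measurePreserving_reflect :
    MeasurePreserving (fun p : ℝ × ℝ => (p.1, 1 - p.1 - p.2)) := by
  have := (MeasurePreserving.id (volume : Measure ℝ)).skew_product
    (g := fun h x : ℝ => 1 - h - x) (μc := volume) (μd := volume) (by fun_prop)
    (Eventually.of_forall fun h => (Measure.measurePreserving_sub_left volume (1 - h)).map_eq)
  exact this

theorem ae_quadratic_ne_zero (p q : ℝ) : ∀ᵐ x : ℝ, x ^ 2 + p * x + q ≠ 0 := by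
  have : ({-p / 2 + √(p ^ 2 / 4 - q), -p / 2 - √(p ^ 2 / 4 - q)} : Set ℝ).Finite := by simp
  filter_upwards [this.measure_zero volume |> compl_mem_ae_iff.2] with x hx h
  refine hx ?_
  have h1 : (x + p / 2) ^ 2 = √(p ^ 2 / 4 - q) ^ 2 := by
    rw [Real.sq_sqrt] <;> nlinarith [sq_nonneg (x + p / 2)]
  rcases sq_eq_sq_iff_eq_or_eq_neg.1 h1 with h | h
  · exact Or.inl (by linarith)
  · exact Or.inr (Set.mem_singleton_iff.2 (by linarith))

theorem ae_ne_const (c : ℝ) : ∀ᵐ x : ℝ, x ≠ c := Measure.ae_ne volume c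

theorem ae_prod_of_ae_ae {p : ℝ × ℝ → Prop} (hp : MeasurableSet {x | p x})
    (h : ∀ᵐ a : ℝ, ∀ᵐ b : ℝ, p (a, b)) : ∀ᵐ x : ℝ × ℝ, p x :=
  (Measure.ae_prod_iff_ae_ae hp).2 h

theorem ae_off_lines : ∀ᵐ p : ℝ × ℝ, p.1 ≠ 0 ∧ p.2 ≠ 0 ∧ 1 - p.1 - p.2 ≠ 0 := by
  refine ae_prod_of_ae_ae ?_ ?_
  · measurability
  · filter_upwards [ae_ne_const 0] with a ha
    filter_upwards [ae_ne_const 0, ae_ne_const (1 - a)] with b hb hb'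
    exact ⟨ha, hb, fun h => hb' (by linarith)⟩

theorem ae_symTwo_mul_symThree_ne_zero :
    ∀ᵐ p : ℝ × ℝ, symTwo p.1 p.2 * symThree p.1 p.2 ≠ 0 := by
  have h1 : ∀ᵐ p : ℝ × ℝ, symTwo p.1 p.2 ≠ 0 := by
    refine ae_prod_of_ae_ae (measurableSet_eq_fun (by fun_prop) (by fun_prop)).compl ?_
    refine Eventually.of_forall fun a => ?_
    filter_upwards [ae_quadratic_ne_zero (-(1 - a)) (-(a * (1 - a)))] with b hb h
    refine hb ?_
    simp only [symTwo] at h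
    linear_combination -h
  filter_upwards [h1, ae_off_lines] with p h1 h2
  exact mul_ne_zero h1 (mul_ne_zero (mul_ne_zero h2.1 h2.2.1) h2.2.2)

theorem integral_simplex_eq {g : ℝ × ℝ → ℂ} (hg : Integrable g)
    (hswap : ∀ h x, g (x, h) = g (h, x)) (hrefl : ∀ h x, g (h, 1 - h - x) = g (h, x)) :
    ∫ p in {p : ℝ × ℝ | 0 < p.1 ∧ 0 < p.2 ∧ 0 < 1 - p.1 - p.2}, g p =
      (∫ p in Set.Ioi 0 ×ˢ Set.univ, g p) - 2 * (∫ p in Set.Iio 0 ×ˢ Set.univ, g p) +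
        3 * ∫ p in Set.Iio 0 ×ˢ Set.Iio 0, g p := by
  set A : Set (ℝ × ℝ) := {p | 0 < p.1 ∧ 0 < p.2 ∧ 0 < 1 - p.1 - p.2} with hA
  set B₁ : Set (ℝ × ℝ) := {p | p.1 < 0 ∧ 0 < p.2 ∧ 0 < 1 - p.1 - p.2} with hB₁
  set B₂ : Set (ℝ × ℝ) := {p | 0 < p.1 ∧ p.2 < 0 ∧ 0 < 1 - p.1 - p.2} with hB₂
  set B₃ : Set (ℝ × ℝ) := {p | 0 < p.1 ∧ 0 < p.2 ∧ 1 - p.1 - p.2 < 0} with hB₃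
  set D₁ : Set (ℝ × ℝ) := {p | 0 < p.1 ∧ p.2 < 0 ∧ 1 - p.1 - p.2 < 0} with hD₁
  set D₂ : Set (ℝ × ℝ) := {p | p.1 < 0 ∧ 0 < p.2 ∧ 1 - p.1 - p.2 < 0} with hD₂
  set D₃ : Set (ℝ × ℝ) := {p | p.1 < 0 ∧ p.2 < 0 ∧ 0 < 1 - p.1 - p.2} with hD₃
  have mA : MeasurableSet A := by measurability
  have mB₁ : MeasurableSet B₁ := by measurability
  have mB₂ : MeasurableSet B₂ := by measurability
  have mB₃ : MeasurableSet B₃ := by measurability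
  have mD₁ : MeasurableSet D₁ := by measurability
  have mD₂ : MeasurableSet D₂ := by measurability
  have mD₃ : MeasurableSet D₃ := by measurability
  have hS : MeasurePreserving (Prod.swap : ℝ × ℝ → ℝ × ℝ) := Measure.measurePreserving_swap
  have hSe : MeasurableEmbedding (Prod.swap : ℝ × ℝ → ℝ × ℝ) :=
    (MeasurableEquiv.prodComm (α := ℝ) (β := ℝ)).measurableEmbedding
  have hRe : MeasurableEmbedding (fun p : ℝ × ℝ => (p.1, 1 - p.1 - p.2)) := by
    refine (MeasurableEquiv.measurableEmbedding
      ⟨⟨fun p : ℝ × ℝ => (p.1, 1 - p.1 - p.2), fun p => (p.1, 1 - p.1 - p.2), ?_, ?_⟩, ?_, ?_⟩)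
    · intro p; simp
    · intro p; simp
    · simp only [Equiv.coe_fn_mk]; fun_prop
    · simp only [Equiv.coe_fn_symm_mk]; fun_prop
  have swap : ∀ s : Set (ℝ × ℝ), ∫ p in Prod.swap ⁻¹' s, g p = ∫ p in s, g p := by
    intro s
    rw [← hS.setIntegral_preimage_emb hSe g s]
    exact integral_congr_ae (Eventually.of_forall fun p => (hswap p.2 p.1))
  have refl : ∀ s : Set (ℝ × ℝ),
      ∫ p in (fun p : ℝ × ℝ => (p.1, 1 - p.1 - p.2)) ⁻¹' s, g p = ∫ p in s, g p := by
    intro s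
    rw [← measurePreserving_reflect.setIntegral_preimage_emb hRe g s]
    exact integral_congr_ae (Eventually.of_forall fun p : ℝ × ℝ => (hrefl p.1 p.2).symm)
  have e1 : ∫ p in B₁, g p = ∫ p in B₂, g p := by
    rw [← swap B₂]
    congr 2
    ext p
    simp only [hB₁, hB₂, Set.mem_ofPred_eq, Set.mem_preimage, Prod.fst_swap, Prod.snd_swap]
    grind
  have e2 : ∫ p in D₁, g p = ∫ p in D₂, g p := by
    rw [← swap D₂]
    congr 2
    ext p
    simp only [hD₁, hD₂, Set.mem_ofPred_eq, Set.mem_preimage, Prod.fst_swap, Prod.snd_swap]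
    grind
  have e3 : ∫ p in B₃, g p = ∫ p in B₂, g p := by
    rw [← refl B₂]
    congr 2
    ext p
    simp only [hB₃, hB₂, Set.mem_ofPred_eq, Set.mem_preimage]
    grind
  have e4 : ∫ p in D₂, g p = ∫ p in D₃, g p := by
    rw [← refl D₃]
    congr 2
    ext p
    simp only [hD₂, hD₃, Set.mem_ofPred_eq, Set.mem_preimage]
    grind
  have e5 : (Set.Iio 0 ×ˢ Set.Iio 0 : Set (ℝ × ℝ)) = D₃ := by
    ext p
    simp only [hD₃, Set.mem_ofPred_eq, Set.mem_prod, Set.mem_Iio]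
    grind
  have e6 : ∫ p in Set.Ioi 0 ×ˢ Set.univ, g p =
      (∫ p in A, g p) + (∫ p in B₂, g p) + (∫ p in B₃, g p) + ∫ p in D₁, g p := by
    rw [← integral_indicator (measurableSet_Ioi.prod MeasurableSet.univ), ← integral_indicator mA,
      ← integral_indicator mB₂, ← integral_indicator mB₃, ← integral_indicator mD₁,
      ← integral_add' (hg.indicator mA) (hg.indicator mB₂),
      ← integral_add' ((hg.indicator mA).add (hg.indicator mB₂)) (hg.indicator mB₃),
      ← integral_add' (((hg.indicator mA).add (hg.indicator mB₂)).add (hg.indicator mB₃))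
        (hg.indicator mD₁)]
    refine integral_congr_ae ?_
    filter_upwards [ae_off_lines] with p hp
    simp only [Set.indicator, hA, hB₂, hB₃, hD₁, Set.mem_prod, Set.mem_ofPred_eq, Set.mem_Ioi,
      Set.mem_univ, and_true, Pi.add_apply]
    grind
  have e7 : ∫ p in Set.Iio 0 ×ˢ Set.univ, g p =
      (∫ p in B₁, g p) + (∫ p in D₂, g p) + ∫ p in D₃, g p := by
    rw [← integral_indicator (measurableSet_Iio.prod MeasurableSet.univ),
      ← integral_indicator mB₁, ← integral_indicator mD₂, ← integral_indicator mD₃,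
      ← integral_add' (hg.indicator mB₁) (hg.indicator mD₂),
      ← integral_add' ((hg.indicator mB₁).add (hg.indicator mD₂)) (hg.indicator mD₃)]
    refine integral_congr_ae ?_
    filter_upwards [ae_off_lines] with p hp
    simp only [Set.indicator, hB₁, hD₂, hD₃, Set.mem_prod, Set.mem_ofPred_eq, Set.mem_Iio,
      Set.mem_univ, and_true, Pi.add_apply]
    grind
  rw [e5, e6, e7, e1, e2, e3, e4]
  ring

end

section

open Filter Topology

/-- The integrand on the six chambers of the `(h, x)`-plane, regularised by `ε`. -/
noncomputable def chamberKernel (ε b h x : ℝ) : ℂ :=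
  ((b * (1 - b) : ℝ) * symTwo h x - (1 + ε * Complex.I) * symThree h x : ℂ)⁻¹

@[fun_prop]
theorem measurable_chamberKernel (ε : ℝ) :
    Measurable fun p : ℝ × ℝ × ℝ => chamberKernel ε p.1 p.2.1 p.2.2 := by
  unfold chamberKernel symTwo symThree; fun_prop

theorem chamberKernel_swap (ε b h x : ℝ) : chamberKernel ε b x h = chamberKernel ε b h x := by
  simp only [chamberKernel, symTwo, symThree]
  push_cast
  ring_nf

theorem chamberKernel_reflect (ε b h x : ℝ) :
    chamberKernel ε b h (1 - h - x) = chamberKernel ε b h x := by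
  simp only [chamberKernel, symTwo, symThree]
  push_cast
  ring_nf

theorem norm_chamberKernel_inv_re_le (ε b h x : ℝ) :
    |b * (1 - b) * symTwo h x - symThree h x| ≤
      ‖((b * (1 - b) : ℝ) * symTwo h x - (1 + ε * Complex.I) * symThree h x : ℂ)‖ := by
  have := Complex.abs_re_le_norm
    ((b * (1 - b) : ℝ) * symTwo h x - (1 + ε * Complex.I) * symThree h x : ℂ)
  simpa using this

theorem norm_chamberKernel_le {ε b h x : ℝ} (hε : 0 < ε) (hb : b ∈ Set.Ioo (0 : ℝ) 1)
    (hne : symTwo h x * symThree h x ≠ 0) : ‖chamberKernel ε b h x‖ ≤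
      (1 + 1 / ε) * (quarterInv (b * (1 - b)) ^ 3 *
        quarterInv (symTwo h x * symThree h x) ^ 2) := by
  have h1 := one_le_quarterInv_unit hb
  have hu : 0 < b * (1 - b) := mul_pos hb.1 (by linarith [hb.2])
  have hre := norm_chamberKernel_inv_re_le ε b h x
  have him := Complex.abs_im_le_norm
    ((b * (1 - b) : ℝ) * symTwo h x - (1 + ε * Complex.I) * symThree h x : ℂ)
  rw [chamberKernel, norm_inv]
  set M := ‖((b * (1 - b) : ℝ) * symTwo h x - (1 + ε * Complex.I) * symThree h x : ℂ)‖
  set u := b * (1 - b)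
  set P := symTwo h x
  set R := symThree h x
  have him' : ε * |R| ≤ M := by
    rw [← abs_of_pos hε, ← abs_mul]
    simpa [abs_mul] using him
  have hR : |R| ≤ M * (1 / ε) := by
    rw [mul_one_div, le_div_iff₀ hε, mul_comm]
    exact him'
  have hM : 0 ≤ M := norm_nonneg _
  have hP : u * |P| ≤ M * (1 + 1 / ε) := by
    have : |u * P| ≤ |u * P - R| + |R| := by
      simpa using abs_add_le (u * P - R) R
    rw [abs_mul, abs_of_pos hu] at this
    linarith
  have hne' : 0 < |u * (P * R)| := abs_pos.2 (mul_ne_zero hu.ne' hne)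
  have hs : √|u * (P * R)| ≤ M * (1 + 1 / ε) := by
    rw [Real.sqrt_le_left (by positivity), abs_mul u, abs_mul P, abs_of_pos hu, ← mul_assoc, sq]
    have hR' : |R| ≤ M * (1 + 1 / ε) := by linarith
    gcongr
  have hs0 : 0 < √|u * (P * R)| := Real.sqrt_pos.2 hne'
  have hM0 : 0 < M := by
    have : 0 < M * (1 + 1 / ε) := hs0.trans_le hs
    exact pos_of_mul_pos_left this (by positivity)
  calc M⁻¹ ≤ (1 + 1 / ε) * (√|u * (P * R)|)⁻¹ := by
        rw [← div_eq_mul_inv, inv_le_comm₀ hM0 (by positivity), inv_div, div_le_iff₀ (by positivity)]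
        exact hs
    _ = (1 + 1 / ε) * (quarterInv u ^ 2 * quarterInv (P * R) ^ 2) := by
        rw [← quarterInv_sq, quarterInv_mul, mul_pow]
    _ ≤ _ := by
        gcongr
        norm_num

theorem integrable_quarterInv_unit :
    Integrable (fun b => quarterInv (b * (1 - b)) ^ 3) (volume.restrict (Set.Ioo (0 : ℝ) 1)) := by
  refine ⟨Measurable.aestronglyMeasurable (by fun_prop), ?_⟩
  rw [hasFiniteIntegral_iff_ofReal
    (Eventually.of_forall fun b => pow_nonneg (quarterInv_nonneg _) 3)]
  exact lintegral_quarterInv_unit_ne_top.lt_top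

theorem integrable_sym :
    Integrable fun p : ℝ × ℝ => quarterInv (symTwo p.1 p.2 * symThree p.1 p.2) ^ 2 := by
  refine ⟨Measurable.aestronglyMeasurable (by fun_prop), ?_⟩
  rw [hasFiniteIntegral_iff_ofReal
    (Eventually.of_forall fun b => pow_nonneg (quarterInv_nonneg _) 2), Measure.volume_eq_prod,
    lintegral_prod _ (by fun_prop)]
  exact lintegral_sym_ne_top.lt_top

theorem integrable_unit_mul_sym :
    Integrable (fun p : ℝ × ℝ × ℝ => quarterInv (p.1 * (1 - p.1)) ^ 3 *
      quarterInv (symTwo p.2.1 p.2.2 * symThree p.2.1 p.2.2) ^ 2)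
      ((volume.restrict (Set.Ioo (0 : ℝ) 1)).prod volume) :=
  integrable_quarterInv_unit.mul_prod integrable_sym

theorem ae_unit_prod {p : ℝ × ℝ → Prop} (hp : ∀ᵐ x, p x) :
    ∀ᵐ z ∂(volume.restrict (Set.Ioo (0 : ℝ) 1)).prod (volume : Measure (ℝ × ℝ)),
      z.1 ∈ Set.Ioo (0 : ℝ) 1 ∧ p z.2 :=
  (Measure.quasiMeasurePreserving_fst.ae (ae_restrict_mem measurableSet_Ioo)).and
    (Measure.quasiMeasurePreserving_snd.ae hp)

theorem integrable_chamberKernel {ε : ℝ} (hε : 0 < ε) :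
    Integrable (fun p : ℝ × ℝ × ℝ => chamberKernel ε p.1 p.2.1 p.2.2)
      ((volume.restrict (Set.Ioo (0 : ℝ) 1)).prod volume) := by
  refine (integrable_unit_mul_sym.const_mul (1 + 1 / ε)).mono'
    (Measurable.aestronglyMeasurable (by fun_prop)) ?_
  filter_upwards [ae_unit_prod ae_symTwo_mul_symThree_ne_zero] with z hz
  exact norm_chamberKernel_le hε hz.1 hz.2

theorem tendsto_chamberKernel (b h x : ℝ) (hne : b * (1 - b) * symTwo h x - symThree h x ≠ 0) :
    Tendsto (fun ε : ℝ => chamberKernel ε b h x) (𝓝[>] 0)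
      (𝓝 ((b * (1 - b) * symTwo h x - symThree h x : ℝ) : ℂ)⁻¹) := by
  have h1 : Continuous fun ε : ℝ => ((b * (1 - b) : ℝ) * symTwo h x -
      (1 + ε * Complex.I) * symThree h x : ℂ) := by fun_prop
  have e : ((b * (1 - b) * symTwo h x - symThree h x : ℝ) : ℂ) = (b * (1 - b) : ℝ) * symTwo h x -
      (1 + (0 : ℝ) * Complex.I) * symThree h x := by
    push_cast
    ring
  have h2 := (h1.tendsto 0).mono_left (nhdsWithin_le_nhds (s := Set.Ioi 0))
  rw [← e] at h2
  exact h2.inv₀ (Complex.ofReal_ne_zero.2 hne)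

theorem tendsto_integral_neg_chamber :
    Tendsto (fun ε : ℝ => (∫ p : ℝ × ℝ in Set.Iio 0 ×ˢ Set.Iio 0,
      ∫ b in Set.Ioo (0 : ℝ) 1, chamberKernel ε b p.1 p.2).re) (𝓝[>] 0)
      (𝓝 (-(∫⁻ b in Set.Ioo (0 : ℝ) 1, ∫⁻ h in Set.Iio (0 : ℝ), ∫⁻ x in Set.Iio (0 : ℝ),
        ENNReal.ofReal ((symThree h x - b * (1 - b) * symTwo h x)⁻¹)).toReal)) := by
  set ν := volume.restrict (Set.Ioo (0 : ℝ) 1)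
  set D : Set (ℝ × ℝ) := Set.Iio 0 ×ˢ Set.Iio 0 with hD
  have hDm : MeasurableSet D := measurableSet_Iio.prod measurableSet_Iio
  have hle : ν.prod (volume.restrict D) ≤ ν.prod volume :=
    Measure.prod_mono le_rfl Measure.restrict_le_self
  have hae : ∀ᵐ z ∂ν.prod (volume.restrict D), z.1 ∈ Set.Ioo (0 : ℝ) 1 ∧ z.2 ∈ D :=
    (Measure.quasiMeasurePreserving_fst.ae (ae_restrict_mem measurableSet_Ioo)).and
      (Measure.quasiMeasurePreserving_snd.ae (ae_restrict_mem hDm))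
  have hpos : ∀ z : ℝ × ℝ × ℝ, z.1 ∈ Set.Ioo (0 : ℝ) 1 → z.2 ∈ D →
      0 < symThree z.2.1 z.2.2 - z.1 * (1 - z.1) * symTwo z.2.1 z.2.2 := by
    intro z hb hz
    have h0 : z.2.1 < 0 := hz.1
    have h1 : z.2.2 < 0 := hz.2
    have hu : 0 < z.1 * (1 - z.1) := mul_pos hb.1 (by linarith [hb.2])
    have h2 : 0 < z.2.1 * z.2.2 := mul_pos_of_neg_of_neg h0 h1
    have hA : 0 < symThree z.2.1 z.2.2 := mul_pos h2 (by linarith)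
    have hB : 0 < -symTwo z.2.1 z.2.2 := by
      rw [symTwo]
      nlinarith
    nlinarith
  have hlim : Tendsto (fun ε : ℝ => ∫ z, chamberKernel ε z.1 z.2.1 z.2.2 ∂ν.prod (volume.restrict D))
      (𝓝[>] 0) (𝓝 (∫ z, ((z.1 * (1 - z.1) * symTwo z.2.1 z.2.2 - symThree z.2.1 z.2.2 : ℝ) : ℂ)⁻¹
        ∂ν.prod (volume.restrict D))) := by
    refine tendsto_integral_filter_of_dominated_convergence _
      (Eventually.of_forall fun ε => Measurable.aestronglyMeasurable (by fun_prop))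
      (Eventually.of_forall fun ε => ?_) (integrable_unit_mul_sym.mono_measure hle) ?_
    · filter_upwards [hae] with z hz
      have h0 := hpos z hz.1 hz.2
      have hu : 0 < z.1 * (1 - z.1) := mul_pos hz.1.1 (by linarith [hz.1.2])
      have h1 := norm_chamberKernel_inv_re_le ε z.1 z.2.1 z.2.2
      rw [abs_sub_comm, abs_of_pos h0] at h1
      have h2 := one_le_quarterInv_unit hz.1
      rw [chamberKernel, norm_inv]
      refine (inv_anti₀ h0 h1).trans ((symThree_sub_mul_symTwo_inv_le hu hz.2.1 hz.2.2).trans ?_)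
      gcongr
      norm_num
    · filter_upwards [hae] with z hz
      refine tendsto_chamberKernel _ _ _ ?_
      have := hpos z hz.1 hz.2
      exact (by linarith : _ < (0 : ℝ)).ne
  have hval : (∫ z, ((z.1 * (1 - z.1) * symTwo z.2.1 z.2.2 - symThree z.2.1 z.2.2 : ℝ) : ℂ)⁻¹
        ∂ν.prod (volume.restrict D)) =
      ((-(∫⁻ b in Set.Ioo (0 : ℝ) 1, ∫⁻ h in Set.Iio (0 : ℝ), ∫⁻ x in Set.Iio (0 : ℝ),
        ENNReal.ofReal ((symThree h x - b * (1 - b) * symTwo h x)⁻¹)).toReal : ℝ) : ℂ) := by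
    simp_rw [← Complex.ofReal_inv]
    rw [integral_complex_ofReal, Complex.ofReal_inj, ← neg_inj, ← integral_neg, neg_neg]
    simp_rw [← inv_neg, neg_sub]
    rw [integral_eq_lintegral_of_nonneg_ae]
    · congr 1
      rw [lintegral_prod _ (by fun_prop)]
      refine lintegral_congr fun b => ?_
      rw [hD, Measure.volume_eq_prod, ← Measure.prod_restrict, lintegral_prod _ (by fun_prop)]
    · filter_upwards [hae] with z hz
      exact inv_nonneg.2 (hpos z hz.1 hz.2).le
    · exact Measurable.aestronglyMeasurable (by fun_prop)
  rw [hval] at hlim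
  have := (Complex.continuous_re.tendsto _).comp hlim
  rw [Complex.ofReal_re] at this
  refine this.congr' ?_
  filter_upwards [self_mem_nhdsWithin] with ε hε
  rw [Function.comp, integral_prod_symm]
  exact (integrable_chamberKernel hε).mono_measure hle

end

section

open Filter Topology

theorem exists_integral_chamberKernel {ε b h : ℝ} (hε : 0 < ε) (hb : b ∈ Set.Ioo (0 : ℝ) 1)
    (h0 : h ≠ 0) (h1 : h ≠ 1) : ∃ k w : ℂ, k = (b * (1 - b) : ℝ) - (1 + ε * Complex.I) * h ∧
      k ≠ 0 ∧ 0 < w.re ∧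
      w ^ 2 = -((((1 - h : ℝ) : ℂ)) ^ 2 / 4 + (b * (1 - b) * h * (1 - h) : ℝ) / k) ∧
      ∫ x : ℝ, chamberKernel ε b h x = -Real.pi / (k * w) := by
  have hu : 0 < b * (1 - b) := mul_pos hb.1 (by linarith [hb.2])
  have him : ((b * (1 - b) : ℝ) - (1 + ε * Complex.I) * h : ℂ).im = -(ε * h) := by simp
  have hk : ((b * (1 - b) : ℝ) - (1 + ε * Complex.I) * h : ℂ) ≠ 0 := fun h' => by
    rw [h'] at him
    exact mul_ne_zero hε.ne' h0 (by simpa using him)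
  have hD : -((((1 - h : ℝ) : ℂ)) ^ 2 / 4 + (b * (1 - b) * h * (1 - h) : ℝ) /
      ((b * (1 - b) : ℝ) - (1 + ε * Complex.I) * h)) ∈ Complex.slitPlane := by
    refine Complex.mem_slitPlane_iff.2 (Or.inr ?_)
    rw [Complex.neg_im, Complex.add_im, div_eq_mul_inv (Complex.ofReal _), Complex.im_ofReal_mul,
      Complex.inv_im, him, ← Complex.ofReal_pow, ← Complex.ofReal_ofNat, ← Complex.ofReal_div,
      Complex.ofReal_im, zero_add, neg_ne_zero, neg_neg]
    exact mul_ne_zero (mul_ne_zero (mul_ne_zero hu.ne' h0) (sub_ne_zero.2 h1.symm))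
      (div_ne_zero (mul_ne_zero hε.ne' h0) (Complex.normSq_pos.2 hk).ne')
  obtain ⟨w, hw2, hw, -, -, hInt⟩ := Complex.integral_inv_quadratic hk hD
  refine ⟨_, w, rfl, hk, hw, hw2, ?_⟩
  rw [← hInt]
  refine integral_congr_ae (Eventually.of_forall fun x => ?_)
  simp only [chamberKernel, symTwo, symThree]
  congr 1
  push_cast
  ring

theorem integral_chamberKernel_sq {ε b h : ℝ} (hε : 0 < ε) (hb : b ∈ Set.Ioo (0 : ℝ) 1)
    (h0 : h ≠ 0) (h1 : h ≠ 1) : (∫ x : ℝ, chamberKernel ε b h x) ^ 2 = -(4 * Real.pi ^ 2) /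
      ((((b * (1 - b) : ℝ) - (1 + ε * Complex.I) * h) * (1 - h : ℝ)) *
        (((b * (1 - b) : ℝ) - (1 + ε * Complex.I) * h) * (1 - h : ℝ) +
          (4 * (b * (1 - b)) * h : ℝ))) := by
  obtain ⟨k, w, hk, hk0, hw, hw2, hJ⟩ := exists_integral_chamberKernel hε hb h0 h1
  have hσ : ((1 - h : ℝ) : ℂ) ≠ 0 := Complex.ofReal_ne_zero.2 (sub_ne_zero.2 h1.symm)
  have e : (k * w) ^ 2 = -((k * (1 - h : ℝ)) * (k * (1 - h : ℝ) + (4 * (b * (1 - b)) * h : ℝ))) / 4 := by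
    rw [mul_pow, hw2]
    push_cast
    field_simp
  rw [hJ, div_pow, e, ← hk, neg_sq, div_div_eq_mul_div, div_neg, neg_div, mul_comm]

theorem norm_integral_chamberKernel_le {ε b h : ℝ} (hε : 0 < ε) (hb : b ∈ Set.Ioo (0 : ℝ) 1)
    (h0 : h ≠ 0) (h1 : h ≠ 1) (hW : discW b h ≠ 0) :
    ‖∫ x : ℝ, chamberKernel ε b h x‖ ≤ 2 * Real.pi * quarterInv (discW b h) ^ 2 := by
  have hq := quarterInv_nonneg (discW b h)
  refine abs_le_of_sq_le_sq' ?_ (by positivity) |>.2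
  rw [← norm_pow, integral_chamberKernel_sq hε hb h0 h1, norm_div, norm_mul _ (_ + _), norm_neg,
    mul_pow, ← pow_mul, quarterInv_pow_four, ← div_eq_mul_inv]
  have e1 : ‖(4 * Real.pi ^ 2 : ℂ)‖ = (2 * Real.pi) ^ 2 := by
    rw [norm_mul, norm_pow, Complex.norm_real, Real.norm_of_nonneg Real.pi_pos.le]
    norm_num
    ring
  rw [e1]
  refine div_le_div_of_nonneg_left (by positivity) (abs_pos.2 hW) ?_
  rw [discW, abs_mul]
  refine mul_le_mul ?_ ?_ (abs_nonneg _) (norm_nonneg _)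
  · refine le_trans (le_of_eq ?_) (Complex.abs_re_le_norm _)
    congr 1
    simp
  · refine le_trans (le_of_eq ?_) (Complex.abs_re_le_norm _)
    congr 1
    simp

theorem tendsto_regularised (b h : ℝ) : Tendsto
    (fun ε : ℝ => (b * (1 - b) : ℝ) - (1 + ε * Complex.I) * h) (𝓝[>] 0)
    (𝓝 ((b * (1 - b) - h : ℝ) : ℂ)) := by
  have h1 : Continuous fun ε : ℝ => ((b * (1 - b) : ℝ) - (1 + ε * Complex.I) * h : ℂ) := by
    fun_prop
  have h2 := (h1.tendsto 0).mono_left (nhdsWithin_le_nhds (s := Set.Ioi 0))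
  convert h2 using 2
  push_cast
  ring

theorem tendsto_integral_chamberKernel_of_discW_pos {b h : ℝ} (hb : b ∈ Set.Ioo (0 : ℝ) 1)
    (h0 : h ≠ 0) (h1 : h ≠ 1) (hW : 0 < discW b h) :
    Tendsto (fun ε : ℝ => (∫ x : ℝ, chamberKernel ε b h x).re) (𝓝[>] 0) (𝓝 0) := by
  refine Complex.tendsto_re_zero_of_sq (L := -(4 * Real.pi ^ 2) / discW b h) ?_ ?_
  · exact div_nonpos_of_nonpos_of_nonneg (by nlinarith [sq_nonneg Real.pi]) hW.le
  · have hk := (tendsto_regularised b h).mul_const ((1 - h : ℝ) : ℂ)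
    have hlim := (hk.mul (hk.add_const ((4 * (b * (1 - b)) * h : ℝ) : ℂ)))
    have e : ((b * (1 - b) - h : ℝ) : ℂ) * (1 - h : ℝ) * (((b * (1 - b) - h : ℝ) : ℂ) * (1 - h : ℝ) +
        (4 * (b * (1 - b)) * h : ℝ)) = (discW b h : ℝ) := by
      rw [discW]
      push_cast
      ring
    rw [e] at hlim
    have := Tendsto.div (tendsto_const_nhds (x := (-(4 * Real.pi ^ 2) : ℂ))) hlim (Complex.ofReal_ne_zero.2 hW.ne')
    have e2 : ((-(4 * Real.pi ^ 2) / discW b h : ℝ) : ℂ) = -(4 * Real.pi ^ 2 : ℂ) / discW b h := by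
      push_cast
      ring
    rw [e2]
    refine this.congr' ?_
    filter_upwards [self_mem_nhdsWithin] with ε hε
    rw [integral_chamberKernel_sq hε hb h0 h1]
    rfl

theorem tendsto_integral_chamberKernel_of_discW_neg {b h : ℝ} (hb : b ∈ Set.Ioo (0 : ℝ) 1)
    (hh : h ∈ Set.Ioo (0 : ℝ) 1) (hW : discW b h < 0) :
    Tendsto (fun ε : ℝ => (∫ x : ℝ, chamberKernel ε b h x).re) (𝓝[>] 0)
      (𝓝 (2 * Real.pi * (√(-discW b h))⁻¹)) := by
  have hh0 := hh.1
  have hh1 : 0 < 1 - h := sub_pos.2 hh.2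
  have hu : 0 < b * (1 - b) := mul_pos hb.1 (by linarith [hb.2])
  have hk : b * (1 - b) - h < 0 := by
    by_contra! hk
    refine hW.not_ge ?_
    rw [discW]
    have := mul_nonneg hk hh1.le
    positivity
  choose! k w hkd hk0 hw hw2 hJ using fun ε (hε : 0 < ε) =>
    exists_integral_chamberKernel hε hb hh.1.ne' hh.2.ne
  have hkl : Tendsto k (𝓝[>] 0) (𝓝 ((b * (1 - b) - h : ℝ) : ℂ)) := by
    refine (tendsto_regularised b h).congr' ?_
    filter_upwards [self_mem_nhdsWithin] with ε hε
    exact (hkd ε hε).symm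
  have hkne : ((b * (1 - b) - h : ℝ) : ℂ) ≠ 0 := Complex.ofReal_ne_zero.2 hk.ne
  have hD : 0 < -discW b h / (4 * (b * (1 - b) - h) ^ 2) := by
    refine div_pos (neg_pos.2 hW) ?_
    have := pow_pos (neg_pos.2 hk) 2
    linarith [neg_sq (b * (1 - b) - h)]
  have hwl : Tendsto w (𝓝[>] 0) (𝓝 (√(-discW b h / (4 * (b * (1 - b) - h) ^ 2)) : ℂ)) := by
    refine Complex.tendsto_of_sq_of_re_pos hD ?_ ?_
    · filter_upwards [self_mem_nhdsWithin] with ε hε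
      exact hw ε hε
    · have h1 := ((Tendsto.div (tendsto_const_nhds (x := ((b * (1 - b) * h * (1 - h) : ℝ) : ℂ))) hkl hkne).const_add
        (((1 - h : ℝ) : ℂ) ^ 2 / 4)).neg
      have e : -(((1 - h : ℝ) : ℂ) ^ 2 / 4 +
          ((b * (1 - b) * h * (1 - h) : ℝ) : ℂ) / ((b * (1 - b) - h : ℝ) : ℂ)) =
          ((-discW b h / (4 * (b * (1 - b) - h) ^ 2) : ℝ) : ℂ) := by
        rw [← Complex.ofReal_div, ← Complex.ofReal_pow, ← Complex.ofReal_ofNat,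
          ← Complex.ofReal_div, ← Complex.ofReal_add, ← Complex.ofReal_neg, Complex.ofReal_inj,
          discW]
        have := hk.ne
        field_simp
      rw [e] at h1
      refine h1.congr' ?_
      filter_upwards [self_mem_nhdsWithin] with ε hε
      exact (hw2 ε hε).symm
  have hlim := Tendsto.div (tendsto_const_nhds (x := (-Real.pi : ℂ))) (hkl.mul hwl)
    (mul_ne_zero hkne (Complex.ofReal_ne_zero.2 (Real.sqrt_pos.2 hD).ne'))
  have e : (-Real.pi : ℂ) / (((b * (1 - b) - h : ℝ) : ℂ) *
      (√(-discW b h / (4 * (b * (1 - b) - h) ^ 2)) : ℂ)) =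
      ((2 * Real.pi * (√(-discW b h))⁻¹ : ℝ) : ℂ) := by
    rw [← Complex.ofReal_neg, ← Complex.ofReal_mul, ← Complex.ofReal_div, Complex.ofReal_inj,
      Real.sqrt_div (neg_pos.2 hW).le,
      show 4 * (b * (1 - b) - h) ^ 2 = (-(2 * (b * (1 - b) - h))) ^ 2 by ring,
      Real.sqrt_sq (by linarith)]
    have h2 : √(-discW b h) ≠ 0 := (Real.sqrt_pos.2 (neg_pos.2 hW)).ne'
    have := hk.ne
    field_simp
  rw [e] at hlim
  have := (Complex.continuous_re.tendsto _).comp hlim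
  rw [Complex.ofReal_re] at this
  refine this.congr' ?_
  filter_upwards [self_mem_nhdsWithin] with ε hε
  rw [Function.comp, hJ ε hε]
  rfl

theorem ae_discW_ne_zero (S : Set ℝ) :
    ∀ᵐ z ∂(volume.restrict (Set.Ioo (0 : ℝ) 1)).prod ((volume : Measure ℝ).restrict S),
      discW z.1 z.2 ≠ 0 := by
  refine (Measure.ae_prod_iff_ae_ae (measurableSet_eq_fun (by fun_prop) (by fun_prop)).compl).2 ?_
  refine Eventually.of_forall fun b => ae_restrict_of_ae ?_
  filter_upwards [ae_ne_const 1, ae_ne_const (b * (1 - b)),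
    ae_quadratic_ne_zero (3 * (b * (1 - b)) - 1) (b * (1 - b))] with h h1 h2 h3
  rw [discW]
  refine mul_ne_zero (mul_ne_zero (sub_ne_zero.2 h2.symm) (sub_ne_zero.2 h1.symm)) fun h' => h3 ?_
  linear_combination h'

theorem discW_pos {b h : ℝ} (hb : b ∈ Set.Ioo (0 : ℝ) 1) (h0 : h ≠ 0) (h1 : h ≠ 1)
    (hh : h ∉ Set.Ioo (0 : ℝ) 1) : 0 < discW b h := by
  have hu : 0 < b * (1 - b) := mul_pos hb.1 (by linarith [hb.2])
  have hu4 : b * (1 - b) ≤ 1 / 4 := by nlinarith [sq_nonneg (b - 1 / 2)]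
  rw [discW]
  generalize b * (1 - b) = u at *
  rcases lt_or_gt_of_ne h0 with hlt | hgt
  · refine mul_pos (mul_pos (by linarith) (by linarith)) ?_
    nlinarith [mul_nonneg (neg_pos.2 hlt).le (sub_nonneg.2 hu4), sq_nonneg h]
  · have h2 : 1 < h := lt_of_le_of_ne (not_lt.1 fun h' => hh ⟨hgt, h'⟩) h1.symm
    have h3 : 0 < (u - h) * (1 - h) := mul_pos_of_neg_of_neg (by linarith) (by linarith)
    refine mul_pos h3 ?_
    nlinarith [mul_pos hu hgt, mul_pos hgt (sub_pos.2 h2)]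

/-- The boundary value of the real part of the inner integral of `chamberKernel`. -/
noncomputable def boundaryValue (b h : ℝ) : ℝ :=
  if h ∈ Set.Ioo (0 : ℝ) 1 then 2 * Real.pi * (√(-discW b h))⁻¹ else 0

theorem tendsto_integral_chamberKernel {b h : ℝ} (hb : b ∈ Set.Ioo (0 : ℝ) 1)
    (h0 : h ≠ 0) (h1 : h ≠ 1) (hW : discW b h ≠ 0) :
    Tendsto (fun ε : ℝ => (∫ x : ℝ, chamberKernel ε b h x).re) (𝓝[>] 0)
      (𝓝 (boundaryValue b h)) := by
  rw [boundaryValue]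
  split_ifs with hh
  · rcases lt_or_gt_of_ne hW with hW | hW
    · exact tendsto_integral_chamberKernel_of_discW_neg hb hh hW
    · rw [Real.sqrt_eq_zero_of_nonpos (by linarith), inv_zero, mul_zero]
      exact tendsto_integral_chamberKernel_of_discW_pos hb h0 h1 hW
  · exact tendsto_integral_chamberKernel_of_discW_pos hb h0 h1 (discW_pos hb h0 h1 hh)

theorem integral_integral_prod_assoc {ν μ κ : Measure ℝ} [SFinite ν] [SFinite μ] [SFinite κ]
    {F : ℝ → ℝ → ℝ → ℂ} (hF : Integrable (fun p : ℝ × ℝ × ℝ => F p.1 p.2.1 p.2.2)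
      (ν.prod (μ.prod κ))) :
    ∫ p, ∫ b, F b p.1 p.2 ∂ν ∂μ.prod κ = ∫ z, ∫ x, F z.1 z.2 x ∂κ ∂ν.prod μ := by
  have hmp : MeasurePreserving (MeasurableEquiv.prodAssoc : (ℝ × ℝ) × ℝ ≃ᵐ ℝ × ℝ × ℝ)
      ((ν.prod μ).prod κ) (ν.prod (μ.prod κ)) := measurePreserving_prodAssoc ν μ κ
  rw [← integral_prod_symm (fun p : ℝ × ℝ × ℝ => F p.1 p.2.1 p.2.2) hF,
    ← hmp.integral_comp MeasurableEquiv.prodAssoc.measurableEmbedding]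
  rw [← hmp.integrable_comp_emb MeasurableEquiv.prodAssoc.measurableEmbedding] at hF
  exact integral_prod _ hF

theorem tendsto_integral_strip {S : Set ℝ}
    (hfin : ∫⁻ h in S, ∫⁻ b in Set.Ioo (0 : ℝ) 1,
      ENNReal.ofReal (quarterInv (discW b h) ^ 2) ≠ ⊤) :
    Tendsto (fun ε : ℝ => (∫ p : ℝ × ℝ in S ×ˢ Set.univ,
      ∫ b in Set.Ioo (0 : ℝ) 1, chamberKernel ε b p.1 p.2).re) (𝓝[>] 0)
      (𝓝 (∫ z, boundaryValue z.1 z.2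
        ∂(volume.restrict (Set.Ioo (0 : ℝ) 1)).prod (volume.restrict S))) := by
  set ν := volume.restrict (Set.Ioo (0 : ℝ) 1)
  set μ := (volume : Measure ℝ).restrict S with hμ
  have hrestr : (volume : Measure (ℝ × ℝ)).restrict (S ×ˢ Set.univ) = μ.prod volume := by
    rw [hμ, Measure.volume_eq_prod, ← Measure.prod_restrict, Measure.restrict_univ]
  have hInt : ∀ ε > 0, Integrable (fun p : ℝ × ℝ × ℝ => chamberKernel ε p.1 p.2.1 p.2.2)
      (ν.prod (μ.prod volume)) := by
    intro ε hε
    rw [← hrestr]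
    exact (integrable_chamberKernel hε).mono_measure
      (Measure.prod_mono le_rfl Measure.restrict_le_self)
  have hae : ∀ᵐ z ∂ν.prod μ, z.1 ∈ Set.Ioo (0 : ℝ) 1 ∧ z.2 ≠ 0 ∧ z.2 ≠ 1 ∧ discW z.1 z.2 ≠ 0 := by
    filter_upwards [Measure.quasiMeasurePreserving_fst.ae (ae_restrict_mem measurableSet_Ioo),
      Measure.quasiMeasurePreserving_snd.ae (ae_restrict_of_ae (ae_ne_const 0)),
      Measure.quasiMeasurePreserving_snd.ae (ae_restrict_of_ae (ae_ne_const 1)),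
      ae_discW_ne_zero S] with z h1 h2 h3 h4
    exact ⟨h1, h2, h3, h4⟩
  have hbound : Integrable (fun z : ℝ × ℝ => 2 * Real.pi * quarterInv (discW z.1 z.2) ^ 2)
      (ν.prod μ) := by
    refine Integrable.const_mul ⟨Measurable.aestronglyMeasurable (by fun_prop), ?_⟩ _
    rw [hasFiniteIntegral_iff_ofReal
      (Eventually.of_forall fun b => pow_nonneg (quarterInv_nonneg _) 2),
      lintegral_prod_symm _ (Measurable.aemeasurable (by fun_prop))]
    exact hfin.lt_top
  have hmeas : ∀ ε > 0, AEStronglyMeasurable (fun z : ℝ × ℝ => (∫ x, chamberKernel ε z.1 z.2 x).re)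
      (ν.prod μ) := by
    intro ε hε
    refine Complex.continuous_re.comp_aestronglyMeasurable
      (StronglyMeasurable.aestronglyMeasurable ?_)
    refine StronglyMeasurable.integral_prod_right' (f := fun q : (ℝ × ℝ) × ℝ =>
      chamberKernel ε q.1.1 q.1.2 q.2) (Measurable.stronglyMeasurable ?_)
    exact (measurable_chamberKernel ε).comp (f := fun q : (ℝ × ℝ) × ℝ => (q.1.1, q.1.2, q.2))
      (by fun_prop)
  have hlim : Tendsto (fun ε : ℝ => ∫ z, (∫ x, chamberKernel ε z.1 z.2 x).re ∂ν.prod μ)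
      (𝓝[>] 0) (𝓝 (∫ z, boundaryValue z.1 z.2 ∂ν.prod μ)) := by
    refine tendsto_integral_filter_of_dominated_convergence _ ?_ ?_ hbound ?_
    · filter_upwards [self_mem_nhdsWithin] with ε hε
      exact hmeas ε hε
    · filter_upwards [self_mem_nhdsWithin] with ε hε
      filter_upwards [hae] with z hz
      exact (Complex.abs_re_le_norm _).trans
        (norm_integral_chamberKernel_le hε hz.1 hz.2.1 hz.2.2.1 hz.2.2.2)
    · filter_upwards [hae] with z hz
      exact tendsto_integral_chamberKernel hz.1 hz.2.1 hz.2.2.1 hz.2.2.2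
  refine hlim.congr' ?_
  filter_upwards [self_mem_nhdsWithin] with ε hε
  rw [hrestr, integral_integral_prod_assoc (hInt ε hε)]
  refine (integral_re (𝕜 := ℂ) (f := fun z : ℝ × ℝ => ∫ x, chamberKernel ε z.1 z.2 x) ?_)
  have hmp : MeasurePreserving (MeasurableEquiv.prodAssoc : (ℝ × ℝ) × ℝ ≃ᵐ ℝ × ℝ × ℝ)
      ((ν.prod μ).prod volume) (ν.prod (μ.prod volume)) := measurePreserving_prodAssoc ν μ volume
  exact ((hmp.integrable_comp_emb MeasurableEquiv.prodAssoc.measurableEmbedding).2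
    (hInt ε hε)).integral_prod_left

theorem tendsto_integral_neg_strip :
    Tendsto (fun ε : ℝ => (∫ p : ℝ × ℝ in Set.Iio 0 ×ˢ Set.univ,
      ∫ b in Set.Ioo (0 : ℝ) 1, chamberKernel ε b p.1 p.2).re) (𝓝[>] 0) (𝓝 0) := by
  have h := tendsto_integral_strip lintegral_discW_neg_ne_top
  rwa [integral_eq_zero_of_ae] at h
  filter_upwards [Measure.quasiMeasurePreserving_snd.ae (ae_restrict_mem measurableSet_Iio)]
    with z hz
  rw [boundaryValue, if_neg fun h' => lt_asymm (Set.mem_Iio.1 hz) h'.1, Pi.zero_apply]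

theorem integral_boundaryValue :
    ∫ z, boundaryValue z.1 z.2
      ∂(volume.restrict (Set.Ioo (0 : ℝ) 1)).prod (volume.restrict (Set.Ioi (0 : ℝ))) =
    2 * Real.pi * doubleLog.toReal := by
  have hm : Measurable fun z : ℝ × ℝ => boundaryValue z.1 z.2 := by
    unfold boundaryValue
    exact Measurable.ite (measurable_snd measurableSet_Ioo) (by fun_prop) measurable_const
  have h0 : ∀ b h, 0 ≤ boundaryValue b h := by
    intro b h
    rw [boundaryValue]
    split_ifs <;> positivity
  have e : ∀ b, ∫⁻ h in Set.Ioi 0, ENNReal.ofReal (boundaryValue b h) =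
      ENNReal.ofReal (2 * Real.pi) * ∫⁻ h in Set.Ioo (0 : ℝ) 1, ENNReal.ofReal
        (√((1 - h) * (h - b * (1 - b)) * (b * (1 - b) * (1 + 3 * h) - h * (1 - h))))⁻¹ := by
    intro b
    have hsupp : (Function.support fun h => ENNReal.ofReal (boundaryValue b h)) ⊆
        Set.Ioo 0 1 := by
      intro h hh
      by_contra h'
      exact hh (by simp only [boundaryValue, if_neg h', ENNReal.ofReal_zero])
    rw [setLIntegral_eq_of_support_subset (hsupp.trans Set.Ioo_subset_Ioi_self),
      ← setLIntegral_eq_of_support_subset hsupp, ← lintegral_const_mul _ (by fun_prop)]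
    refine setLIntegral_congr_fun measurableSet_Ioo fun h hh => ?_
    simp only [boundaryValue, if_pos hh]
    rw [ENNReal.ofReal_mul (by positivity), discW]
    congr 5
    ring
  rw [integral_eq_lintegral_of_nonneg_ae (Eventually.of_forall fun z => h0 _ _)
    hm.aestronglyMeasurable, lintegral_prod _ (by fun_prop)]
  simp only [e]
  rw [lintegral_const_mul' _ _ ENNReal.ofReal_ne_top, lintegral_window_eq_doubleLog,
    ENNReal.toReal_mul, ENNReal.toReal_ofReal (by positivity)]

theorem tendsto_integral_pos_strip :
    Tendsto (fun ε : ℝ => (∫ p : ℝ × ℝ in Set.Ioi 0 ×ˢ Set.univ,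
      ∫ b in Set.Ioo (0 : ℝ) 1, chamberKernel ε b p.1 p.2).re) (𝓝[>] 0)
      (𝓝 (2 * Real.pi * doubleLog.toReal)) := by
  have h := tendsto_integral_strip (S := Set.Ioi 0) (ne_top_of_le_ne_top lintegral_discW_pos_ne_top
    (lintegral_mono fun h => lintegral_mono' Measure.restrict_le_self le_rfl))
  rwa [integral_boundaryValue] at h

end

section

open Filter Topology

theorem integral_Ioo_zero_one_of_reflect {f : ℝ → ℂ} (hf : Integrable f)
    (hrefl : ∀ b, f (1 + b) = f (-b)) :
    ∫ b in Set.Ioo (0 : ℝ) 1, f b = (∫ b, f b) - 2 * ∫ y in Set.Ioi (0 : ℝ), f (-y) := by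
  have h1 := intervalIntegral.integral_Iic_add_Ioi (b := (0 : ℝ)) hf.integrableOn hf.integrableOn
  have h2 : ∫ b in Set.Ioi (0 : ℝ), f b =
      (∫ b in Set.Ioo (0 : ℝ) 1, f b) + ∫ b in Set.Ioi (1 : ℝ), f b := by
    rw [← integral_Ioc_eq_integral_Ioo, ← Set.Ioc_union_Ioi_eq_Ioi (zero_le_one' ℝ),
      setIntegral_union (Set.Ioc_disjoint_Ioi le_rfl) measurableSet_Ioi hf.integrableOn
        hf.integrableOn]
  have h3 : ∫ b in Set.Ioi (1 : ℝ), f b = ∫ y in Set.Ioi (0 : ℝ), f (-y) := by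
    rw [← (measurePreserving_add_left volume (1 : ℝ)).setIntegral_preimage_emb
      (measurableEmbedding_addLeft 1), Set.preimage_const_add_Ioi, sub_self]
    simp_rw [hrefl]
  have h4 := integral_comp_neg_Ioi 0 f
  rw [neg_zero] at h4
  rw [← h1, h2, h3, h4]
  ring

theorem integral_inv_quadratic_regularised {ε k l : ℝ} (hε : 0 < ε) (hk : 0 < k) (hl : 0 < l) :
    (Integrable fun b : ℝ => ((b * (1 - b) : ℝ) * k - (1 + ε * Complex.I) * l : ℂ)⁻¹) ∧
    (∫ b : ℝ, ((b * (1 - b) : ℝ) * k - (1 + ε * Complex.I) * l : ℂ)⁻¹) ^ 2 =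
      -(4 * Real.pi ^ 2) / (k * (k - 4 * ((1 + ε * Complex.I) * l))) := by
  have hk' : (k : ℂ) ≠ 0 := Complex.ofReal_ne_zero.2 hk.ne'
  have him : (-((((1 : ℝ) : ℂ)) ^ 2 / 4 + -((1 + ε * Complex.I) * l) / k)).im = ε * l / k := by
    simp [neg_div]
  have hD : -((((1 : ℝ) : ℂ)) ^ 2 / 4 + -((1 + ε * Complex.I) * l) / k) ∈ Complex.slitPlane :=
    Complex.mem_slitPlane_iff.2 (Or.inr (by rw [him]; positivity))
  have hD0 := Complex.slitPlane_ne_zero hD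
  obtain ⟨w, hw2, hw, -, hInt, hJ⟩ := Complex.integral_inv_quadratic hk' hD
  have e : ∀ b : ℝ, ((b * (1 - b) : ℝ) * k - (1 + ε * Complex.I) * l : ℂ) =
      k * (b * ((1 : ℝ) - b)) + -((1 + ε * Complex.I) * l) := by
    intro b
    push_cast
    ring
  simp_rw [e]
  refine ⟨hInt, ?_⟩
  rw [hJ, div_pow, mul_pow, hw2]
  have e2 : (k : ℂ) ^ 2 * -((((1 : ℝ) : ℂ)) ^ 2 / 4 + -((1 + ε * Complex.I) * l) / k) =
      -(k * (k - 4 * ((1 + ε * Complex.I) * l))) / 4 := by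
    push_cast
    field_simp
    ring
  rw [e2, neg_sq, div_div_eq_mul_div, div_neg, neg_div]
  ring

theorem norm_integral_inv_quadratic_regularised_le {ε k l : ℝ} (hε : 0 < ε) (hl : 0 < l)
    (hkl : 9 * l ≤ k) :
    ‖∫ b : ℝ, ((b * (1 - b) : ℝ) * k - (1 + ε * Complex.I) * l : ℂ)⁻¹‖ ≤
      Real.pi * quarterInv (k * l) ^ 2 := by
  have hk : 0 < k := by linarith
  refine le_of_sq_le_sq ?_ (by have := quarterInv_nonneg (k * l); positivity)
  rw [← norm_pow, (integral_inv_quadratic_regularised hε hk hl).2, mul_pow, ← pow_mul,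
    quarterInv_pow_four, abs_of_pos (by positivity), norm_div, norm_neg, norm_mul, norm_mul]
  have h1 : k - 4 * l ≤ ‖(k - 4 * ((1 + ε * Complex.I) * l) : ℂ)‖ := by
    have := (le_abs_self _).trans
      (Complex.abs_re_le_norm (k - 4 * ((1 + ε * Complex.I) * l) : ℂ))
    simpa using this
  have h2 : 0 < k - 4 * l := by linarith
  have h0 : 0 < ‖(k - 4 * ((1 + ε * Complex.I) * l) : ℂ)‖ := h2.trans_le h1
  rw [norm_pow, Complex.norm_real, Complex.norm_real, Real.norm_of_nonneg Real.pi_pos.le,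
    Real.norm_of_nonneg hk.le, ← div_eq_mul_inv, div_le_div_iff₀ (by positivity) (by positivity)]
  have h3 : 4 * (k * l) ≤ k * ‖(k - 4 * ((1 + ε * Complex.I) * l) : ℂ)‖ := by
    nlinarith
  have h4 : ‖(4 : ℂ)‖ = 4 := by simp
  rw [h4]
  nlinarith [sq_nonneg Real.pi]

theorem tendsto_re_integral_inv_quadratic {k l : ℝ} (hl : 0 < l) (hkl : 9 * l ≤ k) :
    Tendsto (fun ε : ℝ => (∫ b : ℝ, ((b * (1 - b) : ℝ) * k - (1 + ε * Complex.I) * l : ℂ)⁻¹).re)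
      (𝓝[>] 0) (𝓝 0) := by
  have hk : 0 < k := by linarith
  have h2 : 0 < k - 4 * l := by linarith
  refine Complex.tendsto_re_zero_of_sq (L := -(4 * Real.pi ^ 2) / (k * (k - 4 * l))) ?_ ?_
  · exact div_nonpos_of_nonpos_of_nonneg (by nlinarith [sq_nonneg Real.pi]) (by positivity)
  · have hc : Tendsto (fun ε : ℝ => (k * (k - 4 * ((1 + ε * Complex.I) * l)) : ℂ)) (𝓝[>] 0)
        (𝓝 (k * (k - 4 * ((1 + (0 : ℝ) * Complex.I) * l)))) :=
      ((by fun_prop : Continuous fun ε : ℝ =>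
        (k * (k - 4 * ((1 + ε * Complex.I) * l)) : ℂ)).tendsto 0).mono_left nhdsWithin_le_nhds
    have e : (k * (k - 4 * ((1 + (0 : ℝ) * Complex.I) * l)) : ℂ) = ((k * (k - 4 * l) : ℝ) : ℂ) := by
      push_cast; ring
    rw [e] at hc
    have hne : ((k * (k - 4 * l) : ℝ) : ℂ) ≠ 0 := Complex.ofReal_ne_zero.2 (by positivity)
    have := (tendsto_const_nhds (x := (-(4 * Real.pi ^ 2) : ℂ))).div hc hne
    rw [show (-(4 * Real.pi ^ 2) / (k * (k - 4 * l) : ℝ) : ℂ) =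
      ((-(4 * Real.pi ^ 2) / (k * (k - 4 * l)) : ℝ) : ℂ) by push_cast; ring] at this
    refine this.congr' ?_
    filter_upwards [self_mem_nhdsWithin] with ε hε
    rw [(integral_inv_quadratic_regularised hε hk hl).2]
    rfl

/-- The open chamber on which `h`, `x` and `1 - h - x` are all positive. -/
def simplexChamber : Set (ℝ × ℝ) := {p | 0 < p.1 ∧ 0 < p.2 ∧ 0 < 1 - p.1 - p.2}

theorem measurableSet_simplexChamber : MeasurableSet simplexChamber := by
  unfold simplexChamber; measurability

theorem symThree_pos {p : ℝ × ℝ} (hp : p ∈ simplexChamber) : 0 < symThree p.1 p.2 :=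
  mul_pos (mul_pos hp.1 hp.2.1) hp.2.2

theorem nine_symThree_le {p : ℝ × ℝ} (hp : p ∈ simplexChamber) :
    9 * symThree p.1 p.2 ≤ symTwo p.1 p.2 := by
  obtain ⟨h1, h2, h3⟩ := hp
  rw [symThree, symTwo]
  generalize hz : 1 - p.1 - p.2 = z at *
  generalize p.1 = x at *
  generalize p.2 = y at *
  obtain rfl : z = 1 - x - y := hz.symm
  nlinarith [mul_nonneg h1.le (sq_nonneg (y - (1 - x - y))),
    mul_nonneg h2.le (sq_nonneg (x - (1 - x - y))), mul_nonneg h3.le (sq_nonneg (x - y))]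

theorem lintegral_simplexChamber {Φ : ℝ × ℝ → ENNReal} (hΦ : Measurable Φ) :
    ∫⁻ p in simplexChamber, Φ p =
      ∫⁻ h in Set.Ioo (0 : ℝ) 1, ∫⁻ x in Set.Ioo (0 : ℝ) (1 - h), Φ (h, x) := by
  rw [← lintegral_indicator measurableSet_simplexChamber, Measure.volume_eq_prod,
    lintegral_prod _ (hΦ.indicator measurableSet_simplexChamber).aemeasurable,
    ← lintegral_indicator measurableSet_Ioo]
  refine lintegral_congr fun h => ?_
  by_cases hh : h ∈ Set.Ioo (0 : ℝ) 1
  · rw [Set.indicator_of_mem hh, ← lintegral_indicator measurableSet_Ioo]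
    refine lintegral_congr fun x => ?_
    have : (h, x) ∈ simplexChamber ↔ x ∈ Set.Ioo 0 (1 - h) :=
      ⟨fun ⟨_, h2, h3⟩ => ⟨h2, by simpa using h3⟩, fun ⟨h2, h3⟩ => ⟨hh.1, h2, by simpa using h3⟩⟩
    by_cases hx : x ∈ Set.Ioo 0 (1 - h)
    · rw [Set.indicator_of_mem hx, Set.indicator_of_mem (this.2 hx)]
    · rw [Set.indicator_of_notMem hx, Set.indicator_of_notMem (mt this.1 hx)]
  · rw [Set.indicator_of_notMem hh]
    refine (lintegral_congr fun x => Set.indicator_of_notMem (fun h' => hh ?_) _).trans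
      lintegral_zero
    obtain ⟨h1, h2, h3⟩ := h'
    simp only at h1 h2 h3
    exact ⟨h1, by linarith⟩

end

section

open Filter Topology

/-- The value `I(1)` of the three-banana integral, as an integral over the negative chamber. -/
noncomputable def bananaValue : ENNReal :=
  ∫⁻ b in Set.Ioo (0 : ℝ) 1, ∫⁻ h in Set.Iio (0 : ℝ), ∫⁻ x in Set.Iio (0 : ℝ),
    ENNReal.ofReal ((symThree h x - b * (1 - b) * symTwo h x)⁻¹)

theorem lintegral_simplexChamber_prod :
    ∫⁻ z, ENNReal.ofReal ((z.2 * (1 + z.2) * symTwo z.1.1 z.1.2 + symThree z.1.1 z.1.2)⁻¹)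
      ∂(volume.restrict simplexChamber).prod (volume.restrict (Set.Ioi (0 : ℝ))) = bananaValue := by
  rw [lintegral_prod _ (Measurable.aemeasurable (by fun_prop)), lintegral_simplexChamber
    (Φ := fun p => ∫⁻ y in Set.Ioi (0 : ℝ),
      ENNReal.ofReal ((y * (1 + y) * symTwo p.1 p.2 + symThree p.1 p.2)⁻¹))]
  · exact lintegral_quadratic_eq_simplex.symm.trans lintegral_quadratic_eq_neg
  · refine Measurable.lintegral_prod_right' (f := fun z : (ℝ × ℝ) × ℝ =>
      ENNReal.ofReal ((z.2 * (1 + z.2) * symTwo z.1.1 z.1.2 + symThree z.1.1 z.1.2)⁻¹)) ?_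
    fun_prop

theorem ae_simplexChamber_prod :
    ∀ᵐ z ∂((volume : Measure (ℝ × ℝ)).restrict simplexChamber).prod
      ((volume : Measure ℝ).restrict (Set.Ioi (0 : ℝ))), z.1 ∈ simplexChamber ∧ 0 < z.2 :=
  (Measure.quasiMeasurePreserving_fst.ae (ae_restrict_mem measurableSet_simplexChamber)).and
    (Measure.quasiMeasurePreserving_snd.ae (ae_restrict_mem measurableSet_Ioi))

theorem quadratic_pos_of_mem_simplexChamber {p : ℝ × ℝ} (hp : p ∈ simplexChamber) {y : ℝ}
    (hy : 0 < y) : 0 < y * (1 + y) * symTwo p.1 p.2 + symThree p.1 p.2 := by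
  have h1 := symThree_pos hp
  have h2 := nine_symThree_le hp
  have h3 : 0 < symTwo p.1 p.2 := by linarith
  positivity

theorem integrable_outer_majorant :
    Integrable (fun z : (ℝ × ℝ) × ℝ =>
      (z.2 * (1 + z.2) * symTwo z.1.1 z.1.2 + symThree z.1.1 z.1.2)⁻¹)
      ((volume.restrict simplexChamber).prod (volume.restrict (Set.Ioi (0 : ℝ)))) := by
  refine ⟨Measurable.aestronglyMeasurable (by fun_prop), ?_⟩
  rw [hasFiniteIntegral_iff_ofReal, lintegral_simplexChamber_prod]
  · exact lintegral_neg_chamber_ne_top.lt_top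
  · filter_upwards [ae_simplexChamber_prod] with z hz
    exact inv_nonneg.2 (quadratic_pos_of_mem_simplexChamber hz.1 hz.2).le

theorem norm_chamberKernel_neg_le (ε : ℝ) {p : ℝ × ℝ} (hp : p ∈ simplexChamber) {y : ℝ}
    (hy : 0 < y) : ‖chamberKernel ε (-y) p.1 p.2‖ ≤
      (y * (1 + y) * symTwo p.1 p.2 + symThree p.1 p.2)⁻¹ := by
  have h := norm_chamberKernel_inv_re_le ε (-y) p.1 p.2
  have h0 := quadratic_pos_of_mem_simplexChamber hp hy
  rw [show -y * (1 - -y) * symTwo p.1 p.2 - symThree p.1 p.2 =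
    -(y * (1 + y) * symTwo p.1 p.2 + symThree p.1 p.2) by ring, abs_neg, abs_of_pos h0] at h
  rw [chamberKernel, norm_inv]
  exact inv_anti₀ h0 h

theorem integrable_chamberKernel_neg (ε : ℝ) :
    Integrable (fun z : (ℝ × ℝ) × ℝ => chamberKernel ε (-z.2) z.1.1 z.1.2)
      ((volume.restrict simplexChamber).prod (volume.restrict (Set.Ioi (0 : ℝ)))) := by
  refine integrable_outer_majorant.mono' (Measurable.aestronglyMeasurable ?_) ?_
  · exact (measurable_chamberKernel ε).comp
      (f := fun z : (ℝ × ℝ) × ℝ => (-z.2, z.1.1, z.1.2)) (by fun_prop)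
  · filter_upwards [ae_simplexChamber_prod] with z hz
    exact norm_chamberKernel_neg_le ε hz.1 hz.2

theorem tendsto_integral_chamberKernel_neg :
    Tendsto (fun ε : ℝ => (∫ p in simplexChamber, ∫ y in Set.Ioi (0 : ℝ),
      chamberKernel ε (-y) p.1 p.2).re) (𝓝[>] 0) (𝓝 (-bananaValue.toReal)) := by
  set κ := (volume.restrict simplexChamber).prod (volume.restrict (Set.Ioi (0 : ℝ)))
  have hlim : Tendsto (fun ε : ℝ => ∫ z, chamberKernel ε (-z.2) z.1.1 z.1.2 ∂κ) (𝓝[>] 0)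
      (𝓝 (∫ z, ((-z.2 * (1 - -z.2) * symTwo z.1.1 z.1.2 - symThree z.1.1 z.1.2 : ℝ) : ℂ)⁻¹ ∂κ)) := by
    refine tendsto_integral_filter_of_dominated_convergence _
      (Eventually.of_forall fun ε => (integrable_chamberKernel_neg ε).aestronglyMeasurable)
      (Eventually.of_forall fun ε => ?_) integrable_outer_majorant ?_
    · filter_upwards [ae_simplexChamber_prod] with z hz
      exact norm_chamberKernel_neg_le ε hz.1 hz.2
    · filter_upwards [ae_simplexChamber_prod] with z hz
      refine tendsto_chamberKernel _ _ _ ?_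
      have := quadratic_pos_of_mem_simplexChamber hz.1 hz.2
      exact (by linarith : _ < (0 : ℝ)).ne
  have hval : (∫ z, ((-z.2 * (1 - -z.2) * symTwo z.1.1 z.1.2 - symThree z.1.1 z.1.2 : ℝ) : ℂ)⁻¹
      ∂κ) = ((-bananaValue.toReal : ℝ) : ℂ) := by
    simp_rw [← Complex.ofReal_inv]
    rw [integral_complex_ofReal, Complex.ofReal_inj, ← neg_inj, ← integral_neg, neg_neg]
    rw [← lintegral_simplexChamber_prod, ← integral_eq_lintegral_of_nonneg_ae]
    · refine integral_congr_ae (Eventually.of_forall fun z => ?_)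
      simp only
      rw [← inv_neg]
      congr 1
      ring
    · filter_upwards [ae_simplexChamber_prod] with z hz
      exact inv_nonneg.2 (quadratic_pos_of_mem_simplexChamber hz.1 hz.2).le
    · exact integrable_outer_majorant.aestronglyMeasurable
  rw [hval] at hlim
  have := (Complex.continuous_re.tendsto _).comp hlim
  rw [Complex.ofReal_re] at this
  refine this.congr fun ε => ?_
  rw [Function.comp, integral_prod _ (integrable_chamberKernel_neg ε)]

theorem aestronglyMeasurable_integral_chamberKernel (ε : ℝ) (μ : Measure (ℝ × ℝ)) :
    AEStronglyMeasurable (fun p : ℝ × ℝ => ∫ b, chamberKernel ε b p.1 p.2) μ := by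
  refine StronglyMeasurable.aestronglyMeasurable ?_
  refine StronglyMeasurable.integral_prod_right' (f := fun q : (ℝ × ℝ) × ℝ =>
    chamberKernel ε q.2 q.1.1 q.1.2) (Measurable.stronglyMeasurable ?_)
  exact (measurable_chamberKernel ε).comp (f := fun q : (ℝ × ℝ) × ℝ => (q.2, q.1.1, q.1.2))
    (by fun_prop)

theorem norm_integral_line_le {ε : ℝ} (hε : 0 < ε) {p : ℝ × ℝ} (hp : p ∈ simplexChamber) :
    ‖∫ b, chamberKernel ε b p.1 p.2‖ ≤
      Real.pi * quarterInv (symTwo p.1 p.2 * symThree p.1 p.2) ^ 2 :=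
  norm_integral_inv_quadratic_regularised_le hε (symThree_pos hp) (nine_symThree_le hp)

theorem integrable_integral_line {ε : ℝ} (hε : 0 < ε) :
    Integrable (fun p : ℝ × ℝ => ∫ b, chamberKernel ε b p.1 p.2)
      (volume.restrict simplexChamber) := by
  refine (integrable_sym.restrict.const_mul Real.pi).mono'
    (aestronglyMeasurable_integral_chamberKernel ε _) ?_
  filter_upwards [ae_restrict_mem measurableSet_simplexChamber] with p hp
  exact norm_integral_line_le hε hp

theorem tendsto_integral_line :
    Tendsto (fun ε : ℝ => (∫ p in simplexChamber, ∫ b, chamberKernel ε b p.1 p.2).re)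
      (𝓝[>] 0) (𝓝 0) := by
  have hlim : Tendsto (fun ε : ℝ => ∫ p in simplexChamber, (∫ b, chamberKernel ε b p.1 p.2).re)
      (𝓝[>] 0) (𝓝 (∫ p in simplexChamber, (0 : ℝ))) := by
    refine tendsto_integral_filter_of_dominated_convergence _
      (Eventually.of_forall fun ε => Complex.continuous_re.comp_aestronglyMeasurable
        (aestronglyMeasurable_integral_chamberKernel ε _)) ?_
      (integrable_sym.restrict.const_mul Real.pi) ?_
    · filter_upwards [self_mem_nhdsWithin] with ε hε
      filter_upwards [ae_restrict_mem measurableSet_simplexChamber] with p hp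
      exact (Complex.abs_re_le_norm _).trans (norm_integral_line_le hε hp)
    · filter_upwards [ae_restrict_mem measurableSet_simplexChamber] with p hp
      exact tendsto_re_integral_inv_quadratic (symThree_pos hp) (nine_symThree_le hp)
  rw [integral_zero] at hlim
  refine hlim.congr' ?_
  filter_upwards [self_mem_nhdsWithin] with ε hε
  exact integral_re (𝕜 := ℂ) (integrable_integral_line hε)

theorem tendsto_integral_simplexChamber :
    Tendsto (fun ε : ℝ => (∫ p in simplexChamber, ∫ b in Set.Ioo (0 : ℝ) 1,
      chamberKernel ε b p.1 p.2).re) (𝓝[>] 0) (𝓝 (2 * bananaValue.toReal)) := by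
  have h := tendsto_integral_line.sub (tendsto_integral_chamberKernel_neg.const_mul 2)
  rw [zero_sub, mul_neg, neg_neg] at h
  refine h.congr' ?_
  filter_upwards [self_mem_nhdsWithin] with ε hε
  have e : ∫ p in simplexChamber, ∫ b in Set.Ioo (0 : ℝ) 1, chamberKernel ε b p.1 p.2 =
      ∫ p in simplexChamber, ((∫ b, chamberKernel ε b p.1 p.2) -
        2 * ∫ y in Set.Ioi (0 : ℝ), chamberKernel ε (-y) p.1 p.2) := by
    refine setIntegral_congr_fun measurableSet_simplexChamber fun p hp => ?_
    have h3 := symThree_pos hp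
    refine integral_Ioo_zero_one_of_reflect (integral_inv_quadratic_regularised hε
      (by linarith [nine_symThree_le hp]) h3).1 fun b => ?_
    simp only [chamberKernel]
    congr 3
    push_cast
    ring
  rw [e, integral_sub (integrable_integral_line hε)
    ((integrable_chamberKernel_neg ε).integral_prod_left.const_mul 2), integral_const_mul]
  simp

theorem five_mul_bananaValue : 5 * bananaValue.toReal = 2 * Real.pi * doubleLog.toReal := by
  have h := (tendsto_integral_pos_strip.sub (tendsto_integral_neg_strip.const_mul 2)).add
    (tendsto_integral_neg_chamber.const_mul 3)
  have h' := tendsto_nhds_unique (tendsto_integral_simplexChamber.congr' ?_) h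
  · change _ = _ + 3 * -bananaValue.toReal at h'
    linarith
  filter_upwards [self_mem_nhdsWithin] with ε hε
  have := integral_simplex_eq (g := fun p => ∫ b in Set.Ioo (0 : ℝ) 1, chamberKernel ε b p.1 p.2)
    (integrable_chamberKernel hε).integral_prod_right
    (fun h x => by simp_rw [chamberKernel_swap]) (fun h x => by simp_rw [chamberKernel_reflect])
  rw [simplexChamber, this]
  simp

end

theorem doubleLog_eq : doubleLog = ENNReal.ofReal (√3 / 8 * (48 * (√5 *
    (Real.Gamma (1 / 15) * Real.Gamma (2 / 15) * Real.Gamma (4 / 15) * Real.Gamma (8 / 15)) /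
      (360 * √3 * Real.pi)))) := by
  have h := halfPeriod_products_eq_doubleLog.symm.trans halfPeriod_products
  rw [ENNReal.ofReal_mul (by positivity), ← h, ← mul_assoc, ← ENNReal.ofReal_mul (by positivity),
    show √3 / 8 * (8 / √3) = 1 by field_simp, ENNReal.ofReal_one, one_mul]

theorem feynmanI_one_gamma :
    feynmanI 1 =
      Real.Gamma (1 / 15) * Real.Gamma (2 / 15) * Real.Gamma (4 / 15) * Real.Gamma (8 / 15) /
        (30 * Real.sqrt 5) := by
  have h1 : feynmanI 1 = bananaValue.toReal := feynmanI_one_eq_toReal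
  have hΓ : ∀ x : ℝ, 0 < x → 0 ≤ Real.Gamma x := fun x hx => (Real.Gamma_pos_of_pos hx).le
  have hP := mul_nonneg (mul_nonneg (mul_nonneg (hΓ (1 / 15) (by norm_num))
    (hΓ (2 / 15) (by norm_num))) (hΓ (4 / 15) (by norm_num))) (hΓ (8 / 15) (by norm_num))
  have h2 := five_mul_bananaValue
  rw [doubleLog_eq, ENNReal.toReal_ofReal (by positivity), ← h1] at h2
  generalize Real.Gamma (1 / 15) * Real.Gamma (2 / 15) * Real.Gamma (4 / 15) *
    Real.Gamma (8 / 15) = P at *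
  have h5 : √5 ^ 2 = 5 := Real.sq_sqrt (by norm_num)
  have hpi := Real.pi_pos
  have h3 : 0 < √3 := by positivity
  have e : 2 * Real.pi * (√3 / 8 * (48 * (√5 * P / (360 * √3 * Real.pi)))) = √5 * P / 30 := by
    field_simp
    ring
  rw [e] at h2
  rw [eq_div_iff (by positivity)]
  linear_combination 6 * √5 * h2 + P / 5 * h5
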